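/- arXiv:1811.12702 — 2 statements merged into one kernel-verified Lean document; each statement's English description precedes it below -/
import Mathlib

section
/- Assume hypothesis (H1) and let p₀ ≥ 0. Let W : closure(ℝⁿ ∖ C) → [0,∞) be locally Lipschitz continuous on closure(ℝⁿ ∖ C), positive definite and proper on ℝⁿ ∖ C, and suppose there exist a continuous strictly increasing γ̃ : (0,∞) → (0,∞) and a continuous function W₁ : closure(ℝⁿ ∖ C) → [0,∞), positive definite and proper on ℝⁿ ∖ C, such that H(x,p₀,p) ≤ −γ̃(W₁(x)) for every x ∈ ℝⁿ ∖ C and every p ∈ ∂_P W(x). Then there exists a (p₀/2)-Minimum Restraint Function W̄ which moreover satisfies W̄(x) ≤ W(x) for all x ∈ ℝⁿ ∖ C. -/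
open Filter Topology Metric MeasureTheory Bornology
open scoped RealInnerProductSpace ENNReal NNReal

noncomputable section

abbrev Euc (n : ℕ) : Type := EuclideanSpace ℝ (Fin n)

/-- Distance to the target set. -/
def dC {n : ℕ} (C : Set (Euc n)) (y : Euc n) : ℝ := Metric.infDist y C

/-- The Hamiltonian `H(x, p₀, p) = inf_{u ∈ U} (⟪p, f(x,u)⟫ + p₀ l(x,u))`. -/
def Ham {n m : ℕ} (U : Set (Euc m)) (f : Euc n → Euc m → Euc n) (l : Euc n → Euc m → ℝ)
    (p0 : ℝ) (x p : Euc n) : ℝ :=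
  sInf ((fun u => ⟪p, f x u⟫ + p0 * l x u) '' U)

/-- The Hamiltonian truncated to controls of norm at most `N`. -/
def HamN {n m : ℕ} (U : Set (Euc m)) (f : Euc n → Euc m → Euc n) (l : Euc n → Euc m → ℝ)
    (N : ℝ) (p0 : ℝ) (x p : Euc n) : ℝ :=
  sInf ((fun u => ⟪p, f x u⟫ + p0 * l x u) '' (U ∩ Metric.closedBall 0 N))

/-- Set of limiting gradients `D*W(x)`. -/
def limitingGradients {n : ℕ} (W : Euc n → ℝ) (x : Euc n) : Set (Euc n) :=
  {w | ∃ xk : ℕ → Euc n, (∀ k, DifferentiableAt ℝ W (xk k) ∧ xk k ≠ x) ∧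
    Tendsto xk atTop (𝓝 x) ∧ Tendsto (fun k => gradient W (xk k)) atTop (𝓝 w)}

/-- Proximal subdifferential `∂_P W(x)`. -/
def proxSubdiff {n : ℕ} (W : Euc n → ℝ) (x : Euc n) : Set (Euc n) :=
  {p | ∃ σ > (0:ℝ), ∃ η > (0:ℝ), ∀ y, ‖y - x‖ ≤ η →
    ⟪p, y - x⟫ ≤ W y - W x + σ * ‖y - x‖ ^ 2}

/-- Limiting subdifferential `∂_L W(x)`. -/
def limitingSubdiff {n : ℕ} (W : Euc n → ℝ) (x : Euc n) : Set (Euc n) :=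
  {p | ∃ (xk : ℕ → Euc n) (pk : ℕ → Euc n), (∀ k, pk k ∈ proxSubdiff W (xk k)) ∧
    Tendsto xk atTop (𝓝 x) ∧ Tendsto pk atTop (𝓝 p)}

/-- `W` is positive definite on `ℝⁿ ∖ C`. -/
def PosDefOn {n : ℕ} (C : Set (Euc n)) (W : Euc n → ℝ) : Prop :=
  (∀ x, x ∉ C → 0 < W x) ∧ ∀ x ∈ frontier C, W x = 0

/-- `W` is proper on `ℝⁿ ∖ C`: preimages (within the closure of the complement of the
target) of compact subsets of `[0,∞)` are compact. -/
def ProperOn {n : ℕ} (C : Set (Euc n)) (W : Euc n → ℝ) : Prop :=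
  ∀ Kc : Set ℝ, IsCompact Kc → Kc ⊆ Set.Ici 0 → IsCompact (closure Cᶜ ∩ W ⁻¹' Kc)

/-- `W` is locally semiconcave on `ℝⁿ ∖ C`. -/
def LocSemiconcaveOn {n : ℕ} (C : Set (Euc n)) (W : Euc n → ℝ) : Prop :=
  ∀ S : Set (Euc n), IsCompact S → S ⊆ Cᶜ → ∃ ρ > (0:ℝ),
    ∀ x y : Euc n, segment ℝ x y ⊆ S →
      W x + W y - 2 * W (midpoint ℝ x y) ≤ ρ * ‖x - y‖ ^ 2

/-- `W` is locally Lipschitz continuous on the set `s`. -/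
def LocLipschitzOn {n : ℕ} (s : Set (Euc n)) (W : Euc n → ℝ) : Prop :=
  ∀ x ∈ s, ∃ (K : ℝ≥0) (t : Set (Euc n)), t ∈ nhdsWithin x s ∧ LipschitzOnWith K W t

/-- `γ : (0,∞) → (0,∞)` is a continuous, strictly increasing rate function. -/
def RateFun (γ : ℝ → ℝ) : Prop :=
  ContinuousOn γ (Set.Ioi 0) ∧ StrictMonoOn γ (Set.Ioi 0) ∧ ∀ r, 0 < r → 0 < γ r

/-- `W` is a `p₀`-Minimum Restraint Function with rate `γ`. -/
def IsMRF {n m : ℕ} (C : Set (Euc n)) (U : Set (Euc m)) (f : Euc n → Euc m → Euc n)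
    (l : Euc n → Euc m → ℝ) (p0 : ℝ) (W : Euc n → ℝ) (γ : ℝ → ℝ) : Prop :=
  ContinuousOn W (closure Cᶜ) ∧ (∀ x ∈ closure Cᶜ, 0 ≤ W x) ∧
  LocSemiconcaveOn C W ∧ PosDefOn C W ∧ ProperOn C W ∧ RateFun γ ∧
  ∀ x, x ∉ C → ∀ p ∈ limitingGradients W x, Ham U f l p0 x p ≤ -γ (W x)

/-- `W` is a `p₀`-OMRF (original Minimum Restraint Function of Motta-Rampazzo). -/
def IsOMRF {n m : ℕ} (C : Set (Euc n)) (U : Set (Euc m)) (f : Euc n → Euc m → Euc n)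
    (l : Euc n → Euc m → ℝ) (p0 : ℝ) (W : Euc n → ℝ) : Prop :=
  ContinuousOn W (closure Cᶜ) ∧ (∀ x ∈ closure Cᶜ, 0 ≤ W x) ∧
  LocSemiconcaveOn C W ∧ PosDefOn C W ∧ ProperOn C W ∧
  ∀ x, x ∉ C → ∀ p ∈ limitingGradients W x, Ham U f l p0 x p < 0

/-- Hypothesis (H0). -/
def HypH0 {n m : ℕ} (C : Set (Euc n)) (U : Set (Euc m)) (f : Euc n → Euc m → Euc n)
    (l : Euc n → Euc m → ℝ) : Prop :=
  IsClosed C ∧ IsCompact (frontier C) ∧ IsClosed U ∧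
  (∀ x u, u ∈ U → 0 ≤ l x u) ∧
  (∀ Kc : Set (Euc n), IsCompact Kc → Kc ⊆ Cᶜ →
    UniformContinuousOn (fun q : Euc n × Euc m => f q.1 q.2) (Kc ×ˢ U) ∧
    UniformContinuousOn (fun q : Euc n × Euc m => l q.1 q.2) (Kc ×ˢ U)) ∧
  (∀ R : ℝ, 0 < R → ∃ M : ℝ, 0 < M ∧ ∀ x u, dC C x ≤ R → x ∉ C → u ∈ U →
    ‖f x u‖ ≤ M ∧ l x u ≤ M)

/-- Hypothesis (H1). -/
def HypH1 {n m : ℕ} (C : Set (Euc n)) (U : Set (Euc m)) (f : Euc n → Euc m → Euc n)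
    (l : Euc n → Euc m → ℝ) : Prop :=
  IsClosed C ∧ IsCompact (frontier C) ∧ IsClosed U ∧
  (∀ x u, u ∈ U → 0 ≤ l x u) ∧
  ContinuousOn (fun q : Euc n × Euc m => f q.1 q.2) (closure Cᶜ ×ˢ U) ∧
  ContinuousOn (fun q : Euc n × Euc m => l q.1 q.2) (closure Cᶜ ×ˢ U) ∧
  (∀ Kc : Set (Euc n), IsCompact Kc → Kc ⊆ closure Cᶜ →
    ∃ Mf Ml Lf Ll : ℝ, 0 < Mf ∧ 0 < Ml ∧ 0 < Lf ∧ 0 < Ll ∧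
      (∀ x ∈ Kc, ∀ u ∈ U, ‖f x u‖ ≤ Mf ∧ l x u ≤ Ml) ∧
      (∀ x₁ ∈ Kc, ∀ x₂ ∈ Kc, ∀ u ∈ U,
        ‖f x₁ u - f x₂ u‖ ≤ Lf * ‖x₁ - x₂‖ ∧ |l x₁ u - l x₂ u| ≤ Ll * ‖x₁ - x₂‖))

/-- A partition of `[0,∞)`. -/
structure TimePartition where
  t : ℕ → ℝ
  zero : t 0 = 0
  mono : StrictMono t
  unbounded : Tendsto t atTop atTop

/-- A class-`KL` comparison function. -/
structure IsKL (β : ℝ → ℝ → ℝ) : Prop where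
  nonneg : ∀ r t, 0 ≤ r → 0 ≤ t → 0 ≤ β r t
  cont : ∀ t, 0 ≤ t → ContinuousOn (fun r => β r t) (Set.Ici 0)
  strictMono : ∀ t, 0 ≤ t → StrictMonoOn (fun r => β r t) (Set.Ici 0)
  zero : ∀ t, 0 ≤ t → β 0 t = 0
  anti : ∀ r, 0 ≤ r → AntitoneOn (fun t => β r t) (Set.Ici 0)
  tendsto : ∀ r, 0 ≤ r → Tendsto (fun t => β r t) atTop (𝓝 0)

/-- `(x,u)` is a `π`-sampling trajectory-control pair from `z` associated with the
feedback `K`, with exit time `T`; trajectories reaching the target at a finite exit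
time are extended to `[0,∞)` by their limit value. -/
structure IsSamplingSol {n m : ℕ} (C : Set (Euc n)) (U : Set (Euc m))
    (f : Euc n → Euc m → Euc n) (K : Euc n → Euc m) (π : TimePartition) (z : Euc n)
    (x : ℝ → Euc n) (u : ℝ → Euc m) (T : ℝ≥0∞) : Prop where
  pos : 0 < T
  init : x 0 = z
  cont : ContinuousOn x (Set.Ici 0)
  ctrl : ∀ j : ℕ, ∀ t ∈ Set.Ico (π.t j) (π.t (j+1)), u t = K (x (π.t j))
  outside : ∀ t : ℝ, 0 ≤ t → ENNReal.ofReal t < T → x t ∉ C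
  deriv : ∀ t : ℝ, 0 < t → ENNReal.ofReal t < T → (∀ j, t ≠ π.t j) →
    HasDerivAt x (f (x t) (u t)) t
  exit : ∀ tr : ℝ, 0 ≤ tr → T = ENNReal.ofReal tr →
    dC C (x tr) = 0 ∧ ∀ s, tr ≤ s → x s = x tr

/-- The time `T̄ᵣ` after which the trajectory remains in the `r`-neighbourhood
of the target. -/
def Tbar {n : ℕ} (C : Set (Euc n)) (x : ℝ → Euc n) (r : ℝ) : ℝ :=
  sInf {t : ℝ | 0 < t ∧ ∀ τ, t ≤ τ → dC C (x τ) ≤ r}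

/-- `K` sample stabilizes the system to `C` with `(q,W)`-regulated cost, for initial
points in `Z`. -/
def SampleStabOn {n m : ℕ} (C : Set (Euc n)) (U : Set (Euc m))
    (f : Euc n → Euc m → Euc n) (l : Euc n → Euc m → ℝ) (K : Euc n → Euc m)
    (Z : Set (Euc n)) (q : ℝ) (W : Euc n → ℝ) : Prop :=
  ∃ β : ℝ → ℝ → ℝ, IsKL β ∧
    ∀ r R : ℝ, 0 < r → r < R → ∃ δ > (0:ℝ),
      ∀ π : TimePartition, (∀ j, π.t (j+1) - π.t j ≤ δ) →
      ∀ z ∈ Z, dC C z ≤ R →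
      ∀ x u T, IsSamplingSol C U f K π z x u T →
        (∀ t, 0 ≤ t → dC C (x t) ≤ max (β R t) r) ∧
        (∫ τ in (0:ℝ)..(Tbar C x r), l (x τ) (u τ)) ≤ W z / q

/-- `X` is an Euler trajectory of the system from `z` associated with `K`. -/
def IsEulerTraj {n m : ℕ} (C : Set (Euc n)) (U : Set (Euc m))
    (f : Euc n → Euc m → Euc n) (K : Euc n → Euc m) (z : Euc n) (X : ℝ → Euc n) : Prop :=
  ∃ (π : ℕ → TimePartition) (x : ℕ → ℝ → Euc n) (u : ℕ → ℝ → Euc m)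
    (T : ℕ → ℝ≥0∞) (δ : ℕ → ℝ),
    Tendsto δ atTop (𝓝 0) ∧ (∀ i j, (π i).t (j+1) - (π i).t j ≤ δ i) ∧
    (∀ i, IsSamplingSol C U f K (π i) z (x i) (u i) (T i)) ∧
    TendstoLocallyUniformlyOn x X atTop (Set.Ici 0)

/-- `(X, X⁰)` is an Euler trajectory-cost pair from `z` associated with `K`. -/
def IsEulerPair {n m : ℕ} (C : Set (Euc n)) (U : Set (Euc m))
    (f : Euc n → Euc m → Euc n) (l : Euc n → Euc m → ℝ) (K : Euc n → Euc m)
    (z : Euc n) (X : ℝ → Euc n) (X0 : ℝ → ℝ) : Prop :=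
  ∃ (π : ℕ → TimePartition) (x : ℕ → ℝ → Euc n) (u : ℕ → ℝ → Euc m)
    (T : ℕ → ℝ≥0∞) (δ : ℕ → ℝ),
    Tendsto δ atTop (𝓝 0) ∧ (∀ i j, (π i).t (j+1) - (π i).t j ≤ δ i) ∧
    (∀ i, IsSamplingSol C U f K (π i) z (x i) (u i) (T i)) ∧
    TendstoLocallyUniformlyOn x X atTop (Set.Ici 0) ∧
    TendstoLocallyUniformlyOn (fun i s => ∫ τ in (0:ℝ)..s, l (x i τ) (u i τ)) X0
      atTop (Set.Ici 0)

/-- The filter of approach to `T` from the left (`atTop` when `T = ∞`). -/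
def leftFilter (T : ℝ≥0∞) : Filter ℝ :=
  if T = ⊤ then Filter.atTop else nhdsWithin T.toReal (Set.Iio T.toReal)

/-- The exit time `T_X` of a (Euler) trajectory `X`. -/
def exitTimeInf {n : ℕ} (C : Set (Euc n)) (X : ℝ → Euc n) : ℝ≥0∞ :=
  sInf {τ : ℝ≥0∞ | 0 < τ ∧ (∀ t : ℝ, 0 ≤ t → ENNReal.ofReal t < τ → X t ∉ C) ∧
    Tendsto (fun t => dC C (X t)) (leftFilter τ) (𝓝 0)}

/-- `K` Euler stabilizes the system to `C` with `(q,W)`-regulated cost, for initial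
points in `Z`. -/
def EulerStabOn {n m : ℕ} (C : Set (Euc n)) (U : Set (Euc m))
    (f : Euc n → Euc m → Euc n) (l : Euc n → Euc m → ℝ) (K : Euc n → Euc m)
    (Z : Set (Euc n)) (q : ℝ) (W : Euc n → ℝ) : Prop :=
  ∃ β : ℝ → ℝ → ℝ, IsKL β ∧
    ∀ z ∈ Z,
      (∀ X, IsEulerTraj C U f K z X → ∀ t, 0 ≤ t → dC C (X t) ≤ β (dC C z) t) ∧
      (∀ X X0, IsEulerPair C U f l K z X X0 →
        ∀ t, 0 ≤ t → ENNReal.ofReal t < exitTimeInf C X → X0 t ≤ W z / q)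

/-- A locally bounded feedback taking values in the control set. -/
def IsFeedback {n m : ℕ} (C : Set (Euc n)) (U : Set (Euc m)) (K : Euc n → Euc m) : Prop :=
  (∀ x, x ∉ C → K x ∈ U) ∧
  ∀ x, x ∉ C → ∃ V ∈ 𝓝 x, Bornology.IsBounded (K '' (V \ C))

/-- `K` is a `W`-feedback: for the selection `psel x ∈ D*W(x)`, `K x` minimizes
`u ↦ ⟪psel x, f(x,u)⟫ + p₀ l(x,u)` over `U ∩ B(0, N(W x))`. -/
def IsWFeedback {n m : ℕ} (C : Set (Euc n)) (U : Set (Euc m))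
    (f : Euc n → Euc m → Euc n) (l : Euc n → Euc m → ℝ) (p0 : ℝ) (W : Euc n → ℝ)
    (N : ℝ → ℝ) (psel : Euc n → Euc n) (K : Euc n → Euc m) : Prop :=
  ∀ x, x ∉ C →
    K x ∈ U ∩ Metric.closedBall 0 (N (W x)) ∧
    ∀ v ∈ U ∩ Metric.closedBall 0 (N (W x)),
      ⟪psel x, f x (K x)⟫ + p0 * l x (K x) ≤ ⟪psel x, f x v⟫ + p0 * l x v

/-- `(x,u)` is an admissible trajectory-control pair from `z` with exit time `T`. -/
structure IsAdmissiblePair {n m : ℕ} (C : Set (Euc n)) (U : Set (Euc m))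
    (f : Euc n → Euc m → Euc n) (z : Euc n) (x : ℝ → Euc n) (u : ℝ → Euc m)
    (T : ℝ≥0∞) : Prop where
  pos : 0 < T
  init : x 0 = z
  outside : ∀ t : ℝ, 0 ≤ t → ENNReal.ofReal t < T → x t ∉ C
  ctrlmem : ∀ t : ℝ, 0 ≤ t → ENNReal.ofReal t < T → u t ∈ U
  meas : AEStronglyMeasurable u volume
  locbdd : ∀ b : ℝ, 0 ≤ b → ENNReal.ofReal b < T →
    ∃ M : ℝ, ∀ᵐ s ∂volume, s ∈ Set.Icc (0:ℝ) b → ‖u s‖ ≤ M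
  sol : ∀ t : ℝ, 0 ≤ t → ENNReal.ofReal t < T →
    x t = z + ∫ s in (0:ℝ)..t, f (x s) (u s)

end

/-- slopes -/
noncomputable def lamF (t : ℝ) : ℝ := (1 + 1 / (1 + t) ^ 2) / 2
/-- offsets -/
noncomputable def cF (t : ℝ) : ℝ := t ^ 2 / (2 * (1 + t) ^ 2)
/-- margins -/
noncomputable def epF (t : ℝ) : ℝ := t ^ 2 / (12 * (1 + t) ^ 2 * (1 + 2 * t))

lemma lamF_ge {t : ℝ} (ht : 0 < t) : 1 / 2 ≤ lamF t := by
  have : 0 < 1 / (1 + t) ^ 2 := by positivity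
  unfold lamF; linarith

lemma lamF_le {t : ℝ} (ht : 0 < t) : lamF t ≤ 1 := by
  have : 1 / (1 + t) ^ 2 ≤ 1 := by
    rw [div_le_one (by positivity)]; nlinarith
  unfold lamF; linarith

lemma cF_nonneg (t : ℝ) : 0 ≤ cF t := by unfold cF; positivity

lemma epF_pos {t : ℝ} (ht : 0 < t) : 0 < epF t := by unfold epF; positivity

lemma epF_le {t : ℝ} (ht : 0 < t) : epF t ≤ t / 12 := by
  unfold epF
  rw [div_le_div_iff₀ (by positivity) (by norm_num)]
  have h1 : t * 1 ≤ t * ((1 + t) ^ 2 * (1 + 2 * t)) := by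
    apply mul_le_mul_of_nonneg_left _ ht.le
    have : 0 ≤ t ^ 3 := by positivity
    nlinarith [sq_nonneg t]
  have h2 : t ≤ (1 + t) ^ 2 * (1 + 2 * t) := by
    have : 0 ≤ t ^ 3 := by positivity
    nlinarith [sq_nonneg t]
  nlinarith [mul_le_mul_of_nonneg_left h2 ht.le]

lemma line_le {t r : ℝ} (ht : 0 < t) (h : t ≤ 2 * r) : lamF t * r + cF t ≤ r := by
  have : r - (lamF t * r + cF t) = t * (2 * r + r * t - t) / (2 * (1 + t) ^ 2) := by
    unfold lamF cF; field_simp; ring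
  have h2 : 0 ≤ t * (2 * r + r * t - t) / (2 * (1 + t) ^ 2) := by
    have : 0 ≤ r * t := by apply mul_nonneg <;> linarith
    have : 0 ≤ 2 * r + r * t - t := by linarith
    positivity
  linarith

lemma line_diff {t r : ℝ} (ht : 0 < t) :
    (lamF t * r + cF t) - (lamF (2 * t) * r + cF (2 * t)) =
      t * ((r - t) * (1 + 2 * t) + (r - 2 * t) * (1 + t)) / (2 * (1 + t) ^ 2 * (1 + 2 * t) ^ 2) := by
  unfold lamF cF; field_simp; ring

lemma line_up {t r : ℝ} (ht : 0 < t) (h : 3 * t < r) :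
    lamF (2 * t) * r + cF (2 * t) < lamF t * r + cF t - epF t := by
  have h1 := line_diff (r := r) ht
  have h2 : epF t < t * ((r - t) * (1 + 2 * t) + (r - 2 * t) * (1 + t)) /
      (2 * (1 + t) ^ 2 * (1 + 2 * t) ^ 2) := by
    calc epF t = t * (t / 6 * (1 + 2 * t)) / (2 * (1 + t) ^ 2 * (1 + 2 * t) ^ 2) := by
          unfold epF; field_simp; ring
      _ < _ := by
          gcongr
          have : 0 < (r - 2 * t) * (1 + t) := by apply mul_pos <;> linarith
          have : t / 6 * (1 + 2 * t) ≤ (r - t) * (1 + 2 * t) := by gcongr; linarith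
          linarith
  linarith

lemma line_down {t r : ℝ} (ht : 0 < t) (h : r < t / 3) :
    lamF (t / 2) * r + cF (t / 2) < lamF t * r + cF t - epF t := by
  obtain ⟨s, rfl⟩ : ∃ s, t = 2 * s := ⟨t / 2, by ring⟩
  have hs : 0 < s := by linarith
  rw [mul_div_cancel_left₀ _ (by norm_num : (2:ℝ) ≠ 0)]
  have h1 := line_diff (r := r) hs
  have h2 : epF (2 * s) < - (s * ((r - s) * (1 + 2 * s) + (r - 2 * s) * (1 + s)) /
      (2 * (1 + s) ^ 2 * (1 + 2 * s) ^ 2)) := by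
    calc epF (2 * s) ≤ s ^ 2 / (3 * (1 + s) * (1 + 2 * s) ^ 2) := by
          unfold epF
          rw [div_le_div_iff₀ (by positivity) (by positivity)]
          have : 0 ≤ s ^ 2 * (1 + 2 * s) ^ 2 * s := by positivity
          nlinarith
      _ = s * (2 / 3 * s * (1 + s)) / (2 * (1 + s) ^ 2 * (1 + 2 * s) ^ 2) := by
          field_simp
      _ < s * (-((r - s) * (1 + 2 * s) + (r - 2 * s) * (1 + s))) /
          (2 * (1 + s) ^ 2 * (1 + 2 * s) ^ 2) := by
          gcongr
          have : 0 < (s - r) * (1 + 2 * s) := by apply mul_pos <;> linarith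
          have : 2 / 3 * s * (1 + s) ≤ (2 * s - r) * (1 + s) := by gcongr; linarith
          linarith
      _ = _ := by ring
  linarith

lemma exists_rate (S : Set (ℝ × ℝ)) (hpos : ∀ q ∈ S, 0 < q.1)
    (hS : ∀ a > (0:ℝ), ∃ c > (0:ℝ), ∀ q ∈ S, a ≤ q.1 → c ≤ q.2) :
    ∃ γ : ℝ → ℝ, RateFun γ ∧ ∀ q ∈ S, γ q.1 ≤ q.2 := by
  classical
  have hne : Nonempty (insert ((1:ℝ), (1:ℝ)) S : Set (ℝ × ℝ)) := ⟨⟨_, Set.mem_insert _ _⟩⟩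
  set T := insert ((1:ℝ), (1:ℝ)) S with hT
  have hTpos : ∀ q ∈ T, 0 < q.1 := by
    rintro q (rfl | hq)
    · norm_num
    · exact hpos q hq
  have hTS : ∀ a > (0:ℝ), ∃ c > (0:ℝ), ∀ q ∈ T, a ≤ q.1 → c ≤ q.2 := by
    intro a ha
    obtain ⟨c, hc, h⟩ := hS a ha
    refine ⟨min c 1, by positivity, ?_⟩
    rintro q (rfl | hq) haq
    · exact min_le_right _ _
    · exact (min_le_left _ _).trans (h q hq haq)
  have hT0 : ∀ q ∈ T, 0 ≤ q.2 := by
    intro q hq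
    obtain ⟨c, hc, h⟩ := hTS q.1 (hTpos q hq)
    exact hc.le.trans (h q hq le_rfl)
  let G : ℝ → ℝ := fun r => ⨅ q : T, (q.1.2 + max (r - q.1.1) 0)
  have hbdd : ∀ r, BddBelow (Set.range fun q : T => (q.1.2 + max (r - q.1.1) 0)) := by
    intro r
    refine ⟨0, ?_⟩
    rintro _ ⟨q, rfl⟩
    have := hT0 q.1 q.2
    have := le_max_right (r - q.1.1) 0
    show 0 ≤ _
    linarith
  have hGmono : Monotone G := by
    intro r s hrs
    refine ciInf_mono (hbdd r) ?_
    intro q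
    have : max (r - q.1.1) 0 ≤ max (s - q.1.1) 0 := max_le_max (by linarith) le_rfl
    linarith
  have hGl : ∀ r s, r ≤ s → G s ≤ G r + (s - r) := by
    intro r s hrs
    have : G s - (s - r) ≤ G r := by
      refine le_ciInf ?_
      intro q
      have h1 : G s ≤ q.1.2 + max (s - q.1.1) 0 := ciInf_le (hbdd s) q
      have : max (s - q.1.1) 0 ≤ max (r - q.1.1) 0 + (s - r) := by
        apply max_le
        · linarith [le_max_left (r - q.1.1) 0]
        · linarith [le_max_right (r - q.1.1) 0]
      linarith
    linarith
  have hGpos : ∀ r, 0 < r → 0 < G r := by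
    intro r hr
    obtain ⟨c, hc, h⟩ := hTS (r / 2) (by positivity)
    refine lt_of_lt_of_le (by positivity : 0 < min c (r / 2)) (le_ciInf ?_)
    intro q
    by_cases hq : r / 2 ≤ q.1.1
    · have := h q.1 q.2 hq
      linarith [min_le_left c (r / 2), le_max_right (r - q.1.1) 0]
    · have := hT0 q.1 q.2
      linarith [min_le_right c (r / 2), le_max_left (r - q.1.1) 0]
  have hGc : Continuous G := by
    have : LipschitzWith 1 G := by
      apply LipschitzWith.of_le_add
      intro x y
      rcases le_total x y with h | h
      · linarith [hGmono h, dist_nonneg (x := x) (y := y)]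
      · rw [Real.dist_eq, abs_of_nonneg (by linarith)]; exact hGl y x h
    exact this.continuous
  refine ⟨fun r => G r * (1 - 1 / (1 + r)), ⟨?_, ?_, ?_⟩, ?_⟩
  · apply hGc.continuousOn.mul
    apply continuousOn_const.sub
    apply continuousOn_const.div (by fun_prop)
    intro x hx
    have : 0 < x := hx
    positivity
  · intro r hr s hs hrs
    have hr : 0 < r := hr
    have hs : 0 < s := hs
    have h1 : 1 / (1 + s) < 1 / (1 + r) := by
      apply one_div_lt_one_div_of_lt <;> linarith
    have h3 : 1 / (1 + r) < 1 := by rw [div_lt_one] <;> linarith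
    have := hGpos r hr
    have := hGpos s hs
    have := hGmono hrs.le
    show G r * _ < G s * _
    calc G r * (1 - 1 / (1 + r)) ≤ G s * (1 - 1 / (1 + r)) := by
          apply mul_le_mul_of_nonneg_right this; linarith
      _ < _ := by apply mul_lt_mul_of_pos_left <;> linarith
  · intro r hr
    have h3 : 1 / (1 + r) < 1 := by rw [div_lt_one] <;> linarith
    exact mul_pos (hGpos r hr) (by linarith)
  · intro q hq
    have hq0 := hpos q hq
    have h1 : G q.1 ≤ q.2 + max (q.1 - q.1) 0 :=
      ciInf_le (hbdd q.1) ⟨q, Set.mem_insert_of_mem _ hq⟩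
    have h3 : 0 < 1 / (1 + q.1) := by positivity
    have := hGpos _ hq0
    simp only [sub_self, max_self, add_zero] at h1
    show G q.1 * _ ≤ _
    nlinarith

section Main
variable {n m : ℕ} {C : Set (Euc n)} {U : Set (Euc m)}
    {f : Euc n → Euc m → Euc n} {l : Euc n → Euc m → ℝ}

lemma Ham_exists {p0 : ℝ} {x p : Euc n} {c : ℝ} (hc : 0 < c) (h : Ham U f l p0 x p ≤ -c) :
    ∀ ε > (0:ℝ), ∃ u ∈ U, ⟪p, f x u⟫ + p0 * l x u < -c + ε := by
  intro ε hε
  have hU : U.Nonempty := by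
    by_contra hU
    rw [Set.not_nonempty_iff_eq_empty] at hU
    subst hU
    simp [Ham] at h
    linarith
  obtain ⟨_, ⟨u, hu, rfl⟩, h2⟩ := exists_lt_of_csInf_lt (hU.image _)
    (lt_of_le_of_lt h (by linarith : -c < -c + ε))
  exact ⟨u, hu, h2⟩

lemma Ham_le_of {p0 : ℝ} (hp0 : 0 ≤ p0) {x p : Euc n} {B M : ℝ}
    (hl : ∀ u ∈ U, 0 ≤ l x u) (hM : ∀ u ∈ U, ‖f x u‖ ≤ M)
    (h : ∀ ε > (0:ℝ), ∃ u ∈ U, ⟪p, f x u⟫ + p0 * l x u ≤ B + ε) :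
    Ham U f l p0 x p ≤ B := by
  have hb : BddBelow ((fun u => ⟪p, f x u⟫ + p0 * l x u) '' U) := by
    refine ⟨-(‖p‖ * M), ?_⟩
    rintro _ ⟨u, hu, rfl⟩
    have h1 := abs_real_inner_le_norm p (f x u)
    have h2 : ‖p‖ * ‖f x u‖ ≤ ‖p‖ * M := by gcongr; exact hM u hu
    have h3 := mul_nonneg hp0 (hl u hu)
    have := neg_abs_le (⟪p, f x u⟫)
    show _ ≤ ⟪p, f x u⟫ + p0 * l x u
    linarith
  apply le_of_forall_pos_le_add
  intro ε hε
  obtain ⟨u, hu, h2⟩ := h ε hε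
  exact (csInf_le hb ⟨u, hu, rfl⟩).trans h2

lemma Ham_limit (hH1 : HypH1 C U f l) {p0 : ℝ} (hp0 : 0 ≤ p0) {x p : Euc n} (hx : x ∉ C)
    {c : ℝ} (hc : 0 < c)
    {xk pk : ℕ → Euc n} (h1 : Tendsto xk atTop (𝓝 x)) (h2 : Tendsto pk atTop (𝓝 p))
    (h : ∀ᶠ k in atTop, Ham U f l p0 (xk k) (pk k) ≤ -c) : Ham U f l p0 x p ≤ -c := by
  obtain ⟨hC, -, -, hl, -, -, hK⟩ := hH1
  obtain ⟨r, hr, hrC⟩ := Metric.nhds_basis_closedBall.mem_iff.1 (hC.isOpen_compl.mem_nhds hx)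
  obtain ⟨Mf, Ml, Lf, Ll, hMf, hMl, hLf, hLl, hb, hlip⟩ :=
    hK (closedBall x r) (isCompact_closedBall x r) (hrC.trans subset_closure)
  have hxm : x ∈ closedBall x r := mem_closedBall_self hr.le
  refine Ham_le_of hp0 (fun u hu => hl x u hu) (fun u hu => (hb x hxm u hu).1) ?_
  intro ε hε
  have hE : Tendsto (fun k => ‖p‖ * (Lf * ‖x - xk k‖) + ‖p - pk k‖ * Mf + p0 * (Ll * ‖x - xk k‖))
      atTop (𝓝 (‖p‖ * (Lf * ‖x - x‖) + ‖p - p‖ * Mf + p0 * (Ll * ‖x - x‖))) := by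
    have e1 := (tendsto_const_nhds (x := x)).sub h1 |>.norm
    have e2 := (tendsto_const_nhds (x := p)).sub h2 |>.norm
    exact (((e1.const_mul Lf).const_mul ‖p‖).add (e2.mul_const Mf)).add ((e1.const_mul Ll).const_mul p0)
  simp only [sub_self, norm_zero, mul_zero, zero_mul, add_zero] at hE
  obtain ⟨k, hk1, hk2, hk3⟩ := (h.and ((hE.eventually_lt_const (half_pos hε)).and
    (h1.eventually (closedBall_mem_nhds x hr)))).exists
  obtain ⟨u, hu, hu2⟩ := Ham_exists hc hk1 (ε / 2) (half_pos hε)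
  refine ⟨u, hu, ?_⟩
  have hl1 := (hlip x hxm _ hk3 u hu).1
  have hl2 := (hlip x hxm _ hk3 u hu).2
  have e : ⟪p, f x u⟫ = ⟪pk k, f (xk k) u⟫ + ⟪p, f x u - f (xk k) u⟫ + ⟪p - pk k, f (xk k) u⟫ := by
    rw [inner_sub_left, inner_sub_right]; ring
  have i1 : ⟪p, f x u - f (xk k) u⟫ ≤ ‖p‖ * (Lf * ‖x - xk k‖) :=
    (real_inner_le_norm _ _).trans (by gcongr)
  have i2 : ⟪p - pk k, f (xk k) u⟫ ≤ ‖p - pk k‖ * Mf :=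
    (real_inner_le_norm _ _).trans (by gcongr; exact (hb _ hk3 u hu).1)
  have i3 : p0 * l x u ≤ p0 * l (xk k) u + p0 * (Ll * ‖x - xk k‖) := by
    rw [← mul_add]
    apply mul_le_mul_of_nonneg_left _ hp0
    linarith [le_abs_self (l x u - l (xk k) u)]
  linarith

lemma notMem_of_pos (_hC : IsClosed C) {W : Euc n → ℝ} (hWpd : PosDefOn C W) {x : Euc n}
    (hx : x ∈ closure Cᶜ) (h : 0 < W x) : x ∉ C := by
  intro hxC
  have : x ∈ frontier C := by
    rw [frontier_eq_closure_inter_closure]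
    exact ⟨subset_closure hxC, hx⟩
  linarith [hWpd.2 x this]

lemma W1_lower (hC : IsClosed C) {W W1 : Euc n → ℝ} (hWc : ContinuousOn W (closure Cᶜ))
    (hWpd : PosDefOn C W)
    (hW1c : ContinuousOn W1 (closure Cᶜ)) (hW1nn : ∀ x ∈ closure Cᶜ, 0 ≤ W1 x)
    (hW1pd : PosDefOn C W1) (hW1pr : ProperOn C W1) {a : ℝ} (ha : 0 < a) :
    ∃ c > (0:ℝ), ∀ x, x ∉ C → a ≤ W x → c ≤ W1 x := by
  have hK := hW1pr (Set.Icc 0 1) isCompact_Icc Set.Icc_subset_Ici_self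
  set K := closure Cᶜ ∩ W1 ⁻¹' Set.Icc 0 1
  have hK2 : IsCompact (K ∩ W ⁻¹' Set.Ici a) := by
    apply hK.of_isClosed_subset _ Set.inter_subset_left
    exact (hWc.mono Set.inter_subset_left).preimage_isClosed_of_isClosed hK.isClosed isClosed_Ici
  rcases (K ∩ W ⁻¹' Set.Ici a).eq_empty_or_nonempty with he | hne
  · refine ⟨1, one_pos, fun x hx hax => ?_⟩
    by_contra hlt
    have hx' : x ∈ closure Cᶜ := subset_closure hx
    have : x ∈ K ∩ W ⁻¹' Set.Ici a := ⟨⟨hx', hW1nn x hx', by linarith⟩, hax⟩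
    simp [he] at this
  · obtain ⟨z, hz, hmin⟩ := hK2.exists_isMinOn hne
      (hW1c.mono (Set.inter_subset_left.trans Set.inter_subset_left))
    have hzC : z ∉ C := notMem_of_pos hC hWpd hz.1.1 (lt_of_lt_of_le ha hz.2)
    refine ⟨min 1 (W1 z), lt_min one_pos (hW1pd.1 z hzC), fun x hx hax => ?_⟩
    by_contra hlt
    push Not at hlt
    have hx' : x ∈ closure Cᶜ := subset_closure hx
    have : x ∈ K ∩ W ⁻¹' Set.Ici a :=
      ⟨⟨hx', hW1nn x hx', hlt.le.trans (min_le_left _ _)⟩, hax⟩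
    have := hmin this
    simp only [Set.mem_ofPred_eq] at this
    linarith [min_le_right 1 (W1 z)]

lemma level_lemma {p0 : ℝ} {W W1 : Euc n → ℝ} {γt : ℝ → ℝ}
    (hH1 : HypH1 C U f l) (hp0 : 0 ≤ p0)
    (hWc : ContinuousOn W (closure Cᶜ))
    (hWlip : LocLipschitzOn (closure Cᶜ) W)
    (hWpd : PosDefOn C W) (hWpr : ProperOn C W)
    (hγ : RateFun γt)
    (hW1c : ContinuousOn W1 (closure Cᶜ)) (hW1nn : ∀ x ∈ closure Cᶜ, 0 ≤ W1 x)
    (hW1pd : PosDefOn C W1) (hW1pr : ProperOn C W1)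
    (hdec : ∀ x, x ∉ C → ∀ p ∈ proxSubdiff W x, Ham U f l p0 x p ≤ -γt (W1 x))
    {t ε : ℝ} (ht : 0 < t) (hε : 0 < ε) (hεt : ε ≤ t / 12) :
    ∃ δ > (0:ℝ), ∃ α > (0:ℝ), ∀ x, x ∉ C → W x ∈ Set.Icc (t / 4) (4 * t) →
      (∀ y, ‖y - x‖ ≤ δ → y ∉ C ∧ |W y - W x| ≤ ε) ∧
      (∀ y, ‖y - x‖ ≤ δ → W y + α * ‖x - y‖ ^ 2 ≤ W x → ‖y - x‖ ≤ δ / 2) ∧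
      (∀ y, ‖y - x‖ ≤ δ / 2 →
        (∀ z, ‖z - x‖ ≤ δ → W y + α * ‖x - y‖ ^ 2 ≤ W z + α * ‖x - z‖ ^ 2) →
        ∀ lam, 1 / 2 ≤ lam → lam ≤ 1 →
          Ham U f l (p0 / 2) x ((2 * (lam * α)) • (x - y)) ≤ -(γt (W1 y) / 4)) := by
  obtain ⟨hC, -, -, hl, -, -, hKH⟩ := hH1
  have hK := hWpr (Set.Icc (t / 4) (4 * t)) isCompact_Icc
    (fun r hr => by have := hr.1; show 0 ≤ r; linarith)
  set K := closure Cᶜ ∩ W ⁻¹' Set.Icc (t / 4) (4 * t) with hKdef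
  have hKC : K ⊆ Cᶜ := fun x hx =>
    notMem_of_pos hC hWpd hx.1 (lt_of_lt_of_le (by positivity) hx.2.1)
  obtain ⟨η, hη, hηC⟩ := hK.exists_cthickening_subset_open hC.isOpen_compl hKC
  have hK' : IsCompact (cthickening η K) := hK.cthickening
  have hK'c : cthickening η K ⊆ closure Cᶜ := hηC.trans subset_closure
  have hLL : LocallyLipschitzOn (cthickening η K) W := by
    intro x hx
    obtain ⟨k, s, hs, h⟩ := hWlip x (hK'c hx)
    exact ⟨k, s, nhdsWithin_mono _ hK'c hs, h⟩
  obtain ⟨L0, hL0⟩ := hLL.exists_lipschitzOnWith_of_compact hK'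
  set L : ℝ := L0 + 1 with hL
  have hLpos : 0 < L := by positivity
  have hWL : ∀ x ∈ cthickening η K, ∀ y ∈ cthickening η K, |W x - W y| ≤ L * ‖x - y‖ := by
    intro x hx y hy
    have := hL0.dist_le_mul x hx y hy
    rw [Real.dist_eq, dist_eq_norm] at this
    have h2 := norm_nonneg (x - y)
    nlinarith
  obtain ⟨Mf, Ml, Lf, Ll, hMf, hMl, hLf, hLl, hb, hlip⟩ := hKH _ hK' hK'c
  obtain ⟨w, hw, hwW⟩ := W1_lower hC hWc hWpd hW1c hW1nn hW1pd hW1pr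
    (by positivity : 0 < t / 8)
  set g := γt w
  have hg : 0 < g := hγ.2.2 w hw
  set Q := 2 * L * Lf + p0 * Ll + 1 with hQ
  have hQpos : 0 < Q := by positivity
  obtain ⟨δ, hδ, hδη, hδε, hδQ⟩ : ∃ δ > (0:ℝ), δ ≤ η ∧ L * δ ≤ ε ∧ Q * δ ≤ g / 2 := by
    refine ⟨min η (min (ε / L) (g / 2 / Q)), by positivity, min_le_left _ _, ?_, ?_⟩
    · have : min η (min (ε / L) (g / 2 / Q)) ≤ ε / L := (min_le_right _ _).trans (min_le_left _ _)
      rw [le_div_iff₀ hLpos] at this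
      linarith
    · have : min η (min (ε / L) (g / 2 / Q)) ≤ g / 2 / Q :=
        (min_le_right _ _).trans (min_le_right _ _)
      rw [le_div_iff₀ hQpos] at this
      linarith
  refine ⟨δ, hδ, 2 * L / δ, by positivity, ?_⟩
  set α := 2 * L / δ with hα
  have hαpos : 0 < α := by positivity
  have hαδ : α * δ = 2 * L := by rw [hα]; field_simp
  intro x hxC hxW
  have hxK : x ∈ K := ⟨subset_closure hxC, hxW⟩
  have hxK' : x ∈ cthickening η K := self_subset_cthickening K hxK
  have hmem : ∀ y, ‖y - x‖ ≤ δ → y ∈ cthickening η K := by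
    intro y hy
    apply mem_cthickening_of_dist_le y x η K hxK
    rw [dist_eq_norm]; linarith
  have hnear : ∀ y, ‖y - x‖ ≤ δ → |W y - W x| ≤ ε := by
    intro y hy
    refine (hWL y (hmem y hy) x hxK').trans (le_trans ?_ hδε)
    gcongr
  have hstep : ∀ y, ‖y - x‖ ≤ δ → W y + α * ‖x - y‖ ^ 2 ≤ W x → α * ‖x - y‖ ≤ L := by
    intro y hy h
    have h1 := hWL y (hmem y hy) x hxK'
    rw [norm_sub_rev y x] at h1
    have h2 := neg_abs_le (W y - W x)
    rcases (norm_nonneg (x - y)).eq_or_lt with h0 | h0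
    · rw [← h0]; simpa using hLpos.le
    · have : (α * ‖x - y‖) * ‖x - y‖ ≤ L * ‖x - y‖ := by nlinarith
      exact le_of_mul_le_mul_right this h0
  refine ⟨fun y hy => ⟨hηC (hmem y hy), hnear y hy⟩, ?_, ?_⟩
  · intro y hy h
    have := hstep y hy h
    rw [norm_sub_rev y x]
    have h3 : α * ‖x - y‖ ≤ α * (δ / 2) := by linarith
    exact le_of_mul_le_mul_left h3 hαpos
  · intro y hy hmin lam hlam1 hlam2
    have hyδ : ‖y - x‖ ≤ δ := by linarith
    have hyC : y ∉ C := hηC (hmem y hyδ)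
    have hyx : W y + α * ‖x - y‖ ^ 2 ≤ W x := by
      have := hmin x (by simpa using hδ.le)
      simpa using this
    have hs := hstep y hyδ hyx
    have hp : (2 * α) • (x - y) ∈ proxSubdiff W y := by
      refine ⟨α, hαpos, δ / 2, by positivity, ?_⟩
      intro z hz
      have hzx : ‖z - x‖ ≤ δ := by
        calc ‖z - x‖ = ‖(z - y) + (y - x)‖ := by congr 1; abel
          _ ≤ ‖z - y‖ + ‖y - x‖ := norm_add_le _ _
          _ ≤ δ := by linarith
      have h1 := hmin z hzx
      have h2 : ‖x - z‖ ^ 2 = ‖x - y‖ ^ 2 - 2 * ⟪x - y, z - y⟫ + ‖z - y‖ ^ 2 := by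
        rw [← norm_sub_sq_real]; congr 2; abel
      rw [h2] at h1
      rw [real_inner_smul_left]
      linarith
    have hH := hdec y hyC _ hp
    have hWy : t / 8 ≤ W y := by
      have := hnear y hyδ
      have := neg_abs_le (W y - W x)
      have := hxW.1
      linarith
    have hw1 := hwW y hyC hWy
    have hgy : g ≤ γt (W1 y) := hγ.2.1.monotoneOn hw (lt_of_lt_of_le hw hw1) hw1
    have hE := Ham_exists (lt_of_lt_of_le hg hgy) hH
    refine Ham_le_of (by positivity) (fun u hu => hl x u hu)
      (fun u hu => (hb x hxK' u hu).1) ?_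
    intro e he
    obtain ⟨u, hu, hu2⟩ := hE e he
    refine ⟨u, hu, ?_⟩
    obtain ⟨hl1, hl2⟩ := hlip x hxK' y (hmem y hyδ) u hu
    set p := (2 * α) • (x - y) with hpdef
    have hpn : ‖p‖ ≤ 2 * L := by
      rw [hpdef, norm_smul, Real.norm_of_nonneg (by positivity)]
      linarith
    have hp2 : (2 * (lam * α)) • (x - y) = lam • p := by
      rw [hpdef, smul_smul]; congr 1; ring
    have e1 : ⟪p, f x u⟫ = ⟪p, f y u⟫ + ⟪p, f x u - f y u⟫ := by
      rw [inner_sub_right]; ring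
    have hxyδ : ‖x - y‖ ≤ δ := by rw [norm_sub_rev]; exact hyδ
    have i1 : ⟪p, f x u - f y u⟫ ≤ 2 * L * (Lf * δ) := by
      refine (real_inner_le_norm _ _).trans ?_
      have : ‖f x u - f y u‖ ≤ Lf * δ := hl1.trans (by gcongr)
      gcongr
    have i3 : p0 * l x u ≤ p0 * l y u + p0 * (Ll * δ) := by
      rw [← mul_add]
      apply mul_le_mul_of_nonneg_left _ hp0
      have : Ll * ‖x - y‖ ≤ Ll * δ := by gcongr
      linarith [le_abs_self (l x u - l y u)]
    have i4 : ⟪p, f x u⟫ + p0 * l x u ≤ -(γt (W1 y) / 2) + e := by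
      have : Q * δ = 2 * L * (Lf * δ) + p0 * (Ll * δ) + δ := by rw [hQ]; ring
      linarith
    rw [hp2, real_inner_smul_left]
    have hlx := mul_nonneg hp0 (hl x u hu)
    have i5 : p0 / 2 * l x u ≤ lam * (p0 * l x u) := by nlinarith
    have i6 : lam * (⟪p, f x u⟫ + p0 * l x u) ≤ lam * (-(γt (W1 y) / 2) + e) := by gcongr
    have hγ0 : 0 < γt (W1 y) := lt_of_lt_of_le hg hgy
    have i7 : 1 / 2 * γt (W1 y) ≤ lam * γt (W1 y) := by gcongr
    have i8 : lam * e ≤ 1 * e := by gcongr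
    have i9 : lam * (⟪p, f x u⟫ + p0 * l x u) = lam * ⟪p, f x u⟫ + lam * (p0 * l x u) := by ring
    have i10 : lam * (-(γt (W1 y) / 2) + e) = -(lam * γt (W1 y) / 2) + lam * e := by ring
    linarith

/-- The value of the term `(k, y)` at `x`. -/
noncomputable def valF (W : Euc n → ℝ) (α : ℤ → ℝ) (x : Euc n) (q : ℤ × Euc n) : ℝ :=
  lamF ((2:ℝ) ^ q.1) * (W q.2 + α q.1 * ‖x - q.2‖ ^ 2) + cF ((2:ℝ) ^ q.1)

/-- The admissible terms at `x`. -/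
def avF (W : Euc n → ℝ) (δ : ℤ → ℝ) (x : Euc n) : Set (ℤ × Euc n) :=
  {q | W x ∈ Set.Icc ((2:ℝ) ^ q.1 / 4) (4 * (2:ℝ) ^ q.1) ∧ ‖q.2 - x‖ ≤ δ q.1}

lemma finite_zpow {a b : ℝ} (ha : 0 < a) : {k : ℤ | a ≤ (2:ℝ) ^ k ∧ (2:ℝ) ^ k ≤ b}.Finite := by
  rcases lt_or_ge b a with h | h
  · convert Set.finite_empty
    ext k; simp; intro h1; linarith
  obtain ⟨i, hi⟩ := exists_mem_Ico_zpow ha (one_lt_two)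
  obtain ⟨j, hj⟩ := exists_mem_Ico_zpow (ha.trans_le h) (one_lt_two)
  apply (Set.finite_Icc i j).subset
  rintro k ⟨h1, h2⟩
  constructor
  · exact (zpow_le_zpow_iff_right₀ one_lt_two).1 (hi.1.trans h1)
  · have := (zpow_lt_zpow_iff_right₀ one_lt_two).1 (lt_of_le_of_lt h2 hj.2)
    omega

end Main

/-- Theorem 4.3: under (H1), a locally Lipschitz `p₀`-MRF yields a genuine
(semiconcave) `(p₀/2)`-MRF below it. -/
theorem lipschitz_mrf_implies_semiconcave_half_mrf
    {n m : ℕ} (C : Set (Euc n)) (U : Set (Euc m))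
    (f : Euc n → Euc m → Euc n) (l : Euc n → Euc m → ℝ)
    (p0 : ℝ) (W W1 : Euc n → ℝ) (γt : ℝ → ℝ)
    (hH1 : HypH1 C U f l) (hp0 : 0 ≤ p0)
    (hWc : ContinuousOn W (closure Cᶜ)) (hWnn : ∀ x ∈ closure Cᶜ, 0 ≤ W x)
    (hWlip : LocLipschitzOn (closure Cᶜ) W)
    (hWpd : PosDefOn C W) (hWpr : ProperOn C W)
    (hγ : RateFun γt)
    (hW1c : ContinuousOn W1 (closure Cᶜ)) (hW1nn : ∀ x ∈ closure Cᶜ, 0 ≤ W1 x)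
    (hW1pd : PosDefOn C W1) (hW1pr : ProperOn C W1)
    (hdec : ∀ x, x ∉ C → ∀ p ∈ proxSubdiff W x, Ham U f l p0 x p ≤ -γt (W1 x)) :
    ∃ (Wb : Euc n → ℝ) (γb : ℝ → ℝ), IsMRF C U f l (p0 / 2) Wb γb ∧
      ∀ x, x ∉ C → Wb x ≤ W x := by
  classical
  have hC := hH1.1
  have hl := hH1.2.2.2.1
  have h2pos : ∀ k : ℤ, (0:ℝ) < 2 ^ k := fun k => zpow_pos two_pos k
  have hlev := fun k : ℤ => level_lemma hH1 hp0 hWc hWlip hWpd hWpr hγ hW1c hW1nn hW1pd hW1pr hdec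
    (h2pos k) (epF_pos (h2pos k)) (epF_le (h2pos k))
  choose δ hδ α hα hL using hlev
  -- existence of optimal terms
  have hex : ∀ x, x ∉ C → ∃ q ∈ avF W δ x, ∀ q' ∈ avF W δ x, valF W α x q ≤ valF W α x q' := by
    intro x hx
    have hWx := hWpd.1 x hx
    have hy : ∀ k : ℤ, W x ∈ Set.Icc ((2:ℝ) ^ k / 4) (4 * (2:ℝ) ^ k) →
        ∃ y, ‖y - x‖ ≤ δ k ∧ ∀ z, ‖z - x‖ ≤ δ k →
          W y + α k * ‖x - y‖ ^ 2 ≤ W z + α k * ‖x - z‖ ^ 2 := by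
      intro k hk
      have hsub : closedBall x (δ k) ⊆ closure Cᶜ := by
        intro y hy
        rw [mem_closedBall, dist_eq_norm] at hy
        exact subset_closure ((hL k x hx hk).1 y hy).1
      have hcont : ContinuousOn (fun z => W z + α k * ‖x - z‖ ^ 2) (closedBall x (δ k)) := by
        apply (hWc.mono hsub).add
        fun_prop
      obtain ⟨y, hy, hmin⟩ := (isCompact_closedBall x (δ k)).exists_isMinOn
        ⟨x, mem_closedBall_self (hδ k).le⟩ hcont
      rw [mem_closedBall, dist_eq_norm] at hy
      refine ⟨y, hy, fun z hz => ?_⟩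
      have : z ∈ closedBall x (δ k) := by rwa [mem_closedBall, dist_eq_norm]
      exact hmin this
    choose! Y hY1 hY2 using hy
    set F := {k : ℤ | W x ∈ Set.Icc ((2:ℝ) ^ k / 4) (4 * (2:ℝ) ^ k)} with hF
    have hFfin : F.Finite := by
      apply (finite_zpow (a := W x / 4) (b := 4 * W x) (by positivity)).subset
      rintro k ⟨h1, h2⟩
      constructor <;> linarith
    have hFne : F.Nonempty := by
      obtain ⟨k, hk1, hk2⟩ := exists_mem_Ico_zpow hWx (one_lt_two)
      rw [zpow_add_one₀ (by norm_num)] at hk2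
      have := h2pos k
      exact ⟨k, by constructor <;> linarith⟩
    obtain ⟨k, hk, hkmin⟩ := Set.exists_min_image F (fun k => valF W α x (k, Y k)) hFfin hFne
    refine ⟨(k, Y k), ⟨hk, hY1 k hk⟩, ?_⟩
    rintro ⟨j, z⟩ ⟨hj, hz⟩
    refine (hkmin j hj).trans ?_
    have h1 := hY2 j hj z hz
    have h2 := lamF_ge (h2pos j)
    simp only [valF]
    gcongr
  choose! q hqav hqmin using hex
  set Wb : Euc n → ℝ := fun x => if x ∈ C then 0 else valF W α x (q x) with hWb
  have hWbC : ∀ x, x ∈ C → Wb x = 0 := fun x hx => by simp [hWb, hx]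
  have hWbv : ∀ x, x ∉ C → Wb x = valF W α x (q x) := fun x hx => by simp [hWb, hx]
  have hWble : ∀ x, x ∉ C → ∀ q' ∈ avF W δ x, Wb x ≤ valF W α x q' := fun x hx q' hq' => by
    rw [hWbv x hx]; exact hqmin x hx q' hq'
  have htriv : ∀ x, x ∉ C → ∀ k : ℤ, W x ∈ Set.Icc ((2:ℝ) ^ k / 4) (4 * (2:ℝ) ^ k) →
      Wb x ≤ lamF ((2:ℝ) ^ k) * W x + cF ((2:ℝ) ^ k) := by
    intro x hx k hk
    have := hWble x hx (k, x) ⟨hk, by simpa using (hδ k).le⟩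
    simpa [valF] using this
  have hWbW : ∀ x, x ∉ C → Wb x ≤ W x := by
    intro x hx
    have hWx := hWpd.1 x hx
    obtain ⟨k, hk1, hk2⟩ := exists_mem_Ico_zpow hWx (one_lt_two)
    rw [zpow_add_one₀ (by norm_num)] at hk2
    have := h2pos k
    refine (htriv x hx k (by constructor <;> linarith)).trans ?_
    exact line_le this (by linarith)
  -- properties of the optimal term
  have hopt : ∀ x, x ∉ C → ∃ k : ℤ, ∃ y, Wb x = valF W α x (k, y) ∧
      W x ∈ Set.Icc ((2:ℝ) ^ k / 3) (3 * (2:ℝ) ^ k) ∧ ‖y - x‖ ≤ δ k / 2 ∧ y ∉ C ∧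
      W x / 2 ≤ W y ∧
      Ham U f l (p0 / 2) x ((2 * (lamF ((2:ℝ) ^ k) * α k)) • (x - y)) ≤ -(γt (W1 y) / 4) := by
    intro x hx
    have hWx := hWpd.1 x hx
    obtain ⟨k, y, hqx⟩ : ∃ k y, q x = (k, y) := ⟨(q x).1, (q x).2, rfl⟩
    have hv := hWbv x hx
    have hav := hqav x hx
    have hmin := hqmin x hx
    rw [hqx] at hv hav hmin
    obtain ⟨hk, hy⟩ := hav
    simp only at hk hy
    have ht := h2pos k
    have hl1 := lamF_ge ht
    have hl2 := lamF_le ht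
    have hep := epF_le ht
    obtain ⟨L1, L2, L3⟩ := hL k x hx hk
    have hyC := (L1 y hy).1
    have hWyx := (L1 y hy).2
    have hWyx' := neg_abs_le (W y - W x)
    have hmin' : ∀ z, ‖z - x‖ ≤ δ k →
        W y + α k * ‖x - y‖ ^ 2 ≤ W z + α k * ‖x - z‖ ^ 2 := by
      intro z hz
      have := hmin (k, z) ⟨hk, hz⟩
      simp only [valF, add_le_add_iff_right] at this
      exact le_of_mul_le_mul_left this (by linarith)
    have hy2 : ‖y - x‖ ≤ δ k / 2 := by
      apply L2 y hy
      have := hmin' x (by simpa using (hδ k).le)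
      simpa using this
    have hlow : lamF ((2:ℝ) ^ k) * W x + cF ((2:ℝ) ^ k) - epF ((2:ℝ) ^ k) ≤ Wb x := by
      rw [hv]
      simp only [valF]
      have h1 : 0 ≤ α k * ‖x - y‖ ^ 2 := by have := hα k; positivity
      have h2 : lamF ((2:ℝ) ^ k) * (W x - epF ((2:ℝ) ^ k)) ≤
          lamF ((2:ℝ) ^ k) * (W y + α k * ‖x - y‖ ^ 2) := by
        gcongr; linarith
      have h3 : lamF ((2:ℝ) ^ k) * epF ((2:ℝ) ^ k) ≤ 1 * epF ((2:ℝ) ^ k) := by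
        gcongr; exact (epF_pos ht).le
      linarith
    have hx1 : W x ≤ 3 * (2:ℝ) ^ k := by
      by_contra hcon
      push Not at hcon
      have h1 := line_up ht hcon
      have e : (2:ℝ) ^ (k + 1) = 2 * (2:ℝ) ^ k := by rw [zpow_add_one₀ (by norm_num)]; ring
      have h2 := htriv x hx (k + 1) (by
        rw [e]; have := hk.2; constructor <;> linarith)
      rw [e] at h2
      linarith
    have hx2 : (2:ℝ) ^ k / 3 ≤ W x := by
      by_contra hcon
      push Not at hcon
      have h1 := line_down ht hcon
      have e : (2:ℝ) ^ (k - 1) = (2:ℝ) ^ k / 2 := by rw [zpow_sub_one₀ (by norm_num)]; ring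
      have h2 := htriv x hx (k - 1) (by
        rw [e]; have := hk.1; constructor <;> linarith)
      rw [e] at h2
      linarith
    exact ⟨k, y, hv, ⟨hx2, hx1⟩, hy2, hyC, by linarith,
      L3 y hy2 hmin' _ hl1 hl2⟩
  -- lower bound
  have hWblow : ∀ x, x ∉ C → W x / 4 ≤ Wb x := by
    intro x hx
    obtain ⟨k, y, hv, -, -, hyC, hWy, -⟩ := hopt x hx
    rw [hv]
    simp only [valF]
    have hl1 := lamF_ge (h2pos k)
    have h0 := hWpd.1 y hyC
    have h1 : 0 ≤ α k * ‖x - y‖ ^ 2 := by have := hα k; positivity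
    have h2 : 1 / 2 * (W y + α k * ‖x - y‖ ^ 2) ≤
        lamF ((2:ℝ) ^ k) * (W y + α k * ‖x - y‖ ^ 2) := by gcongr
    have := cF_nonneg ((2:ℝ) ^ k)
    linarith
  -- key property
  have hkey : ∀ a > (0:ℝ), ∃ c > (0:ℝ), ∀ b : ℝ, ∃ δ0 > (0:ℝ), ∃ A > (0:ℝ), ∀ x, x ∉ C →
      a ≤ W x → W x ≤ b → ∃ p : Euc n, ‖p‖ ≤ A ∧ Ham U f l (p0 / 2) x p ≤ -c ∧
        ∀ z, ‖z - x‖ ≤ δ0 → z ∉ C ∧ Wb z ≤ Wb x + ⟪p, z - x⟫ + A * ‖z - x‖ ^ 2 := by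
    intro a ha
    obtain ⟨w, hw, hwW⟩ := W1_lower hC hWc hWpd hW1c hW1nn hW1pd hW1pr
      (by positivity : 0 < a / 2)
    have hγw := hγ.2.2 w hw
    refine ⟨γt w / 4, by positivity, fun b => ?_⟩
    have hfin := finite_zpow (a := a / 3) (b := 3 * b) (by positivity)
    set F := {k : ℤ | a / 3 ≤ (2:ℝ) ^ k ∧ (2:ℝ) ^ k ≤ 3 * b}
    obtain ⟨δ0, hδ0, hδ0F⟩ : ∃ δ0 > (0:ℝ), ∀ k ∈ F, δ0 ≤ δ k / 2 := by
      rcases F.eq_empty_or_nonempty with he | hne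
      · exact ⟨1, one_pos, by simp [he]⟩
      · obtain ⟨k, -, hk⟩ := Set.exists_min_image F δ hfin hne
        exact ⟨δ k / 2, half_pos (hδ k), fun j hj => by linarith [hk j hj]⟩
    obtain ⟨A, hA, hAF⟩ : ∃ A > (0:ℝ), ∀ k ∈ F, α k + 2 * (α k * δ k) ≤ A := by
      rcases F.eq_empty_or_nonempty with he | hne
      · exact ⟨1, one_pos, by simp [he]⟩
      · obtain ⟨k, -, hk⟩ := Set.exists_max_image F (fun k => α k + 2 * (α k * δ k)) hfin hne
        have := hα k
        have := hδ k
        exact ⟨_, by positivity, hk⟩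
    refine ⟨δ0, hδ0, A, hA, fun x hx hax hxb => ?_⟩
    obtain ⟨k, y, hv, hk, hy, hyC, hWy, hHam⟩ := hopt x hx
    have ht := h2pos k
    have hl1 := lamF_ge ht
    have hl2 := lamF_le ht
    have hαk := hα k
    have hδk := hδ k
    have hkF : k ∈ F := by
      have := hk.1
      have := hk.2
      constructor <;> linarith
    have hD := hδ0F k hkF
    have hAk := hAF k hkF
    have hαδ : 0 < α k * δ k := by positivity
    have hlα : lamF ((2:ℝ) ^ k) * α k ≤ α k := by nlinarith
    have hlα0 : 0 ≤ lamF ((2:ℝ) ^ k) * α k := by apply mul_nonneg <;> linarith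
    have hxy : ‖x - y‖ ≤ δ k := by rw [norm_sub_rev]; linarith
    refine ⟨(2 * (lamF ((2:ℝ) ^ k) * α k)) • (x - y), ?_, ?_, ?_⟩
    · rw [norm_smul, Real.norm_of_nonneg (by positivity)]
      have : lamF ((2:ℝ) ^ k) * α k * ‖x - y‖ ≤ α k * δ k := by gcongr
      linarith
    · refine hHam.trans ?_
      have hw1 := hwW y hyC (by linarith)
      have : γt w ≤ γt (W1 y) := hγ.2.1.monotoneOn hw (lt_of_lt_of_le hw hw1) hw1
      linarith
    · intro z hz
      have hk4 : W x ∈ Set.Icc ((2:ℝ) ^ k / 4) (4 * (2:ℝ) ^ k) := by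
        have := hk.1
        have := hk.2
        constructor <;> linarith
      obtain ⟨hzC, hzW⟩ := (hL k x hx hk4).1 z (by linarith)
      refine ⟨hzC, ?_⟩
      have hep := epF_le ht
      have hyz : ‖y - z‖ ≤ δ k := by
        calc ‖y - z‖ = ‖(y - x) - (z - x)‖ := by congr 1; abel
          _ ≤ ‖y - x‖ + ‖z - x‖ := norm_sub_le _ _
          _ ≤ δ k := by linarith
      have h1 := hWble z hzC (k, y) ⟨by
        have := neg_abs_le (W z - W x)
        have := le_abs_self (W z - W x)
        have := hk.1
        have := hk.2
        constructor <;> simp only <;> linarith, hyz⟩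
      have h2 : ‖z - y‖ ^ 2 = ‖x - y‖ ^ 2 + 2 * ⟪x - y, z - x⟫ + ‖z - x‖ ^ 2 := by
        rw [← norm_add_sq_real]; congr 2; abel
      have h3 : lamF ((2:ℝ) ^ k) * α k * ‖z - x‖ ^ 2 ≤ A * ‖z - x‖ ^ 2 := by
        gcongr; linarith
      rw [hv]
      simp only [valF] at h1 ⊢
      rw [h2] at h1
      rw [real_inner_smul_left]
      linarith
  have hWat : ∀ x, x ∉ C → ContinuousAt W x := fun x hx =>
    hWc.continuousAt (mem_of_superset (hC.isOpen_compl.mem_nhds hx) subset_closure)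
  -- continuity off C
  have hcat : ∀ x, x ∉ C → ContinuousAt Wb x := by
    intro x hx
    have hWx := hWpd.1 x hx
    obtain ⟨c, -, hc⟩ := hkey (W x / 2) (by positivity)
    obtain ⟨δ0, hδ0, A, hA, h⟩ := hc (2 * W x)
    have hnh : ∀ᶠ z in 𝓝 x, z ∉ C ∧ W z ∈ Set.Ioo (W x / 2) (2 * W x) ∧ ‖z - x‖ < min δ0 1 := by
      have hnC : ∀ᶠ z in 𝓝 x, z ∉ C := hC.isOpen_compl.mem_nhds hx
      refine hnC.and (((hWat x hx).eventually
        (Ioo_mem_nhds (by linarith) (by linarith))).and ?_)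
      have := ball_mem_nhds x (lt_min hδ0 one_pos)
      filter_upwards [this] with z hz
      rwa [mem_ball, dist_eq_norm] at hz
    have hb : ∀ u v : Euc n, u ∉ C → W x / 2 ≤ W u → W u ≤ 2 * W x → ‖v - u‖ ≤ δ0 → ‖v - u‖ ≤ 1 →
        Wb v ≤ Wb u + 2 * A * ‖v - u‖ := by
      intro u v hu h1 h2 h3 h4
      obtain ⟨p, hp, -, hz⟩ := h u hu h1 h2
      have h5 := (hz v h3).2
      have h6 : ⟪p, v - u⟫ ≤ A * ‖v - u‖ := (real_inner_le_norm _ _).trans (by gcongr)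
      have h7 : ‖v - u‖ ^ 2 ≤ ‖v - u‖ := by nlinarith [norm_nonneg (v - u)]
      have h8 : A * ‖v - u‖ ^ 2 ≤ A * ‖v - u‖ := by gcongr
      linarith
    rw [ContinuousAt, tendsto_iff_dist_tendsto_zero]
    have hlim : Tendsto (fun z => 2 * A * ‖z - x‖) (𝓝 x) (𝓝 0) := by
      have : Continuous (fun z => 2 * A * ‖z - x‖) := by fun_prop
      have := this.tendsto x
      simpa using this
    refine squeeze_zero' (Eventually.of_forall fun _ => dist_nonneg) ?_ hlim
    filter_upwards [hnh] with z hz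
    obtain ⟨hz1, hz2, hz3⟩ := hz
    have hz4 := hz3.le.trans (min_le_left _ _)
    have hz5 := hz3.le.trans (min_le_right _ _)
    have e1 := hb x z hx (by linarith) (by linarith) hz4 hz5
    have e2 := hb z x hz1 hz2.1.le hz2.2.le (by rwa [norm_sub_rev]) (by rwa [norm_sub_rev])
    rw [norm_sub_rev x z] at e2
    rw [Real.dist_eq, abs_le]
    constructor <;> linarith
  have hnn : ∀ x, 0 ≤ Wb x := by
    intro x
    by_cases hx : x ∈ C
    · rw [hWbC x hx]
    · have := hWpd.1 x hx
      have := hWblow x hx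
      linarith
  have hcont : ContinuousOn Wb (closure Cᶜ) := by
    intro x hx
    by_cases hxC : x ∈ C
    · have hfr : x ∈ frontier C := by
        rw [frontier_eq_closure_inter_closure]
        exact ⟨subset_closure hxC, hx⟩
      have hWx := hWc x hx
      rw [ContinuousWithinAt, hWpd.2 x hfr] at hWx
      rw [ContinuousWithinAt, hWbC x hxC]
      refine squeeze_zero' (Eventually.of_forall hnn) ?_ hWx
      filter_upwards [self_mem_nhdsWithin] with z hz
      by_cases hzC : z ∈ C
      · rw [hWbC z hzC]; exact hWnn z hz
      · exact hWbW z hzC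
    · exact (hcat x hxC).continuousWithinAt
  have hpd : PosDefOn C Wb := by
    refine ⟨fun x hx => ?_, fun x hx => hWbC x (hC.frontier_subset hx)⟩
    have := hWpd.1 x hx
    have := hWblow x hx
    linarith
  have hpr : ProperOn C Wb := by
    intro Kc hKc hK0
    obtain ⟨M, hM⟩ := hKc.bddAbove
    have hcomp := hWpr (Set.Icc 0 (4 * M)) isCompact_Icc Set.Icc_subset_Ici_self
    apply hcomp.of_isClosed_subset
    · exact hcont.preimage_isClosed_of_isClosed isClosed_closure hKc.isClosed
    · rintro x ⟨hx, hxK⟩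
      refine ⟨hx, hWnn x hx, ?_⟩
      have h1 : Wb x ≤ M := hM hxK
      by_cases hxC : x ∈ C
      · have hfr : x ∈ frontier C := by
          rw [frontier_eq_closure_inter_closure]
          exact ⟨subset_closure hxC, hx⟩
        rw [hWpd.2 x hfr]
        have := hnn x
        linarith
      · have := hWblow x hxC
        linarith
  have hsc : LocSemiconcaveOn C Wb := by
    intro S hS hSC
    rcases S.eq_empty_or_nonempty with he | hne
    · refine ⟨1, one_pos, fun x y hxy => ?_⟩
      have := hxy (left_mem_segment ℝ x y)
      simp [he] at this
    have hWS : ContinuousOn W S := hWc.mono (hSC.trans subset_closure)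
    obtain ⟨u, hu, humin⟩ := hS.exists_isMinOn hne hWS
    obtain ⟨v, hv, hvmax⟩ := hS.exists_isMaxOn hne hWS
    have hWu := hWpd.1 u (hSC hu)
    have hWv := hWpd.1 v (hSC hv)
    obtain ⟨c, -, hc⟩ := hkey (W u) hWu
    obtain ⟨δ0, hδ0, A, hA, h⟩ := hc (W v)
    refine ⟨A + W v / δ0 ^ 2, by positivity, fun x y hxy => ?_⟩
    have hxS := hxy (left_mem_segment ℝ x y)
    have hyS := hxy (right_mem_segment ℝ x y)
    have hmS := hxy (midpoint_mem_segment x y)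
    set z := midpoint ℝ x y with hz
    have hxz : x - z = (1 / 2 : ℝ) • (x - y) := by
      rw [hz, midpoint_eq_smul_add, invOf_eq_inv]; module
    have hyz : y - z = -((1 / 2 : ℝ) • (x - y)) := by
      rw [hz, midpoint_eq_smul_add, invOf_eq_inv]; module
    have nxz : ‖x - z‖ = ‖x - y‖ / 2 := by
      rw [hxz, norm_smul]; norm_num; ring
    have nyz : ‖y - z‖ = ‖x - y‖ / 2 := by
      rw [hyz, norm_neg, norm_smul]; norm_num; ring
    have hvd : 0 ≤ W v / δ0 ^ 2 * ‖x - y‖ ^ 2 := by positivity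
    by_cases hd : ‖x - y‖ / 2 ≤ δ0
    · obtain ⟨p, -, -, hp⟩ := h z (hSC hmS) (humin hmS) (hvmax hmS)
      have h1 := (hp x (by rw [nxz]; exact hd)).2
      have h2 := (hp y (by rw [nyz]; exact hd)).2
      rw [nxz, hxz] at h1
      rw [nyz, hyz, inner_neg_right] at h2
      have : 0 ≤ A * ‖x - y‖ ^ 2 := by positivity
      nlinarith
    · push Not at hd
      have h1 : Wb x ≤ W v := (hWbW x (hSC hxS)).trans (hvmax hxS)
      have h2 : Wb y ≤ W v := (hWbW y (hSC hyS)).trans (hvmax hyS)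
      have h3 := hnn z
      have h4 : 2 * W v ≤ W v / δ0 ^ 2 * ‖x - y‖ ^ 2 := by
        have : 4 * δ0 ^ 2 ≤ ‖x - y‖ ^ 2 := by nlinarith
        calc 2 * W v ≤ W v / δ0 ^ 2 * (4 * δ0 ^ 2) := by field_simp; linarith
          _ ≤ _ := by gcongr
      have : 0 ≤ A * ‖x - y‖ ^ 2 := by positivity
      linarith
  -- decrease along limiting gradients
  have hdecr : ∀ a > (0:ℝ), ∃ c > (0:ℝ), ∀ x, x ∉ C → a ≤ Wb x → ∀ p ∈ limitingGradients Wb x,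
      Ham U f l (p0 / 2) x p ≤ -c := by
    intro a ha
    obtain ⟨c, hc, hcb⟩ := hkey (a / 2) (by positivity)
    refine ⟨c, hc, fun x hx hax p hp => ?_⟩
    obtain ⟨xk, hxk, hlim, hgr⟩ := hp
    refine Ham_limit hH1 (by positivity) hx hc hlim hgr ?_
    have h1 : ∀ᶠ k in atTop, xk k ∉ C := hlim.eventually (hC.isOpen_compl.mem_nhds hx)
    have h2 : ∀ᶠ k in atTop, a / 2 < Wb (xk k) :=
      ((hcat x hx).tendsto.comp hlim).eventually_const_lt (by linarith)
    filter_upwards [h1, h2] with k hk1 hk2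
    obtain ⟨δ0, hδ0, A, hA, h⟩ := hcb (W (xk k))
    obtain ⟨v, -, hv, hz⟩ := h _ hk1 (by linarith [hWbW _ hk1]) le_rfl
    have hgrad : gradient Wb (xk k) = v := by
      have hd := (hxk k).1.hasGradientAt
      -- the function below has a local maximum at `xk k`
      set y := xk k
      have hmax : IsLocalMax (fun z => Wb z - ⟪v, z - y⟫ - A * ‖z - y‖ ^ 2) y := by
        filter_upwards [closedBall_mem_nhds y hδ0] with z hzb
        rw [mem_closedBall, dist_eq_norm] at hzb
        have := (hz z hzb).2
        simp only [sub_self, inner_zero_right, norm_zero]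
        linarith
      have hder : HasFDerivAt (fun z => Wb z - ⟪v, z - y⟫ - A * ‖z - y‖ ^ 2)
          ((InnerProductSpace.toDual ℝ (Euc n) (gradient Wb y)) - innerSL ℝ v
            - A • ((2:ℝ) • innerSL ℝ (y - y))) y := by
        have e0 := hd.hasFDerivAt
        have e1 : HasFDerivAt (fun z => ⟪v, z - y⟫) (innerSL ℝ v) y :=
          (innerSL ℝ v).hasFDerivAt.comp y ((hasFDerivAt_id y).sub_const y)
        have e2 : HasFDerivAt (fun z => ‖z - y‖ ^ 2) ((2:ℝ) • innerSL ℝ (y - y)) y := by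
          have := ((hasFDerivAt_id y).sub_const y).norm_sq
          simpa using this
        exact (e0.sub e1).sub (e2.const_mul A)
      have h0 := hmax.hasFDerivAt_eq_zero hder
      clear hder hd
      generalize gradient Wb y = G at h0 ⊢
      have h00 := congrArg (fun T => T (G - v)) h0
      simp only [sub_self, map_zero, smul_zero, sub_zero, sub_apply,
        zero_apply, InnerProductSpace.toDual_apply_apply,
        innerSL_apply_apply] at h00
      have : ⟪G - v, G - v⟫ = 0 := by
        rw [inner_sub_left]; linarith
      exact sub_eq_zero.1 (inner_self_eq_zero.1 this)
    rw [hgrad]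
    exact hv
  obtain ⟨γb, hγb, hγbS⟩ := exists_rate
    {s | ∃ x, x ∉ C ∧ ∃ p ∈ limitingGradients Wb x, s = (Wb x, -Ham U f l (p0 / 2) x p)}
    (by rintro _ ⟨x, hx, p, hp, rfl⟩; exact hpd.1 x hx)
    (by
      intro a ha
      obtain ⟨c, hc, h⟩ := hdecr a ha
      refine ⟨c, hc, ?_⟩
      rintro _ ⟨x, hx, p, hp, rfl⟩ hax
      have := h x hx hax p hp
      show c ≤ -_
      linarith)
  refine ⟨Wb, γb, ⟨hcont, fun x _ => hnn x, hsc, hpd, hpr, hγb, ?_⟩, hWbW⟩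
  intro x hx p hp
  have := hγbS (Wb x, -Ham U f l (p0 / 2) x p) ⟨x, hx, p, hp, rfl⟩
  simp only at this
  linarith
end

section
/- Assume hypothesis (H1) and let p₀ > 0. Let W : closure(ℝⁿ ∖ C) → [0,∞) be a Lipschitz continuous p₀-Minimum Restraint Function. Then there exists a locally bounded feedback K : ℝⁿ ∖ C → U that both sample stabilizes and Euler stabilizes the control system ẋ = f(x,u), u ∈ U, to the target C with (p₀/2, W)-regulated cost. -/
open Filter Topology Metric MeasureTheory Bornology
open scoped RealInnerProductSpace ENNReal NNReal

/-- Clamp a real to `[0,1]`. -/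
noncomputable def clampUnit (s : ℝ) : ℝ := max 0 (min 1 s)

lemma clampUnit_nonneg (s : ℝ) : 0 ≤ clampUnit s := le_max_left _ _

lemma clampUnit_le_one (s : ℝ) : clampUnit s ≤ 1 :=
  max_le zero_le_one (min_le_left _ _)

lemma clampUnit_mono : Monotone clampUnit := fun _ _ h =>
  max_le_max le_rfl (min_le_min le_rfl h)

lemma clampUnit_lip (s t : ℝ) : |clampUnit s - clampUnit t| ≤ |s - t| := by
  unfold clampUnit
  refine (abs_max_sub_max_le_max 0 _ 0 _).trans ?_
  rw [sub_self, abs_zero]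
  refine max_le (abs_nonneg _) ?_
  refine (abs_min_sub_min_le_max 1 s 1 t).trans ?_
  simp

lemma exists_antitone_minorant (e : ℕ → ℝ) (he : ∀ k, 0 < e k) :
    ∃ E : ℕ → ℝ, (∀ k, 0 < E k) ∧ Antitone E ∧ ∀ k, E k ≤ e k := by
  refine ⟨fun k => (Finset.range (k+1)).inf' (Finset.nonempty_range_iff.2 (Nat.succ_ne_zero k)) e, ?_, ?_, ?_⟩
  · intro k
    exact (Finset.lt_inf'_iff _).2 fun i _ => he i
  · intro i j hij
    apply Finset.inf'_mono
    intro a ha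
    simp only [Finset.mem_range] at *
    omega
  · intro k
    exact Finset.inf'_le _ (by simp)

lemma exists_theta (e : ℕ → ℝ) (he : ∀ k, 0 < e k) :
    ∃ Θ : ℝ → ℝ, (∀ ρ, 0 < Θ ρ) ∧ Antitone Θ ∧ ∀ (k : ℕ) (ρ ρ' : ℝ), (k:ℝ) ≤ ρ → (k:ℝ) ≤ ρ' →
      Θ ρ ≤ e k ∧ |Θ ρ - Θ ρ'| ≤ e k * |ρ - ρ'| := by
  obtain ⟨E, hE0, hEa, hEe⟩ := exists_antitone_minorant e he
  set g : ℕ → ℝ := fun j => (1/2:ℝ) / 2 ^ j with hg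
  have hgs : HasSum g 1 := by simpa [hg] using hasSum_geometric_two' (1:ℝ)
  have hg0 : ∀ j, 0 < g j := fun j => by simp only [hg]; positivity
  set a : ℝ → ℕ → ℝ := fun ρ j => E j * g j * clampUnit (j + 1 - ρ) with ha
  have ha0 : ∀ ρ j, 0 ≤ a ρ j := fun ρ j =>
    mul_nonneg (mul_nonneg (hE0 j).le (hg0 j).le) (clampUnit_nonneg _)
  have hsum : ∀ ρ, Summable (a ρ) := by
    intro ρ
    refine Summable.of_nonneg_of_le (ha0 ρ) (fun j => ?_) (hgs.summable.mul_left (E 0))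
    calc a ρ j ≤ E j * g j * 1 := by
          apply mul_le_mul_of_nonneg_left (clampUnit_le_one _)
          exact mul_nonneg (hE0 j).le (hg0 j).le
      _ ≤ E 0 * g j := by
          rw [mul_one]; exact mul_le_mul_of_nonneg_right (hEa (Nat.zero_le j)) (hg0 j).le
  refine ⟨fun ρ => ∑' j, a ρ j, ?_, ?_, ?_⟩
  · intro ρ
    obtain ⟨j, hj⟩ := exists_nat_ge ρ
    refine (hsum ρ).tsum_pos (ha0 ρ) j ?_
    refine mul_pos (mul_pos (hE0 j) (hg0 j)) ?_
    unfold clampUnit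
    apply lt_max_of_lt_right
    apply lt_min one_pos
    linarith
  · intro ρ ρ' h
    refine (hsum ρ').tsum_le_tsum (fun j => ?_) (hsum ρ)
    apply mul_le_mul_of_nonneg_left _ (mul_nonneg (hE0 j).le (hg0 j).le)
    apply clampUnit_mono
    linarith
  · intro k ρ ρ' hρ hρ'
    have key0 : ∀ j, ∀ ρ : ℝ, (k:ℝ) ≤ ρ → j < k → a ρ j = 0 := by
      intro j ρ hρ hj
      have : (j:ℝ) + 1 ≤ k := by exact_mod_cast hj
      have : clampUnit (j + 1 - ρ) = 0 := by
        unfold clampUnit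
        apply max_eq_left
        exact (min_le_right _ _).trans (by linarith)
      simp [ha, this]
    constructor
    · have : ∑' j, a ρ j ≤ ∑' j, E k * g j := by
        refine (hsum ρ).tsum_le_tsum (fun j => ?_) (hgs.summable.mul_left (E k))
        by_cases hj : j < k
        · rw [key0 j ρ hρ hj]; exact mul_nonneg (hE0 k).le (hg0 j).le
        · calc a ρ j ≤ E j * g j * 1 := by
                apply mul_le_mul_of_nonneg_left (clampUnit_le_one _)
                exact mul_nonneg (hE0 j).le (hg0 j).le
            _ ≤ E k * g j := by
                rw [mul_one]
                exact mul_le_mul_of_nonneg_right (hEa (not_lt.1 hj)) (hg0 j).le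
      rw [tsum_mul_left, hgs.tsum_eq, mul_one] at this
      exact this.trans (hEe k)
    · show |∑' j, a ρ j - ∑' j, a ρ' j| ≤ _
      rw [← (hsum ρ).tsum_sub (hsum ρ')]
      have hs' := ((hgs.summable.mul_left (E k)).mul_right |ρ - ρ'|)
      have hb : ∀ j, ‖a ρ j - a ρ' j‖ ≤ E k * g j * |ρ - ρ'| := by
        intro j
        rw [Real.norm_eq_abs]
        by_cases hj : j < k
        · rw [key0 j ρ hρ hj, key0 j ρ' hρ' hj]
          simp only [sub_self, abs_zero]
          exact mul_nonneg (mul_nonneg (hE0 k).le (hg0 j).le) (abs_nonneg _)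
        · have h1 : a ρ j - a ρ' j
              = E j * g j * (clampUnit (j + 1 - ρ) - clampUnit (j + 1 - ρ')) := by
            simp only [ha]; ring
          rw [h1, abs_mul, abs_of_nonneg (mul_nonneg (hE0 j).le (hg0 j).le)]
          refine mul_le_mul ?_ ?_ (abs_nonneg _) (mul_nonneg (hE0 k).le (hg0 j).le)
          · exact mul_le_mul_of_nonneg_right (hEa (not_lt.1 hj)) (hg0 j).le
          · refine (clampUnit_lip _ _).trans (le_of_eq ?_)
            rw [abs_sub_comm ρ ρ']
            congr 1; ring
      have := tsum_of_norm_bounded hs'.hasSum hb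
      rw [Real.norm_eq_abs, tsum_mul_right, tsum_mul_left, hgs.tsum_eq, mul_one] at this
      exact this.trans (mul_le_mul_of_nonneg_right (hEe k) (abs_nonneg _))

/-- A minimum over finitely many levels. -/
lemma exists_pos_le_of_le (e : ℕ → ℝ) (he : ∀ k, 0 < e k) (N : ℕ) :
    ∃ c > 0, ∀ k ≤ N, c ≤ e k := by
  obtain ⟨E, hE0, hEa, hEe⟩ := exists_antitone_minorant e he
  exact ⟨E N, hE0 N, fun k hk => (hEa hk).trans (hEe k)⟩

lemma exists_KL (G : ℝ → ℝ → ℝ) (h0 : ∀ r t, 0 ≤ G r t)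
    (hmono : ∀ t, 0 ≤ t → Monotone (fun r => G r t))
    (hanti : ∀ r, AntitoneOn (fun t => G r t) (Set.Ici 0))
    (hlim : ∀ r, Tendsto (fun t => G r t) atTop (𝓝 0))
    (hz : ∀ ε > 0, ∃ r > 0, G r 0 ≤ ε) :
    ∃ β : ℝ → ℝ → ℝ, IsKL β ∧ ∀ r t, 0 ≤ r → 0 ≤ t → G r t ≤ β r t := by
  have hG0 : ∀ t, 0 ≤ t → G 0 t = 0 := by
    intro t ht
    refine le_antisymm ?_ (h0 _ _)
    refine le_of_forall_pos_le_add fun ε hε => ?_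
    obtain ⟨r, hr, hr'⟩ := hz ε hε
    have h1 := hmono t ht hr.le
    have h2 := hanti r (Set.mem_Ici.2 le_rfl) (Set.mem_Ici.2 ht) ht
    simp only at h1 h2
    linarith
  have hII : ∀ t, 0 ≤ t → ∀ a b, IntervalIntegrable (fun r => G r t) volume a b :=
    fun t ht a b => (hmono t ht).intervalIntegrable
  have hmono' : ∀ t, 0 ≤ t → ∀ r, 0 ≤ r → Monotone (fun s => G (r * s) t) :=
    fun t ht r hr => fun s s' h => hmono t ht (mul_le_mul_of_nonneg_left h hr)
  have hII' : ∀ t, 0 ≤ t → ∀ r, 0 ≤ r → IntervalIntegrable (fun s => G (r * s) t) volume 1 2 :=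
    fun t ht r hr => (hmono' t ht r hr).intervalIntegrable
  set F : ℝ → ℝ → ℝ := fun r t => ∫ s in (1:ℝ)..2, G (r * s) t with hF
  have hFlow : ∀ r t, 0 ≤ r → 0 ≤ t → G r t ≤ F r t := by
    intro r t hr ht
    have := intervalIntegral.integral_mono_on (a := 1) (b := 2) (by norm_num)
      (intervalIntegrable_const (c := G r t)) (hII' t ht r hr)
      (fun s hs => hmono t ht (by nlinarith [hs.1] : r ≤ r * s))
    simp only [intervalIntegral.integral_const] at this
    norm_num at this
    exact this
  have hFup : ∀ r t, 0 ≤ r → 0 ≤ t → F r t ≤ G (r * 2) t := by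
    intro r t hr ht
    have := intervalIntegral.integral_mono_on (a := 1) (b := 2) (by norm_num)
      (hII' t ht r hr) (intervalIntegrable_const (c := G (r * 2) t))
      (fun s hs => hmono' t ht r hr hs.2)
    simp only [intervalIntegral.integral_const] at this
    norm_num at this
    exact this
  have hF0 : ∀ r t, 0 ≤ r → 0 ≤ t → 0 ≤ F r t := fun r t hr ht => (h0 _ _).trans (hFlow r t hr ht)
  have hFmono : ∀ t, 0 ≤ t → MonotoneOn (fun r => F r t) (Set.Ici 0) := by
    intro t ht r hr r' hr' h
    exact intervalIntegral.integral_mono_on (by norm_num) (hII' t ht r hr) (hII' t ht r' hr')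
      (fun s hs => hmono t ht (mul_le_mul_of_nonneg_right h (by linarith [hs.1])))
  refine ⟨fun r t => F r t + r * Real.exp (-t), ⟨?_, ?_, ?_, ?_, ?_, ?_⟩, ?_⟩
  · intro r t hr ht
    have := hF0 r t hr ht
    positivity
  · intro t ht
    apply ContinuousOn.add
    · intro r hr
      rcases eq_or_lt_of_le (Set.mem_Ici.1 hr) with hr0 | hr0
      · -- at zero
        subst hr0
        have hz0 : F 0 t = 0 := by
          simp [hF, hG0 t ht]
        rw [ContinuousWithinAt, hz0, Metric.tendsto_nhdsWithin_nhds]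
        intro ε hε
        obtain ⟨r0, hr0, hr0'⟩ := hz (ε/2) (by positivity)
        refine ⟨r0/2, by positivity, fun r hr hd => ?_⟩
        rw [Real.dist_eq, sub_zero] at hd ⊢
        have hr' : 0 ≤ r := hr
        rw [abs_of_nonneg hr'] at hd
        rw [abs_of_nonneg (hF0 r t hr' ht)]
        have h1 := hFup r t hr' ht
        have h2 : G (r*2) t ≤ G r0 t := hmono t ht (by linarith)
        have h3 := hanti r0 (Set.mem_Ici.2 le_rfl) (Set.mem_Ici.2 ht) ht
        simp only at h3
        linarith
      · apply ContinuousAt.continuousWithinAt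
        have hc : Continuous (fun r => ∫ s in (0:ℝ)..r, G s t) :=
          intervalIntegral.continuous_primitive (hII t ht) 0
        have hE : (fun r => F r t) =ᶠ[𝓝 r]
            fun r => r⁻¹ * ((∫ s in (0:ℝ)..(r*2), G s t) - ∫ s in (0:ℝ)..(r*1), G s t) := by
          filter_upwards [lt_mem_nhds hr0] with q hq
          have h1 := intervalIntegral.integral_comp_mul_left (a := 1) (b := 2)
            (fun s => G s t) (ne_of_gt hq)
          simp only [hF, h1, smul_eq_mul]
          rw [intervalIntegral.integral_interval_sub_left (hII t ht _ _) (hII t ht _ _)]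
        refine ContinuousAt.congr ?_ hE.symm
        apply ContinuousAt.mul (continuousAt_inv₀ hr0.ne')
        apply Continuous.continuousAt
        exact (hc.comp (continuous_id.mul continuous_const)).sub
          (hc.comp (continuous_id.mul continuous_const))
    · fun_prop
  · intro t ht r hr r' hr' h
    have h1 := hFmono t ht hr hr' h.le
    have h2 : r * Real.exp (-t) < r' * Real.exp (-t) :=
      mul_lt_mul_of_pos_right h (Real.exp_pos _)
    simp only at h1 ⊢
    linarith
  · intro t ht
    simp [hF, hG0 t ht]
  · intro r hr t ht t' ht' h
    have h1 : F r t' ≤ F r t :=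
      intervalIntegral.integral_mono_on (by norm_num) (hII' t' ht' r hr) (hII' t ht r hr)
        (fun s hs => hanti (r*s) ht ht' h)
    have h2 : Real.exp (-t') ≤ Real.exp (-t) := Real.exp_le_exp.2 (by linarith)
    have h3 := mul_le_mul_of_nonneg_left h2 hr
    simp only
    linarith
  · intro r hr
    have h1 : Tendsto (fun t => F r t) atTop (𝓝 0) := by
      refine tendsto_of_tendsto_of_tendsto_of_le_of_le' tendsto_const_nhds (hlim (r*2)) ?_ ?_
      · filter_upwards [eventually_ge_atTop 0] with t ht using hF0 r t hr ht
      · filter_upwards [eventually_ge_atTop 0] with t ht using hFup r t hr ht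
    have h2 : Tendsto (fun t : ℝ => r * Real.exp (-t)) atTop (𝓝 (r * 0)) :=
      (Real.tendsto_exp_neg_atTop_nhds_zero).const_mul r
    simpa using h1.add h2
  · intro r t hr ht
    have := hFlow r t hr ht
    have : 0 ≤ r * Real.exp (-t) := by positivity
    linarith

section geometry
variable {n : ℕ} {C : Set (Euc n)}

lemma dC_nonneg (C : Set (Euc n)) (x : Euc n) : 0 ≤ dC C x := infDist_nonneg

lemma dC_cont (C : Set (Euc n)) : Continuous (dC C) := continuous_infDist_pt C

lemma dC_lip (C : Set (Euc n)) (x y : Euc n) : |dC C x - dC C y| ≤ ‖x - y‖ := by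
  have := (lipschitz_infDist_pt C).dist_le_mul x y
  simpa [Real.dist_eq, dist_eq_norm, dC] using this

lemma dC_le_add (C : Set (Euc n)) (x y : Euc n) : dC C x ≤ dC C y + ‖x - y‖ := by
  have := (abs_le.1 (dC_lip C x y)).2
  linarith

lemma dC_pos_iff (hC : IsClosed C) (hne : C.Nonempty) (x : Euc n) : 0 < dC C x ↔ x ∉ C :=
  (hC.notMem_iff_infDist_pos hne).symm

lemma compact_near (hC : IsClosed C) (hne : C.Nonempty) (hfr : IsCompact (frontier C)) (R : ℝ) :
    IsCompact (closure Cᶜ ∩ {x | dC C x ≤ R}) := by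
  refine Metric.isCompact_of_isClosed_isBounded ?_ ?_
  · exact isClosed_closure.inter (isClosed_le (dC_cont C) continuous_const)
  · have hb : IsBounded (frontier C ∪ Metric.thickening (R + 1) (frontier C)) :=
      hfr.isBounded.union hfr.isBounded.thickening
    refine hb.subset ?_
    rintro x ⟨hx1, hx2⟩
    by_cases hxC : x ∈ C
    · left
      rw [frontier_eq_closure_inter_closure]
      exact ⟨subset_closure hxC, hx1⟩
    · right
      obtain ⟨y, hy, hy'⟩ := exists_mem_frontier_infDist_compl_eq_dist (s := Cᶜ) (x := x) hxC
        (by intro h; obtain ⟨c, hc⟩ := hne; have := h ▸ Set.mem_univ c; exact this hc)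
      rw [frontier_compl] at hy
      rw [compl_compl] at hy'
      rw [Metric.mem_thickening_iff]
      refine ⟨y, hy, ?_⟩
      have : infDist x C ≤ R := hx2
      linarith

lemma compact_annulus (hC : IsClosed C) (hne : C.Nonempty) (hfr : IsCompact (frontier C))
    {s : ℝ} (hs : 0 < s) (R : ℝ) :
    IsCompact {x | s ≤ dC C x ∧ dC C x ≤ R} := by
  have h1 : {x | s ≤ dC C x ∧ dC C x ≤ R} =
      (closure Cᶜ ∩ {x | dC C x ≤ R}) ∩ {x | s ≤ dC C x} := by
    ext x
    constructor
    · rintro ⟨h1, h2⟩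
      exact ⟨⟨subset_closure ((dC_pos_iff hC hne x).1 (hs.trans_le h1)), h2⟩, h1⟩
    · rintro ⟨⟨_, h2⟩, h1⟩
      exact ⟨h1, h2⟩
  rw [h1]
  exact (compact_near hC hne hfr R).inter_right (isClosed_le continuous_const (dC_cont C))

lemma annulus_subset (hC : IsClosed C) (hne : C.Nonempty) {s : ℝ} (hs : 0 < s) (R : ℝ) :
    {x | s ≤ dC C x ∧ dC C x ≤ R} ⊆ Cᶜ :=
  fun x hx => (dC_pos_iff hC hne x).1 (hs.trans_le hx.1)

variable {W : Euc n → ℝ}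

lemma pos_lower_of_compact {Q : Set (Euc n)} (hQ : IsCompact Q) {g : Euc n → ℝ}
    (hg : ContinuousOn g Q) (hpos : ∀ x ∈ Q, 0 < g x) : ∃ c > 0, ∀ x ∈ Q, c ≤ g x := by
  rcases Q.eq_empty_or_nonempty with rfl | hne
  · exact ⟨1, one_pos, by simp⟩
  · obtain ⟨x, hx, hmin⟩ := hQ.exists_isMinOn hne hg
    exact ⟨g x, hpos x hx, fun y hy => hmin hy⟩

lemma upper_of_compact {Q : Set (Euc n)} (hQ : IsCompact Q) {g : Euc n → ℝ}
    (hg : ContinuousOn g Q) : ∃ c > 0, ∀ x ∈ Q, g x ≤ c := by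
  obtain ⟨b, hb⟩ := (hQ.image_of_continuousOn hg).bddAbove
  exact ⟨max b 1, lt_max_of_lt_right one_pos,
    fun x hx => (hb (Set.mem_image_of_mem g hx)).trans (le_max_left _ _)⟩

/-- small values of `W` force small distance -/
lemma cmp1 (hC : IsClosed C) (hne : C.Nonempty) (hWc : ContinuousOn W (closure Cᶜ))
    (hWpd : PosDefOn C W) (hWpr : ProperOn C W) {r : ℝ} (hr : 0 < r) :
    ∃ ω > 0, ∀ x, x ∉ C → W x ≤ ω → dC C x ≤ r := by
  have hcomp : IsCompact ((closure Cᶜ ∩ W ⁻¹' Set.Icc 0 1) ∩ {x | r ≤ dC C x}) :=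
    (hWpr _ isCompact_Icc Set.Icc_subset_Ici_self).inter_right
      (isClosed_le continuous_const (dC_cont C))
  obtain ⟨c, hc, hc'⟩ := pos_lower_of_compact hcomp
    (hWc.mono (fun x hx => hx.1.1))
    (fun x hx => hWpd.1 x ((dC_pos_iff hC hne x).1 (hr.trans_le hx.2)))
  refine ⟨min 1 c / 2, by positivity, fun x hx hW => ?_⟩
  by_contra hcon
  have h1 : min 1 c ≤ 1 := min_le_left _ _
  have h2 : min 1 c ≤ c := min_le_right _ _
  have h3 : 0 < min 1 c := lt_min one_pos hc
  have := hc' x ⟨⟨subset_closure hx, (hWpd.1 x hx).le, by linarith⟩, (not_le.1 hcon).le⟩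
  linarith

/-- small distance forces small values of `W` -/
lemma cmp2 (hC : IsClosed C) (hne : C.Nonempty) (hfr : IsCompact (frontier C))
    (hWc : ContinuousOn W (closure Cᶜ))
    (hWpd : PosDefOn C W) {ω : ℝ} (hω : 0 < ω) :
    ∃ s > 0, ∀ x, x ∉ C → dC C x ≤ s → W x ≤ ω := by
  have hcomp0 := compact_near hC hne hfr 1
  have hcomp : IsCompact ((closure Cᶜ ∩ {x | dC C x ≤ 1}) ∩ W ⁻¹' Set.Ici ω) :=
    hcomp0.of_isClosed_subset
      ((hWc.mono Set.inter_subset_left).preimage_isClosed_of_isClosed hcomp0.isClosed isClosed_Ici)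
      Set.inter_subset_left
  obtain ⟨c, hc, hc'⟩ := pos_lower_of_compact hcomp (g := dC C) (dC_cont C).continuousOn (by
    rintro x ⟨⟨h1, h2⟩, h3⟩
    rw [dC_pos_iff hC hne]
    intro hxC
    have : x ∈ frontier C := by
      rw [frontier_eq_closure_inter_closure]
      exact ⟨subset_closure hxC, h1⟩
    have h4 := hWpd.2 x this
    have h5 : ω ≤ W x := h3
    linarith)
  refine ⟨min 1 c / 2, by positivity, fun x hx hd => ?_⟩
  by_contra hcon
  have h1 : min 1 c ≤ 1 := min_le_left _ _
  have h2 : min 1 c ≤ c := min_le_right _ _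
  have h3 : 0 < min 1 c := lt_min one_pos hc
  have := hc' x ⟨⟨subset_closure hx, by show dC C x ≤ 1; linarith⟩, (not_le.1 hcon).le⟩
  linarith

lemma cmp3 (hC : IsClosed C) (hne : C.Nonempty) (hfr : IsCompact (frontier C))
    (hWc : ContinuousOn W (closure Cᶜ)) (R : ℝ) :
    ∃ Ω > 0, ∀ x, x ∉ C → dC C x ≤ R → W x ≤ Ω := by
  obtain ⟨c, hc, hc'⟩ := upper_of_compact (compact_near hC hne hfr R)
    (hWc.mono Set.inter_subset_left)
  exact ⟨c, hc, fun x hx hd => hc' x ⟨subset_closure hx, hd⟩⟩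

lemma cmp4 (hWpd : PosDefOn C W) (hWpr : ProperOn C W) (Ω : ℝ) :
    ∃ R > 0, ∀ x, x ∉ C → W x ≤ Ω → dC C x ≤ R := by
  obtain ⟨c, hc, hc'⟩ := upper_of_compact
    (hWpr (Set.Icc 0 Ω) isCompact_Icc Set.Icc_subset_Ici_self) (g := dC C) (dC_cont C).continuousOn
  exact ⟨c, hc, fun x hx hd => hc' x ⟨subset_closure hx, (hWpd.1 x hx).le, hd⟩⟩

end geometry

section control
variable {n m : ℕ} {C : Set (Euc n)} {U : Set (Euc m)}
    {f : Euc n → Euc m → Euc n} {l : Euc n → Euc m → ℝ}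

lemma exists_ctrl_of_Ham_lt {p0 : ℝ} {x p : Euc n} {c : ℝ} (hc : c ≤ 0)
    (h : Ham U f l p0 x p < c) : ∃ u ∈ U, ⟪p, f x u⟫ + p0 * l x u < c := by
  unfold Ham at h
  have hne : ((fun u => ⟪p, f x u⟫ + p0 * l x u) '' U).Nonempty := by
    by_contra hcon
    rw [Set.not_nonempty_iff_eq_empty] at hcon
    rw [hcon, Real.sInf_empty] at h
    linarith
  obtain ⟨_, ⟨u, hu, rfl⟩, hlt⟩ := exists_lt_of_csInf_lt hne h
  exact ⟨u, hu, hlt⟩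

lemma target_nonempty {p0 : ℝ} {W W1 : Euc n → ℝ} {γt : ℝ → ℝ}
    (hH1 : HypH1 C U f l) (hp0 : 0 < p0)
    (hWc : ContinuousOn W (closure Cᶜ))
    (hWpd : PosDefOn C W) (hWpr : ProperOn C W)
    (hγ : RateFun γt) (hW1pd : PosDefOn C W1)
    (hdec : ∀ x, x ∉ C → ∀ p ∈ proxSubdiff W x, Ham U f l p0 x p ≤ -γt (W1 x)) :
    C.Nonempty := by
  by_contra hcon
  rw [Set.not_nonempty_iff_eq_empty] at hcon
  subst hcon
  simp only [Set.compl_empty, closure_univ] at *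
  have hpos : ∀ x, 0 < W x := fun x => hWpd.1 x (by simp)
  have hcomp := hWpr (Set.Icc 0 (W 0)) isCompact_Icc Set.Icc_subset_Ici_self
  simp only [Set.compl_empty, closure_univ, Set.univ_inter] at hcomp
  obtain ⟨x, hx, hmin⟩ := hcomp.exists_isMinOn ⟨0, (hpos 0).le, le_rfl⟩
    (hWc.mono (Set.subset_univ _))
  have hmin' : ∀ y, W x ≤ W y := by
    intro y
    by_cases hy : W y ≤ W 0
    · exact hmin ⟨(hpos y).le, hy⟩
    · exact hx.2.trans (not_le.1 hy).le
  have h0 : (0 : Euc n) ∈ proxSubdiff W x := by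
    refine ⟨1, one_pos, 1, one_pos, fun y _ => ?_⟩
    have := hmin' y
    rw [inner_zero_left]
    have : 0 ≤ ‖y - x‖ ^ 2 := by positivity
    linarith
  have h1 := hdec x (by simp) 0 h0
  have h2 : 0 ≤ Ham U f l p0 x 0 := by
    apply Real.sInf_nonneg
    rintro _ ⟨u, hu, rfl⟩
    have := hH1.2.2.2.1 x u hu
    simp only [inner_zero_left, zero_add]
    positivity
  have h3 := hγ.2.2 (W1 x) (hW1pd.1 x (by simp))
  linarith

/-- uniform bound on the controls needed over a compact set of (point, subgradient) pairs -/
lemma exists_bounded_ctrl {p0 : ℝ} {W : Euc n → ℝ} {g : Euc n → ℝ} (hp0 : 0 < p0)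
    {Q : Set (Euc n)} (hQ : IsCompact Q) {Mf Lf Ll c M : ℝ} (hMf : 0 < Mf)
    (hLf : 0 < Lf) (hLl : 0 < Ll) (hc : 0 < c) (hM : 0 < M)
    (hbd : ∀ x ∈ Q, ∀ u ∈ U, ‖f x u‖ ≤ Mf)
    (hlip : ∀ x₁ ∈ Q, ∀ x₂ ∈ Q, ∀ u ∈ U,
        ‖f x₁ u - f x₂ u‖ ≤ Lf * ‖x₁ - x₂‖ ∧ |l x₁ u - l x₂ u| ≤ Ll * ‖x₁ - x₂‖)
    (hcg : ∀ x ∈ Q, c ≤ g x)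
    (hdec : ∀ x ∈ Q, ∀ p ∈ proxSubdiff W x, Ham U f l p0 x p ≤ - g x) :
    ∃ N : ℝ, ∀ y ∈ Q, ∀ p ∈ proxSubdiff W y, ‖p‖ ≤ M →
      ∃ u ∈ U, ‖u‖ ≤ N ∧ ⟪p, f y u⟫ + p0 * l y u ≤ - (c / 2) := by
  set G : Set (Euc n × Euc n) := {q | q.1 ∈ Q ∧ q.2 ∈ proxSubdiff W q.1 ∧ ‖q.2‖ ≤ M} with hG
  have hGtb : TotallyBounded G := by
    refine (hQ.prod (isCompact_closedBall (0 : Euc n) M)).totallyBounded.subset ?_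
    rintro ⟨y, p⟩ ⟨h1, _, h3⟩
    exact ⟨h1, by simpa using h3⟩
  set A : ℝ := Mf + M * Lf + p0 * Ll with hA
  have hA0 : 0 < A := by positivity
  set ε : ℝ := c / 4 / A with hε
  have hε0 : 0 < ε := by positivity
  obtain ⟨t, htG, htf, htc⟩ := Metric.finite_approx_of_totallyBounded hGtb ε hε0
  have hsel : ∀ q : Euc n × Euc n, ∃ u, q ∈ G → u ∈ U ∧
      ⟪q.2, f q.1 u⟫ + p0 * l q.1 u < - (3 * c / 4) := by
    intro q
    by_cases hq : q ∈ G
    · have h1 := hdec q.1 hq.1 q.2 hq.2.1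
      have h2 := hcg q.1 hq.1
      obtain ⟨u, hu, hlt⟩ := exists_ctrl_of_Ham_lt (U := U) (f := f) (l := l) (p0 := p0)
        (x := q.1) (p := q.2) (c := - (3 * c / 4)) (by linarith) (by linarith)
      exact ⟨u, fun _ => ⟨hu, hlt⟩⟩
    · exact ⟨0, fun h => absurd h hq⟩
  choose us hus using hsel
  obtain ⟨N, hN⟩ := ((htf.image us).isBounded).exists_norm_le
  refine ⟨N, fun y hy p hp hpM => ?_⟩
  have hmem : (y, p) ∈ G := ⟨hy, hp, hpM⟩
  have := htc hmem
  simp only [Set.mem_iUnion] at this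
  obtain ⟨q, hqt, hqd⟩ := this
  have hqG := htG hqt
  obtain ⟨huU, hlt⟩ := hus q hqG
  refine ⟨us q, huU, hN _ (Set.mem_image_of_mem _ hqt), ?_⟩
  rw [Metric.mem_ball, Prod.dist_eq, max_lt_iff] at hqd
  obtain ⟨hd1, hd2⟩ := hqd
  simp only [dist_eq_norm] at hd1 hd2
  obtain ⟨hf1, hl1⟩ := hlip y hy q.1 hqG.1 (us q) huU
  have hfb := hbd y hy (us q) huU
  have e1 : ⟪p, f y (us q)⟫ - ⟪q.2, f q.1 (us q)⟫
      = ⟪p - q.2, f y (us q)⟫ + ⟪q.2, f y (us q) - f q.1 (us q)⟫ := by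
    rw [inner_sub_left, inner_sub_right]; ring
  have e2 : ⟪p - q.2, f y (us q)⟫ ≤ ε * Mf :=
    (real_inner_le_norm _ _).trans
      (mul_le_mul hd2.le hfb (norm_nonneg _) hε0.le)
  have e3 : ⟪q.2, f y (us q) - f q.1 (us q)⟫ ≤ M * (Lf * ε) :=
    (real_inner_le_norm _ _).trans
      (mul_le_mul hqG.2.2 (hf1.trans (mul_le_mul_of_nonneg_left hd1.le hLf.le))
        (norm_nonneg _) hM.le)
  have e4 : l y (us q) - l q.1 (us q) ≤ Ll * ε :=
    (le_abs_self _).trans (hl1.trans (mul_le_mul_of_nonneg_left hd1.le hLl.le))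
  have e5 : p0 * (l y (us q) - l q.1 (us q)) ≤ p0 * (Ll * ε) :=
    mul_le_mul_of_nonneg_left e4 hp0.le
  have e6 : ε * A = c / 4 := by rw [hε]; field_simp
  have e7 : ε * Mf + M * (Lf * ε) + p0 * (Ll * ε) = ε * A := by rw [hA]; ring
  linarith

end control

lemma exists_small (L : List (ℝ × ℝ)) (hL : ∀ q ∈ L, 0 < q.1 ∧ 0 < q.2) :
    ∃ e > 0, ∀ q ∈ L, e * q.1 ≤ q.2 := by
  induction L with
  | nil => exact ⟨1, one_pos, by simp⟩
  | cons a L ih =>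
    obtain ⟨e, he, hq⟩ := ih (fun q hq => hL q (List.mem_cons_of_mem _ hq))
    obtain ⟨h1, h2⟩ := hL a List.mem_cons_self
    refine ⟨min e (a.2 / a.1), lt_min he (div_pos h2 h1), fun q hq' => ?_⟩
    rcases List.mem_cons.1 hq' with rfl | hq'
    · exact (le_div_iff₀ h1).1 (min_le_right _ _)
    · exact (mul_le_mul_of_nonneg_right (min_le_left _ _)
        (hL q (List.mem_cons_of_mem _ hq')).1.le).trans (hq q hq')

/-- Constants attached to a compact set. -/
structure LvlConst where
  L : ℝ
  Mf : ℝ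
  Lf : ℝ
  Ll : ℝ
  c : ℝ
  w : ℝ
  Wm : ℝ
  N : ℝ

/-- The constants are valid on the compact set `Q`. -/
structure LvlOK {n m : ℕ} (U : Set (Euc m))
    (f : Euc n → Euc m → Euc n) (l : Euc n → Euc m → ℝ) (p0 : ℝ) (W : Euc n → ℝ)
    (Q : Set (Euc n)) (k : LvlConst) : Prop where
  hL : 0 < k.L
  hMf : 0 < k.Mf
  hLf : 0 < k.Lf
  hLl : 0 < k.Ll
  hc : 0 < k.c
  hw : 0 < k.w
  hWm : 0 < k.Wm
  lipW : ∀ x ∈ Q, ∀ y ∈ Q, |W x - W y| ≤ k.L * ‖x - y‖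
  bdf : ∀ x ∈ Q, ∀ u ∈ U, ‖f x u‖ ≤ k.Mf
  lip : ∀ x₁ ∈ Q, ∀ x₂ ∈ Q, ∀ u ∈ U,
        ‖f x₁ u - f x₂ u‖ ≤ k.Lf * ‖x₁ - x₂‖ ∧ |l x₁ u - l x₂ u| ≤ k.Ll * ‖x₁ - x₂‖
  bdW : ∀ x ∈ Q, k.w ≤ W x ∧ W x ≤ k.Wm
  ctrl : ∀ y ∈ Q, ∀ p ∈ proxSubdiff W y, ‖p‖ ≤ 2 * k.L →
      ∃ u ∈ U, ‖u‖ ≤ k.N ∧ ⟪p, f y u⟫ + p0 * l y u ≤ - (k.c / 2)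

section stat
variable {n m : ℕ} {C : Set (Euc n)} {U : Set (Euc m)}
    {f : Euc n → Euc m → Euc n} {l : Euc n → Euc m → ℝ} {p0 : ℝ} {W W1 : Euc n → ℝ} {γt : ℝ → ℝ}

lemma exists_lvl (hH1 : HypH1 C U f l) (hp0 : 0 < p0)
    (hWc : ContinuousOn W (closure Cᶜ))
    (hWlip : LocLipschitzOn (closure Cᶜ) W)
    (hWpd : PosDefOn C W)
    (hγ : RateFun γt)
    (hW1c : ContinuousOn W1 (closure Cᶜ))
    (hW1pd : PosDefOn C W1)
    (hdec : ∀ x, x ∉ C → ∀ p ∈ proxSubdiff W x, Ham U f l p0 x p ≤ -γt (W1 x))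
    {Q : Set (Euc n)} (hQ : IsCompact Q) (hQC : Q ⊆ Cᶜ) :
    ∃ k, LvlOK U f l p0 W Q k := by
  have hQC' : Q ⊆ closure Cᶜ := hQC.trans subset_closure
  obtain ⟨Mf, Ml, Lf, Ll, hMf, hMl, hLf, hLl, hbd, hlip⟩ := hH1.2.2.2.2.2.2 Q hQ hQC'
  have hll : LocallyLipschitzOn Q W := by
    have : LocallyLipschitzOn (closure Cᶜ) W := by
      intro x hx
      obtain ⟨K, t, ht, hK⟩ := hWlip x hx
      exact ⟨K, t, ht, hK⟩
    exact this.mono hQC'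
  obtain ⟨L, hL⟩ := hll.exists_lipschitzOnWith_of_compact hQ
  obtain ⟨c, hc, hc'⟩ := pos_lower_of_compact hQ (g := fun x => γt (W1 x))
    (hγ.1.comp (hW1c.mono hQC') (fun x hx => hW1pd.1 x (hQC hx)))
    (fun x hx => hγ.2.2 _ (hW1pd.1 x (hQC hx)))
  obtain ⟨w, hw, hw'⟩ := pos_lower_of_compact hQ (hWc.mono hQC') (fun x hx => hWpd.1 x (hQC hx))
  obtain ⟨Wm, hWm, hWm'⟩ := upper_of_compact hQ (hWc.mono hQC')
  have hL1 : (0:ℝ) < L + 1 := by positivity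
  obtain ⟨N, hN⟩ := exists_bounded_ctrl (W := W) (g := fun x => γt (W1 x)) hp0 hQ hMf hLf hLl hc
    (M := 2 * (L + 1)) (by positivity) (fun x hx u hu => (hbd x hx u hu).1) hlip hc'
    (fun x hx p hp => hdec x (hQC hx) p hp)
  refine ⟨⟨L + 1, Mf, Lf, Ll, c, w, Wm, N⟩, hL1, hMf, hLf, hLl, hc, hw, hWm, ?_,
    fun x hx u hu => (hbd x hx u hu).1, hlip, fun x hx => ⟨hw' x hx, hWm' x hx⟩, hN⟩
  intro x hx y hy
  have := hL.dist_le_mul x hx y hy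
  rw [Real.dist_eq, dist_eq_norm] at this
  have h2 := norm_nonneg (x - y)
  show _ ≤ ((L:ℝ) + 1) * ‖x - y‖
  linarith

lemma exists_min_pt (hWc : ContinuousOn W (closure Cᶜ)) (hWnn : ∀ x ∈ closure Cᶜ, 0 ≤ W x)
    (hWpr : ProperOn C W) {x : Euc n} (hx : x ∉ C) {a : ℝ} (ha : 0 < a) :
    ∃ y ∈ closure Cᶜ, ∀ y' ∈ closure Cᶜ, W y + a * ‖x - y‖ ^ 2 ≤ W y' + a * ‖x - y'‖ ^ 2 := by
  have hx' : x ∈ closure Cᶜ := subset_closure hx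
  have hcomp := hWpr (Set.Icc 0 (W x)) isCompact_Icc Set.Icc_subset_Ici_self
  have hcont : ContinuousOn (fun y => W y + a * ‖x - y‖ ^ 2) (closure Cᶜ) :=
    hWc.add (by fun_prop)
  obtain ⟨y, hy, hmin⟩ := hcomp.exists_isMinOn ⟨x, hx', hWnn x hx', le_rfl⟩
    (hcont.mono Set.inter_subset_left)
  refine ⟨y, hy.1, fun y' hy' => ?_⟩
  by_cases h : W y' ≤ W x
  · exact hmin ⟨hy', hWnn y' hy', h⟩
  · have h1 : W y + a * ‖x - y‖ ^ 2 ≤ W x + a * ‖x - x‖ ^ 2 := hmin ⟨hx', hWnn x hx', le_rfl⟩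
    rw [sub_self, norm_zero] at h1
    have : 0 ≤ a * ‖x - y'‖ ^ 2 := by positivity
    linarith [not_le.1 h]

lemma prox_of_min (hC : IsClosed C) {x y : Euc n} (hy : y ∉ C) {a : ℝ} (ha : 0 < a)
    (hmin : ∀ y' ∈ closure Cᶜ, W y + a * ‖x - y‖ ^ 2 ≤ W y' + a * ‖x - y'‖ ^ 2) :
    (2 * a) • (x - y) ∈ proxSubdiff W y := by
  obtain ⟨η, hη, hball⟩ := Metric.nhds_basis_closedBall.mem_iff.1 (hC.isOpen_compl.mem_nhds hy)
  refine ⟨a, ha, η, hη, fun y' hy' => ?_⟩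
  have h1 := hmin y' (subset_closure (hball (by simpa [dist_eq_norm] using hy')))
  have h2 : x - y' = (x - y) - (y' - y) := by abel
  rw [h2, norm_sub_sq_real (x - y) (y' - y)] at h1
  rw [real_inner_smul_left]
  linarith

lemma step_est {x y : Euc n} {b b' L M Lf Ll c h t0 : ℝ} {X : ℝ → Euc n} {u : Euc m}
    {V : Euc n → ℝ} {Q : Set (Euc n)}
    (hp0 : 0 < p0) (hL : 0 < L) (hLf : 0 < Lf) (hLl : 0 < Ll) (hM : 0 < M)
    (hb : 0 < b) (hb' : b / 2 ≤ b') (hh : 0 < h) (huU : u ∈ U)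
    (hVx : V x = W y + b⁻¹ * ‖x - y‖ ^ 2)
    (hVx' : V (X (t0 + h)) ≤ W y + b'⁻¹ * ‖X (t0 + h) - y‖ ^ 2)
    (hxy : ‖x - y‖ ≤ L * b)
    (hu : ⟪(2 * b⁻¹) • (x - y), f y u⟫ + p0 * l y u ≤ - (c / 2))
    (hyQ : y ∈ Q) (hXQ : ∀ τ ∈ Set.Icc t0 (t0 + h), X τ ∈ Q)
    (hlip : ∀ x₁ ∈ Q, ∀ x₂ ∈ Q, ∀ u ∈ U,
        ‖f x₁ u - f x₂ u‖ ≤ Lf * ‖x₁ - x₂‖ ∧ |l x₁ u - l x₂ u| ≤ Ll * ‖x₁ - x₂‖)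
    (hlc : ContinuousOn (fun τ => l (X τ) u) (Set.Icc t0 (t0 + h)))
    (hX0 : X t0 = x) (hXc : ContinuousOn X (Set.Icc t0 (t0 + h)))
    (hXd : ∀ τ ∈ Set.Ioo t0 (t0 + h), HasDerivAt X (f (X τ) u) τ)
    (hXM : ∀ τ ∈ Set.Icc t0 (t0 + h), ‖X τ - x‖ ≤ M * (τ - t0))
    (h1 : M * h ≤ L * b) (h2 : 8 * L ^ 2 * |b - b'| ≤ c / 8 * h)
    (h3 : (2 * L * Lf + p0 * Ll) * (L * b) ≤ c / 8)
    (h4 : b⁻¹ * M ^ 2 * h ≤ c / 16) (h5 : (2 * L * Lf + p0 * Ll) * (M * h) ≤ c / 16) :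
    V (X (t0 + h)) + p0 * (∫ τ in t0..(t0 + h), l (X τ) u) + c / 8 * h ≤ V x := by
  have ht : t0 < t0 + h := by linarith
  set ζ : Euc n := (2 * b⁻¹) • (x - y) with hζ
  set x' := X (t0 + h) with hx'
  have hbi : 0 < b⁻¹ := inv_pos.2 hb
  have hζn : ‖ζ‖ ≤ 2 * L := by
    rw [hζ, norm_smul, Real.norm_of_nonneg (by positivity)]
    calc 2 * b⁻¹ * ‖x - y‖ ≤ 2 * b⁻¹ * (L * b) := by gcongr
      _ = 2 * L := by field_simp
  have hXy : ∀ τ ∈ Set.Icc t0 (t0 + h), ‖X τ - y‖ ≤ M * h + L * b := by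
    intro τ hτ
    have e1 : X τ - y = (X τ - x) + (x - y) := by abel
    rw [e1]
    refine (norm_add_le _ _).trans (add_le_add ((hXM τ hτ).trans ?_) hxy)
    exact mul_le_mul_of_nonneg_left (by linarith [hτ.2]) hM.le
  -- mean value theorem
  have hA : ⟪ζ, x' - x⟫ ≤ h * (⟪ζ, f y u⟫ + 2 * L * (Lf * (M * h + L * b))) := by
    obtain ⟨ξ, hξ, hξ'⟩ := exists_hasDerivAt_eq_slope (fun τ => ⟪ζ, X τ⟫)
      (fun τ => ⟪ζ, f (X τ) u⟫) ht
      (continuousOn_const.inner hXc)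
      (fun τ hτ => by
        have := (hasDerivAt_const τ ζ).inner ℝ (hXd τ hτ)
        simpa using this)
    have e1 : t0 + h - t0 = h := by ring
    rw [e1, eq_div_iff hh.ne'] at hξ'
    have e2 : ⟪ζ, x' - x⟫ = h * ⟪ζ, f (X ξ) u⟫ := by
      rw [inner_sub_right, mul_comm, hξ', hX0]
    rw [e2]
    apply mul_le_mul_of_nonneg_left _ hh.le
    have hξI := Set.Ioo_subset_Icc_self hξ
    have e3 : ⟪ζ, f (X ξ) u⟫ = ⟪ζ, f y u⟫ + ⟪ζ, f (X ξ) u - f y u⟫ := by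
      rw [inner_sub_right]; ring
    rw [e3]
    gcongr
    refine (real_inner_le_norm _ _).trans
      (mul_le_mul hζn ?_ (norm_nonneg _) (by positivity))
    refine ((hlip _ (hXQ ξ hξI) y hyQ u huU).1).trans ?_
    exact mul_le_mul_of_nonneg_left (hXy ξ hξI) hLf.le
  have hB : (∫ τ in t0..(t0 + h), l (X τ) u) ≤ h * (l y u + Ll * (M * h + L * b)) := by
    have hi : IntervalIntegrable (fun τ => l (X τ) u) volume t0 (t0 + h) :=
      ContinuousOn.intervalIntegrable_of_Icc ht.le hlc
    have := intervalIntegral.integral_mono_on ht.le hi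
      (intervalIntegrable_const (c := l y u + Ll * (M * h + L * b))) (fun τ hτ => by
        have := (abs_le.1 (hlip _ (hXQ τ hτ) y hyQ u huU).2).2
        have h' := mul_le_mul_of_nonneg_left (hXy τ hτ) hLl.le
        linarith)
    rw [intervalIntegral.integral_const, smul_eq_mul, add_sub_cancel_left] at this
    exact this
  have hB' := mul_le_mul_of_nonneg_left hB hp0.le
  have hX'x : ‖x' - x‖ ≤ M * h := by
    have := hXM (t0 + h) ⟨ht.le, le_rfl⟩
    simpa using this
  have hCc : b⁻¹ * ‖x' - y‖ ^ 2 ≤ b⁻¹ * ‖x - y‖ ^ 2 + ⟪ζ, x' - x⟫ + b⁻¹ * (M * h) ^ 2 := by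
    have e1 : x' - y = (x - y) + (x' - x) := by abel
    rw [e1, norm_add_sq_real, hζ, real_inner_smul_left]
    have : b⁻¹ * ‖x' - x‖ ^ 2 ≤ b⁻¹ * (M * h) ^ 2 := by gcongr
    linarith
  have hb'0 : 0 < b' := by linarith
  have hD : b'⁻¹ * ‖x' - y‖ ^ 2 - b⁻¹ * ‖x' - y‖ ^ 2 ≤ 8 * L ^ 2 * |b - b'| := by
    have e1 : ‖x' - y‖ ≤ 2 * (L * b) := by
      have := hXy (t0 + h) ⟨ht.le, le_rfl⟩
      linarith
    have e2 : ‖x' - y‖ ^ 2 ≤ (2 * (L * b)) ^ 2 := by gcongr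
    have e3 : b'⁻¹ - b⁻¹ ≤ 2 * |b - b'| * (b⁻¹) ^ 2 := by
      have e4 : b'⁻¹ - b⁻¹ = (b - b') * (b'⁻¹ * b⁻¹) := by field_simp
      have e5 : b'⁻¹ ≤ 2 * b⁻¹ := by
        rw [inv_le_comm₀ hb'0 (by positivity), mul_inv, inv_inv]; linarith
      rw [e4]
      calc (b - b') * (b'⁻¹ * b⁻¹) ≤ |b - b'| * (2 * b⁻¹ * b⁻¹) := by
            gcongr
            exact le_abs_self _
        _ = _ := by ring
    calc b'⁻¹ * ‖x' - y‖ ^ 2 - b⁻¹ * ‖x' - y‖ ^ 2 = (b'⁻¹ - b⁻¹) * ‖x' - y‖ ^ 2 := by ring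
      _ ≤ (2 * |b - b'| * (b⁻¹) ^ 2) * ‖x' - y‖ ^ 2 := by gcongr
      _ ≤ (2 * |b - b'| * (b⁻¹) ^ 2) * (2 * (L * b)) ^ 2 := by gcongr
      _ = _ := by field_simp; ring
  have h3' := mul_le_mul_of_nonneg_left h3 hh.le
  have h4' := mul_le_mul_of_nonneg_left h4 hh.le
  have h5' := mul_le_mul_of_nonneg_left h5 hh.le
  have hu' := mul_le_mul_of_nonneg_left hu hh.le
  rw [hVx]
  nlinarith [h3', h4', h5', hu', hA, hB', hCc, hD, hVx', h2]
end stat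

/-- The gauge `d + 1/d`. -/
noncomputable def gauge1 {n : ℕ} (C : Set (Euc n)) (x : Euc n) : ℝ := dC C x + (dC C x)⁻¹

/-- The level set annulus. -/
def annQ {n : ℕ} (C : Set (Euc n)) (k : ℕ) : Set (Euc n) :=
  {x | 1 / (2 * ((k:ℝ) + 1)) ≤ dC C x ∧ dC C x ≤ 2 * ((k:ℝ) + 1)}

section stat
variable {n m : ℕ} {C : Set (Euc n)} {U : Set (Euc m)}
    {f : Euc n → Euc m → Euc n} {l : Euc n → Euc m → ℝ} {p0 : ℝ} {W W1 : Euc n → ℝ} {γt : ℝ → ℝ}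

lemma level_bounds {x : Euc n} (hx : 0 < dC C x) {k : ℕ} (hk : k = ⌊gauge1 C x⌋₊) :
    (k:ℝ) ≤ gauge1 C x ∧ gauge1 C x < k + 1 ∧ 1 / ((k:ℝ) + 1) < dC C x ∧ dC C x < k + 1 := by
  have hi : 0 < (dC C x)⁻¹ := inv_pos.2 hx
  have hg : 0 ≤ gauge1 C x := by unfold gauge1; positivity
  have h1 : (k:ℝ) ≤ gauge1 C x := by rw [hk]; exact Nat.floor_le hg
  have h2 : gauge1 C x < k + 1 := by rw [hk]; exact Nat.lt_floor_add_one _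
  refine ⟨h1, h2, ?_, ?_⟩
  · have h3 : (dC C x)⁻¹ < k + 1 := by unfold gauge1 at h2; linarith
    rw [one_div]
    exact inv_lt_of_inv_lt₀ hx h3
  · unfold gauge1 at h2; linarith

lemma mem_annQ_of_near {x w : Euc n} (hx : 0 < dC C x) {k : ℕ} (hk : k = ⌊gauge1 C x⌋₊)
    (hw : ‖w - x‖ ≤ dC C x / 2) : w ∈ annQ C k := by
  obtain ⟨_, _, h3, h4⟩ := level_bounds hx hk
  have h5 := abs_le.1 (dC_lip C w x)
  constructor
  · have : 1 / (2 * ((k:ℝ) + 1)) = (1 / ((k:ℝ) + 1)) / 2 := by field_simp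
    rw [this]; linarith [h5.1]
  · linarith [h5.2]

lemma gauge_lip {k : ℕ} {x w : Euc n} (hx : x ∈ annQ C k) (hw : w ∈ annQ C k) :
    |gauge1 C x - gauge1 C w| ≤ (1 + 4 * ((k:ℝ) + 1) ^ 2) * ‖x - w‖ := by
  have hk : (0:ℝ) < (k:ℝ) + 1 := by positivity
  have hq : (0:ℝ) < 1 / (2 * ((k:ℝ) + 1)) := by positivity
  have hx0 : 0 < dC C x := hq.trans_le hx.1
  have hw0 : 0 < dC C w := hq.trans_le hw.1
  have e1 : gauge1 C x - gauge1 C w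
      = (dC C x - dC C w) * (1 - (dC C x)⁻¹ * (dC C w)⁻¹) := by
    unfold gauge1; field_simp; ring
  have e2 : (dC C x)⁻¹ ≤ 2 * ((k:ℝ) + 1) := by
    rw [inv_le_comm₀ hx0 (by positivity)]; simpa using hx.1
  have e3 : (dC C w)⁻¹ ≤ 2 * ((k:ℝ) + 1) := by
    rw [inv_le_comm₀ hw0 (by positivity)]; simpa using hw.1
  have e4 : (dC C x)⁻¹ * (dC C w)⁻¹ ≤ (2 * ((k:ℝ) + 1)) * (2 * ((k:ℝ) + 1)) :=
    mul_le_mul e2 e3 (inv_pos.2 hw0).le (by positivity)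
  have e5 : 0 ≤ (dC C x)⁻¹ * (dC C w)⁻¹ := by positivity
  have e6 : |1 - (dC C x)⁻¹ * (dC C w)⁻¹| ≤ 1 + 4 * ((k:ℝ) + 1) ^ 2 := by
    rw [abs_le]; constructor <;> nlinarith
  rw [e1, abs_mul, mul_comm]
  exact mul_le_mul e6 (dC_lip C x w) (abs_nonneg _) (by positivity)

/-- The static construction of feedback and Lyapunov-type function. -/
lemma exists_feedback (hH1 : HypH1 C U f l) (hne : C.Nonempty) (hp0 : 0 < p0)
    (hWc : ContinuousOn W (closure Cᶜ)) (hWnn : ∀ x ∈ closure Cᶜ, 0 ≤ W x)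
    (hWlip : LocLipschitzOn (closure Cᶜ) W)
    (hWpd : PosDefOn C W) (hWpr : ProperOn C W)
    (hγ : RateFun γt)
    (hW1c : ContinuousOn W1 (closure Cᶜ))
    (hW1pd : PosDefOn C W1)
    (hdec : ∀ x, x ∉ C → ∀ p ∈ proxSubdiff W x, Ham U f l p0 x p ≤ -γt (W1 x)) :
    ∃ (K : Euc n → Euc m) (V cr δf Mx : Euc n → ℝ), IsFeedback C U K ∧
      (∀ x, x ∉ C → V x ≤ W x ∧ W x ≤ 2 * V x) ∧
      (∀ s R : ℝ, 0 < s → ∃ c0 > 0, ∀ x, s ≤ dC C x → dC C x ≤ R → c0 ≤ cr x ∧ c0 ≤ δf x) ∧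
      ∀ x, x ∉ C → 0 < Mx x ∧ 0 < cr x ∧ Mx x * δf x ≤ dC C x / 2 ∧
        (∀ w, ‖w - x‖ ≤ dC C x / 2 → ‖f w (K x)‖ < Mx x) ∧
        ∀ (h t0 : ℝ) (X : ℝ → Euc n), 0 < h → h ≤ δf x → X t0 = x →
          ContinuousOn X (Set.Icc t0 (t0 + h)) →
          (∀ τ ∈ Set.Ioo t0 (t0 + h), HasDerivAt X (f (X τ) (K x)) τ) →
          (∀ τ ∈ Set.Icc t0 (t0 + h), ‖X τ - x‖ ≤ Mx x * (τ - t0)) →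
          V (X (t0 + h)) + p0 * (∫ τ in t0..(t0 + h), l (X τ) (K x)) + cr x * h ≤ V x := by
  have hC : IsClosed C := hH1.1
  have hfr := hH1.2.1
  have hdpos : ∀ x, x ∉ C → 0 < dC C x := fun x hx => (dC_pos_iff hC hne x).2 hx
  have hq : ∀ k : ℕ, (0:ℝ) < 1 / (2 * ((k:ℝ) + 1)) := fun k => by positivity
  have hQcomp : ∀ k, IsCompact (annQ C k) := fun k => compact_annulus hC hne hfr (hq k) _
  have hQC : ∀ k, annQ C k ⊆ Cᶜ := fun k => annulus_subset hC hne (hq k) _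
  have hlv : ∀ k, ∃ κ, LvlOK U f l p0 W (annQ C k) κ := fun k =>
    exists_lvl hH1 hp0 hWc hWlip hWpd hγ hW1c hW1pd hdec (hQcomp k) (hQC k)
  choose κ hκ using hlv
  set S : ℕ → ℝ := fun k => 2 * (κ k).L * (κ k).Lf + p0 * (κ k).Ll with hS
  have hS0 : ∀ k, 0 < S k := fun k => by
    have := (hκ k).hL; have := (hκ k).hLf; have := (hκ k).hLl
    simp only [hS]; positivity
  set M : ℕ → ℝ := fun k => (κ k).Mf + 1 with hM
  have hM0 : ∀ k, 0 < M k := fun k => by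
    have := (hκ k).hMf
    simp only [hM]; positivity
  set G : ℕ → ℝ := fun k => 1 + 4 * ((k:ℝ) + 1) ^ 2 with hG
  have hG0 : ∀ k, 0 < G k := fun k => by simp only [hG]; positivity
  have hes : ∀ k : ℕ, ∃ e : ℝ, 0 < e ∧ e * (κ k).Wm ≤ 1 / (4 * ((k:ℝ) + 1) ^ 2) ∧
      e * ((κ k).L ^ 2) ≤ (κ k).w / 2 ∧ e * (S k * (κ k).L) ≤ (κ k).c / 8 ∧
      e * (8 * (κ k).L ^ 2 * (G k * M k)) ≤ (κ k).c / 8 := by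
    intro k
    have i1 := (hκ k).hL; have i2 := (hκ k).hWm; have i3 := (hκ k).hw; have i4 := (hκ k).hc
    have i5 := hS0 k; have i6 := hM0 k; have i7 := hG0 k
    obtain ⟨e, he, heq⟩ := exists_small [((κ k).Wm, 1 / (4 * ((k:ℝ) + 1) ^ 2)),
      ((κ k).L ^ 2, (κ k).w / 2), (S k * (κ k).L, (κ k).c / 8),
      (8 * (κ k).L ^ 2 * (G k * M k), (κ k).c / 8)] (by
        intro q hq
        simp only [List.mem_cons, List.not_mem_nil, or_false] at hq
        rcases hq with rfl | rfl | rfl | rfl <;> constructor <;> simp only <;> positivity)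
    simp only [List.forall_mem_cons] at heq
    obtain ⟨a1, a2, a3, a4, _⟩ := heq
    exact ⟨e, he, a1, a2, a3, a4⟩
  choose e he0 he1 he2 he3 he4 using hes
  obtain ⟨Θ, hΘ0, hΘa, hΘe⟩ := exists_theta e he0
  have hds : ∀ k : ℕ, ∃ δ : ℝ, 0 < δ ∧ δ * M k ≤ (κ k).L * Θ (k + 2) ∧
      δ * M k ≤ 1 / (2 * ((k:ℝ) + 1)) ∧ δ * (G k * M k) ≤ 1 ∧
      δ * (e k * (G k * M k)) ≤ Θ (k + 2) / 2 ∧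
      δ * ((Θ (k + 2))⁻¹ * M k ^ 2) ≤ (κ k).c / 16 ∧ δ * (S k * M k) ≤ (κ k).c / 16 := by
    intro k
    have i1 := (hκ k).hL; have i4 := (hκ k).hc; have i8 := hΘ0 (k + 2); have i9 := he0 k
    have i5 := hS0 k; have i6 := hM0 k; have i7 := hG0 k
    obtain ⟨δ, hδ, hδq⟩ := exists_small [(M k, (κ k).L * Θ (k + 2)),
      (M k, 1 / (2 * ((k:ℝ) + 1))), (G k * M k, 1), (e k * (G k * M k), Θ (k + 2) / 2),
      ((Θ (k + 2))⁻¹ * M k ^ 2, (κ k).c / 16), (S k * M k, (κ k).c / 16)] (by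
        intro q hq
        simp only [List.mem_cons, List.not_mem_nil, or_false] at hq
        rcases hq with rfl | rfl | rfl | rfl | rfl | rfl <;> constructor <;> simp only <;>
          positivity)
    simp only [List.forall_mem_cons] at hδq
    obtain ⟨a1, a2, a3, a4, a5, a6, _⟩ := hδq
    exact ⟨δ, hδ, a1, a2, a3, a4, a5, a6⟩
  choose δ hδ0 hδ1 hδ2 hδ3 hδ4 hδ5 hδ6 using hds
  set b : Euc n → ℝ := fun x => Θ (gauge1 C x + 1) with hb
  have hb0 : ∀ x, 0 < b x := fun x => hΘ0 _
  set lev : Euc n → ℕ := fun x => ⌊gauge1 C x⌋₊ with hlev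
  have hymin : ∀ x, ∃ y, x ∉ C → y ∈ closure Cᶜ ∧
      ∀ y' ∈ closure Cᶜ, W y + (b x)⁻¹ * ‖x - y‖ ^ 2 ≤ W y' + (b x)⁻¹ * ‖x - y'‖ ^ 2 := by
    intro x
    by_cases hx : x ∈ C
    · exact ⟨0, fun h => absurd hx h⟩
    · obtain ⟨y, h1, h2⟩ := exists_min_pt hWc hWnn hWpr hx (inv_pos.2 (hb0 x))
      exact ⟨y, fun _ => ⟨h1, h2⟩⟩
  choose y hy using hymin
  -- basic facts on `b` and `y`
  have hbe : ∀ x, x ∉ C → b x ≤ e (lev x) := by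
    intro x hx
    have h1 := (level_bounds (hdpos x hx) rfl).1
    exact (hΘe (lev x) (gauge1 C x + 1) (gauge1 C x + 1) (by linarith) (by linarith)).1
  have hblow : ∀ x, x ∉ C → Θ (lev x + 2) ≤ b x := by
    intro x hx
    have h1 := (level_bounds (hdpos x hx) rfl).2.1
    exact hΘa (by linarith)
  have hxQ : ∀ x, x ∉ C → x ∈ annQ C (lev x) := fun x hx =>
    mem_annQ_of_near (hdpos x hx) rfl (by rw [sub_self, norm_zero]; have := hdpos x hx; linarith)
  have hqW : ∀ x, x ∉ C → (b x)⁻¹ * ‖x - y x‖ ^ 2 ≤ W x - W (y x) := by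
    intro x hx
    have := (hy x hx).2 x (subset_closure hx)
    rw [sub_self, norm_zero] at this
    linarith
  have hnear : ∀ x, x ∉ C → ‖y x - x‖ ≤ dC C x / 2 := by
    intro x hx
    have h1 := hqW x hx
    have h2 := hWnn _ (hy x hx).1
    have h3 := ((hκ (lev x)).bdW x (hxQ x hx)).2
    have h4 : ‖x - y x‖ ^ 2 ≤ b x * (κ (lev x)).Wm := by
      rw [inv_mul_le_iff₀ (hb0 x)] at h1
      exact h1.trans (mul_le_mul_of_nonneg_left (by linarith) (hb0 x).le)
    have h5 : b x * (κ (lev x)).Wm ≤ 1 / (4 * ((lev x:ℝ) + 1) ^ 2) :=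
      (mul_le_mul_of_nonneg_right (hbe x hx) (hκ (lev x)).hWm.le).trans (he1 _)
    have h6 := (level_bounds (hdpos x hx) (k := lev x) rfl).2.2.1
    have h7 : ‖x - y x‖ ^ 2 ≤ (1 / (2 * ((lev x:ℝ) + 1))) ^ 2 := by
      refine (h4.trans h5).trans (le_of_eq ?_)
      field_simp; norm_num
    have h8 := (pow_le_pow_iff_left₀ (norm_nonneg _) (hq (lev x)).le two_ne_zero).1 h7
    rw [norm_sub_rev]
    have : 1 / (2 * ((lev x:ℝ) + 1)) = (1 / ((lev x:ℝ) + 1)) / 2 := by field_simp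
    linarith
  have hyQ : ∀ x, x ∉ C → y x ∈ annQ C (lev x) := fun x hx =>
    mem_annQ_of_near (hdpos x hx) rfl (hnear x hx)
  have hxy : ∀ x, x ∉ C → ‖x - y x‖ ≤ (κ (lev x)).L * b x := by
    intro x hx
    have h1 := hqW x hx
    have h2 := (abs_le.1 ((hκ (lev x)).lipW x (hxQ x hx) _ (hyQ x hx))).2
    rcases eq_or_lt_of_le (norm_nonneg (x - y x)) with h0 | h0
    · rw [← h0]; exact (mul_pos (hκ _).hL (hb0 x)).le
    · rw [inv_mul_le_iff₀ (hb0 x)] at h1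
      have h3 : ‖x - y x‖ * ‖x - y x‖ ≤ ((κ (lev x)).L * b x) * ‖x - y x‖ := by
        have := mul_le_mul_of_nonneg_left h2 (hb0 x).le
        nlinarith
      exact le_of_mul_le_mul_right h3 h0
  have hKsel : ∀ x, ∃ u, x ∉ C → u ∈ U ∧ ‖u‖ ≤ (κ (lev x)).N ∧
      ⟪(2 * (b x)⁻¹) • (x - y x), f (y x) u⟫ + p0 * l (y x) u ≤ - ((κ (lev x)).c / 2) := by
    intro x
    by_cases hx : x ∈ C
    · exact ⟨0, fun h => absurd hx h⟩
    · have hp := prox_of_min hC (hQC _ (hyQ x hx)) (inv_pos.2 (hb0 x)) (hy x hx).2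
      obtain ⟨u, hu⟩ := (hκ (lev x)).ctrl (y x) (hyQ x hx) _ hp (by
        have hbi := inv_pos.2 (hb0 x)
        rw [norm_smul, Real.norm_of_nonneg (by positivity)]
        have := mul_le_mul_of_nonneg_left (hxy x hx) hbi.le
        have e1 : (b x)⁻¹ * ((κ (lev x)).L * b x) = (κ (lev x)).L := by
          have := (hb0 x).ne'
          field_simp
        nlinarith)
      exact ⟨u, fun _ => hu⟩
  choose K hK using hKsel
  have hclev : ∀ s R : ℝ, 0 < s → ∃ N : ℕ, ∀ x, s ≤ dC C x → dC C x ≤ R → lev x ≤ N := by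
    intro s R hs
    refine ⟨⌊R + s⁻¹⌋₊, fun x h1 h2 => Nat.floor_mono ?_⟩
    have := inv_anti₀ hs h1
    unfold gauge1
    linarith
  refine ⟨K, fun x => W (y x) + (b x)⁻¹ * ‖x - y x‖ ^ 2, fun x => (κ (lev x)).c / 8,
    fun x => δ (lev x), fun x => M (lev x), ⟨fun x hx => (hK x hx).1, ?_⟩, ?_, ?_, ?_⟩
  · intro x hx
    have hcg : ContinuousAt (gauge1 C) x :=
      (dC_cont C).continuousAt.add ((dC_cont C).continuousAt.inv₀ (hdpos x hx).ne')
    refine ⟨{w | gauge1 C w < gauge1 C x + 1},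
      hcg.eventually (gt_mem_nhds (by linarith : gauge1 C x < gauge1 C x + 1)), ?_⟩
    rw [isBounded_iff_forall_norm_le]
    refine ⟨∑ j ∈ Finset.range (⌊gauge1 C x + 1⌋₊ + 1), |(κ j).N|, ?_⟩
    rintro _ ⟨w, ⟨hw1, hw2⟩, rfl⟩
    refine (hK w hw2).2.1.trans ((le_abs_self _).trans ?_)
    refine Finset.single_le_sum (f := fun j => |(κ j).N|) (fun j _ => abs_nonneg _) ?_
    rw [Finset.mem_range, Nat.lt_succ_iff]
    exact Nat.floor_mono (le_of_lt hw1)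
  · intro x hx
    have h1 := hqW x hx
    refine ⟨by linarith, ?_⟩
    have h2 := (abs_le.1 ((hκ (lev x)).lipW x (hxQ x hx) _ (hyQ x hx))).2
    have hL := (hκ (lev x)).hL
    have h3 := mul_le_mul_of_nonneg_left (hxy x hx) hL.le
    have h4 := mul_le_mul_of_nonneg_right (hbe x hx) (sq_nonneg (κ (lev x)).L)
    have h5 := he2 (lev x)
    have h6 := ((hκ (lev x)).bdW x (hxQ x hx)).1
    have h7 : 0 ≤ (b x)⁻¹ * ‖x - y x‖ ^ 2 := by
      have := hb0 x; positivity
    nlinarith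
  · intro s R hs
    obtain ⟨N, hN⟩ := hclev s R hs
    obtain ⟨c1, hc1, hc1'⟩ := exists_pos_le_of_le (fun k => (κ k).c / 8)
      (fun k => by have := (hκ k).hc; positivity) N
    obtain ⟨c2, hc2, hc2'⟩ := exists_pos_le_of_le δ hδ0 N
    exact ⟨min c1 c2, lt_min hc1 hc2, fun x h1 h2 =>
      ⟨(min_le_left _ _).trans (hc1' _ (hN x h1 h2)),
       (min_le_right _ _).trans (hc2' _ (hN x h1 h2))⟩⟩
  · intro x hx
    have hlb := level_bounds (hdpos x hx) (k := lev x) rfl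
    have hk2 : 1 / (2 * ((lev x:ℝ) + 1)) = (1 / ((lev x:ℝ) + 1)) / 2 := by field_simp
    have hMδ : M (lev x) * δ (lev x) ≤ dC C x / 2 := by
      have := hδ2 (lev x)
      rw [mul_comm]; linarith [hlb.2.2.1]
    have i1 := (hκ (lev x)).hL; have i4 := (hκ (lev x)).hc; have i8 := hΘ0 (lev x + 2)
    have i9 := he0 (lev x); have i5 := hS0 (lev x); have i6 := hM0 (lev x)
    have i7 := hG0 (lev x); have ib := hb0 x; have ibl := hblow x hx; have ibe := hbe x hx
    refine ⟨i6, by positivity, hMδ, ?_, ?_⟩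
    · intro w hw
      have := (hκ (lev x)).bdf w (mem_annQ_of_near (hdpos x hx) rfl hw) (K x) (hK x hx).1
      show _ < (κ (lev x)).Mf + 1
      linarith
    · intro h t0 X hh hhδ hX0 hXc hXd hXM
      have ht : t0 ≤ t0 + h := by linarith
      have hMh : M (lev x) * h ≤ δ (lev x) * M (lev x) := by
        rw [mul_comm]; exact mul_le_mul_of_nonneg_right hhδ i6.le
      have hXn : ∀ τ ∈ Set.Icc t0 (t0 + h), ‖X τ - x‖ ≤ dC C x / 2 := by
        intro τ hτ
        refine (hXM τ hτ).trans (le_trans ?_ hMδ)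
        exact mul_le_mul_of_nonneg_left (by linarith [hτ.2]) i6.le
      have hXQ : ∀ τ ∈ Set.Icc t0 (t0 + h), X τ ∈ annQ C (lev x) := fun τ hτ =>
        mem_annQ_of_near (hdpos x hx) rfl (hXn τ hτ)
      set x' := X (t0 + h) with hx'
      have hx'Q : x' ∈ annQ C (lev x) := hXQ _ ⟨ht, le_rfl⟩
      have hx'C : x' ∉ C := hQC _ hx'Q
      have hdx' : ‖x - x'‖ ≤ M (lev x) * h := by
        have := hXM (t0 + h) ⟨ht, le_rfl⟩
        rw [norm_sub_rev]
        simpa using this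
      have hgl := gauge_lip (hxQ x hx) hx'Q
      have hgl2 : |gauge1 C x - gauge1 C x'| ≤ G (lev x) * (M (lev x) * h) :=
        hgl.trans (mul_le_mul_of_nonneg_left hdx' i7.le)
      have hGMh : G (lev x) * (M (lev x) * h) ≤ δ (lev x) * (G (lev x) * M (lev x)) := by
        have := mul_le_mul_of_nonneg_left hMh i7.le
        linarith
      have hg' : (lev x:ℝ) ≤ gauge1 C x' + 1 := by
        have := (abs_le.1 hgl2).2
        linarith [hlb.1, hδ3 (lev x)]
      have hbb : |b x - b x'| ≤ e (lev x) * (G (lev x) * (M (lev x) * h)) := by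
        have := (hΘe (lev x) (gauge1 C x + 1) (gauge1 C x' + 1) (by linarith [hlb.1]) hg').2
        refine this.trans (mul_le_mul_of_nonneg_left ?_ i9.le)
        rwa [add_sub_add_right_eq_sub]
      refine step_est (b := b x) (b' := b x') (L := (κ (lev x)).L) (Lf := (κ (lev x)).Lf)
        (Ll := (κ (lev x)).Ll) (U := U) (W := W) (Q := annQ C (lev x)) (y := y x)
        (f := f) (M := M (lev x)) (c := (κ (lev x)).c)
        (V := fun x => W (y x) + (b x)⁻¹ * ‖x - y x‖ ^ 2)
        hp0 i1 (hκ _).hLf (hκ _).hLl i6 ib ?_ hh (hK x hx).1 rfl ?_ (hxy x hx) (hK x hx).2.2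
        (hyQ x hx) hXQ (hκ _).lip ?_ hX0 hXc hXd hXM ?_ ?_ ?_ ?_ ?_
      · have h1 := (abs_le.1 hbb).2
        have h2 := mul_le_mul_of_nonneg_left hGMh i9.le
        have h3 := hδ4 (lev x)
        nlinarith
      · exact (hy x' hx'C).2 (y x) (hy x hx).1
      · have hl := hH1.2.2.2.2.2.1
        exact hl.comp (f := fun τ => (X τ, K x)) (hXc.prodMk continuousOn_const)
          (fun τ hτ => ⟨subset_closure (hQC _ (hXQ τ hτ)), (hK x hx).1⟩)
      · have := mul_le_mul_of_nonneg_left ibl i1.le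
        linarith [hδ1 (lev x)]
      · have h1 := mul_le_mul_of_nonneg_left hbb (by positivity : 0 ≤ 8 * (κ (lev x)).L ^ 2)
        have h2 := mul_le_mul_of_nonneg_right (he4 (lev x)) hh.le
        nlinarith
      · have h1 := mul_le_mul_of_nonneg_right ibe (mul_pos i5 i1).le
        have h2 := he3 (lev x)
        show S (lev x) * _ ≤ _
        nlinarith
      · have h1 : (b x)⁻¹ ≤ (Θ (lev x + 2))⁻¹ := inv_anti₀ i8 ibl
        have h2 := hδ5 (lev x)
        calc (b x)⁻¹ * M (lev x) ^ 2 * h ≤ (Θ (lev x + 2))⁻¹ * M (lev x) ^ 2 * δ (lev x) := by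
              gcongr
          _ ≤ _ := by linarith
      · have h1 := mul_le_mul_of_nonneg_left hMh i5.le
        have h2 := hδ6 (lev x)
        show S (lev x) * _ ≤ _
        linarith
end stat

section traj
variable {n m : ℕ} {C : Set (Euc n)} {U : Set (Euc m)} {f : Euc n → Euc m → Euc n}
  {l : Euc n → Euc m → ℝ} {p0 : ℝ} {W : Euc n → ℝ} {K : Euc n → Euc m}
  {π : TimePartition} {z : Euc n} {x : ℝ → Euc n} {u : ℝ → Euc m} {T : ℝ≥0∞}

lemma samp_const (h : IsSamplingSol C U f K π z x u T) {t : ℝ} (ht : 0 ≤ t) (hx : x t ∈ C) :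
    ∀ s, t ≤ s → x s ∈ C := by
  intro s hs
  have hT : T ≤ ENNReal.ofReal t := by
    by_contra hc
    exact h.outside t ht (not_le.1 hc) hx
  have hTf : T ≠ ⊤ := ne_top_of_le_ne_top ENNReal.ofReal_ne_top hT
  have h1 := h.exit T.toReal ENNReal.toReal_nonneg (ENNReal.ofReal_toReal hTf).symm
  have h2 : T.toReal ≤ t := by
    have := ENNReal.toReal_mono ENNReal.ofReal_ne_top hT
    rwa [ENNReal.toReal_ofReal ht] at this
  rw [h1.2 s (h2.trans hs), ← h1.2 t h2]
  exact hx

lemma samp_lt (h : IsSamplingSol C U f K π z x u T) (hC : IsClosed C) (hne : C.Nonempty)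
    {t : ℝ} (ht : 0 ≤ t) (hx : x t ∉ C) : ENNReal.ofReal t < T := by
  by_contra hc
  have hT : T ≤ ENNReal.ofReal t := not_lt.1 hc
  have hTf : T ≠ ⊤ := ne_top_of_le_ne_top ENNReal.ofReal_ne_top hT
  have h1 := h.exit T.toReal ENNReal.toReal_nonneg (ENNReal.ofReal_toReal hTf).symm
  have h2 : T.toReal ≤ t := by
    have := ENNReal.toReal_mono ENNReal.ofReal_ne_top hT
    rwa [ENNReal.toReal_ofReal ht] at this
  have h3 := (dC_pos_iff hC hne (x t)).2 hx
  rw [h1.2 t h2, h1.1] at h3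
  exact lt_irrefl _ h3

lemma samp_prior (h : IsSamplingSol C U f K π z x u T)
    {s t : ℝ} (hs : 0 ≤ s) (hst : s ≤ t) (hx : x t ∉ C) : x s ∉ C :=
  fun hc => hx (samp_const h hs hc t hst)

lemma part_nonneg (π : TimePartition) (j : ℕ) : 0 ≤ π.t j := by
  rw [← π.zero]; exact π.mono.monotone (Nat.zero_le j)

lemma part_locate (π : TimePartition) {t : ℝ} (ht : 0 ≤ t) :
    ∃ j, π.t j ≤ t ∧ t < π.t (j + 1) := by
  have hex : ∃ k, t < π.t k := (π.unbounded.eventually_gt_atTop t).exists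
  classical
  have h1 := Nat.find_spec hex
  have h0 : Nat.find hex ≠ 0 := by
    intro h; rw [h, π.zero] at h1; linarith
  obtain ⟨j, hj⟩ := Nat.exists_eq_succ_of_ne_zero h0
  refine ⟨j, not_lt.1 (Nat.find_min hex (by omega)), ?_⟩
  rw [hj] at h1; exact h1

lemma part_ne (π : TimePartition) {j : ℕ} {t : ℝ} (h1 : π.t j < t) (h2 : t < π.t (j + 1)) :
    ∀ i, t ≠ π.t i := by
  intro i hi
  rw [hi] at h1 h2
  have a := π.mono.lt_iff_lt.1 h1
  have b := π.mono.lt_iff_lt.1 h2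
  omega

/-- Displacement estimate for a differential equation. -/
lemma disp_basic {F : Euc n → Euc n} {S : Set (Euc n)} {X : ℝ → Euc n} {a b M ρ : ℝ}
    (hab : a < b) (hM : 0 < M) (hX : ContinuousOn X (Set.Icc a b))
    (hd : ∀ s ∈ Set.Ioo a b, HasDerivAt X (F (X s)) s)
    (hS : ∀ s ∈ Set.Ico a b, X s ∈ S) (hF : ContinuousWithinAt F S (X a))
    (hb : ∀ w ∈ S, ‖w - X a‖ ≤ ρ → ‖F w‖ < M) (hρ : M * (b - a) ≤ ρ) :
    ∀ τ ∈ Set.Icc a b, ‖X τ - X a‖ ≤ M * (τ - a) := by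
  have hXa : ContinuousWithinAt X (Set.Ioo a b) a :=
    (hX a ⟨le_rfl, hab.le⟩).mono Set.Ioo_subset_Icc_self
  have hmem : Set.Ioo a b ∈ 𝓝[>] a := Ioo_mem_nhdsGT hab
  have hXa2 : Tendsto X (𝓝[>] a) (𝓝 (X a)) := by
    have := hXa.tendsto
    rwa [nhdsWithin_Ioo_eq_nhdsGT hab] at this
  have hder0 : HasDerivWithinAt X (F (X a)) (Set.Ici a) a := by
    apply hasDerivWithinAt_Ici_of_tendsto_deriv (s := Set.Ioo a b)
    · intro s hs; exact (hd s hs).differentiableAt.differentiableWithinAt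
    · exact hXa
    · exact hmem
    · have h1 : Tendsto (fun s => F (X s)) (𝓝[>] a) (𝓝 (F (X a))) := by
        apply hF.tendsto.comp
        apply tendsto_nhdsWithin_of_tendsto_nhds_of_eventually_within _ hXa2
        filter_upwards [hmem] with s hs using hS s ⟨hs.1.le, hs.2⟩
      apply h1.congr'
      filter_upwards [hmem] with s hs using (hd s hs).deriv.symm
  have hder : ∀ s ∈ Set.Ico a b, HasDerivWithinAt (fun s => X s - X a) (F (X s)) (Set.Ici s) s := by
    intro s hs
    rcases eq_or_lt_of_le hs.1 with h | h
    · subst h; exact hder0.sub_const _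
    · exact ((hd s ⟨h, hs.2⟩).hasDerivWithinAt).sub_const _
  intro τ hτ
  refine image_norm_le_of_norm_deriv_right_lt_deriv_boundary' (f := fun s => X s - X a)
    (f' := fun s => F (X s)) (a := a) (b := b) (B := fun s => M * (s - a)) (B' := fun _ => M)
    (hX.sub continuousOn_const) hder ?_ ?_ ?_ ?_ hτ
  · simp
  · fun_prop
  · intro s hs
    have : HasDerivAt (fun s => M * (s - a)) (M * 1) s :=
      ((hasDerivAt_id s).sub_const a).const_mul M
    rw [mul_one] at this
    exact this.hasDerivWithinAt
  · intro s hs heq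
    apply hb _ (hS s hs)
    have h1 : ‖X s - X a‖ = M * (s - a) := heq
    rw [h1]
    have : M * (s - a) ≤ M * (b - a) := by
      apply mul_le_mul_of_nonneg_left _ hM.le; linarith [hs.2]
    linarith

/-- Displacement estimate for sampling trajectories on one sampling interval. -/
lemma samp_disp (h : IsSamplingSol C U f K π z x u T) (hC : IsClosed C) (hne : C.Nonempty)
    (hH1 : HypH1 C U f l) (hK : IsFeedback C U K) {j : ℕ} (hx0 : x (π.t j) ∉ C)
    {M ρ : ℝ} (hM : 0 < M)
    (hb : ∀ w ∈ closure Cᶜ, ‖w - x (π.t j)‖ ≤ ρ → ‖f w (K (x (π.t j)))‖ < M)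
    (hρ : M * (π.t (j + 1) - π.t j) ≤ ρ) :
    ∀ τ ∈ Set.Icc (π.t j) (π.t (j + 1)), ‖x τ - x (π.t j)‖ ≤ M * (τ - π.t j) := by
  have hj0 := part_nonneg π j
  have hKU := hK.1 _ hx0
  have key : ∀ τ ∈ Set.Icc (π.t j) (π.t (j + 1)), (∀ s ∈ Set.Ico (π.t j) τ, x s ∉ C) →
      ‖x τ - x (π.t j)‖ ≤ M * (τ - π.t j) := by
    intro τ hτ hout
    rcases eq_or_lt_of_le hτ.1 with he | hlt
    · rw [← he]; simp
    · apply disp_basic (F := fun w => f w (K (x (π.t j)))) (S := closure Cᶜ) (ρ := ρ) hlt hM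
      · exact h.cont.mono (fun s hs => hj0.trans hs.1)
      · intro s hs
        have h1 := hout s ⟨hs.1.le, hs.2⟩
        have h2 := h.deriv s (hj0.trans_lt hs.1) (samp_lt h hC hne (hj0.trans hs.1.le) h1)
          (part_ne π hs.1 (hs.2.trans_le hτ.2))
        rwa [h.ctrl j s ⟨hs.1.le, hs.2.trans_le hτ.2⟩] at h2
      · intro s hs; exact subset_closure (hout s hs)
      · have h1 := hH1.2.2.2.2.1 (x (π.t j), K (x (π.t j))) ⟨subset_closure hx0, hKU⟩
        have h2 : ContinuousWithinAt (fun w : Euc n => (w, K (x (π.t j)))) (closure Cᶜ)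
            (x (π.t j)) := by
          apply Continuous.continuousWithinAt; fun_prop
        exact ContinuousWithinAt.comp (f := fun w : Euc n => (w, K (x (π.t j)))) (t := closure Cᶜ ×ˢ U)
          (g := fun q : Euc n × Euc m => f q.1 q.2) h1 h2
          (fun w hw => ⟨hw, hKU⟩)
      · exact hb
      · refine le_trans ?_ hρ
        apply mul_le_mul_of_nonneg_left _ hM.le; linarith [hτ.2]
      · exact ⟨hlt.le, le_rfl⟩
  intro τ hτ
  by_cases hTτ : ENNReal.ofReal τ ≤ T
  · apply key τ hτ
    intro s hs
    apply h.outside s (hj0.trans hs.1)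
    refine lt_of_lt_of_le ?_ hTτ
    exact (ENNReal.ofReal_lt_ofReal_iff (by linarith [hs.1, hs.2])).2 hs.2
  · have hT : T ≤ ENNReal.ofReal τ := (not_le.1 hTτ).le
    have hTf : T ≠ ⊤ := ne_top_of_le_ne_top ENNReal.ofReal_ne_top hT
    have hTe := (ENNReal.ofReal_toReal hTf).symm
    have h1 := h.exit T.toReal ENNReal.toReal_nonneg hTe
    have h2 : T.toReal ≤ τ := by
      have := ENNReal.toReal_mono ENNReal.ofReal_ne_top hT
      rwa [ENNReal.toReal_ofReal (hj0.trans hτ.1)] at this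
    have h3 : π.t j ≤ T.toReal := by
      have := samp_lt h hC hne hj0 hx0
      rw [hTe] at this
      exact ((ENNReal.ofReal_lt_ofReal_iff_of_nonneg hj0).1 this).le
    rw [h1.2 τ h2]
    refine (key T.toReal ⟨h3, h2.trans hτ.2⟩ ?_).trans ?_
    · intro s hs
      apply h.outside s (hj0.trans hs.1)
      rw [hTe]
      exact (ENNReal.ofReal_lt_ofReal_iff_of_nonneg (hj0.trans hs.1)).2 hs.2
    · apply mul_le_mul_of_nonneg_left _ hM.le; linarith

/-- The data produced by the static construction. -/
structure FBData (C : Set (Euc n)) (U : Set (Euc m)) (f : Euc n → Euc m → Euc n)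
    (l : Euc n → Euc m → ℝ) (p0 : ℝ) (W : Euc n → ℝ) (K : Euc n → Euc m)
    (V cr δf Mx : Euc n → ℝ) : Prop where
  fb : IsFeedback C U K
  VW : ∀ x, x ∉ C → V x ≤ W x ∧ W x ≤ 2 * V x
  ann : ∀ s R : ℝ, 0 < s → ∃ c0 > 0, ∀ x, s ≤ dC C x → dC C x ≤ R → c0 ≤ cr x ∧ c0 ≤ δf x
  main : ∀ x, x ∉ C → 0 < Mx x ∧ 0 < cr x ∧ Mx x * δf x ≤ dC C x / 2 ∧
        (∀ w, ‖w - x‖ ≤ dC C x / 2 → ‖f w (K x)‖ < Mx x) ∧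
        ∀ (h t0 : ℝ) (X : ℝ → Euc n), 0 < h → h ≤ δf x → X t0 = x →
          ContinuousOn X (Set.Icc t0 (t0 + h)) →
          (∀ τ ∈ Set.Ioo t0 (t0 + h), HasDerivAt X (f (X τ) (K x)) τ) →
          (∀ τ ∈ Set.Icc t0 (t0 + h), ‖X τ - x‖ ≤ Mx x * (τ - t0)) →
          V (X (t0 + h)) + p0 * (∫ τ in t0..(t0 + h), l (X τ) (K x)) + cr x * h ≤ V x

variable {V cr δf Mx : Euc n → ℝ}

/-- One descent step. -/
lemma samp_step (D : FBData C U f l p0 W K V cr δf Mx)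
    (h : IsSamplingSol C U f K π z x u T) (hC : IsClosed C) (hne : C.Nonempty)
    (hH1 : HypH1 C U f l) {j : ℕ} (hx0 : x (π.t j) ∉ C)
    (hδ : π.t (j + 1) - π.t j ≤ δf (x (π.t j))) {t : ℝ} (h1 : π.t j < t) (h2 : t ≤ π.t (j + 1)) :
    x t ∉ C ∧ IntervalIntegrable (fun τ => l (x τ) (u τ)) volume (π.t j) t ∧
      0 ≤ (∫ τ in (π.t j)..t, l (x τ) (u τ)) ∧
      V (x t) + p0 * (∫ τ in (π.t j)..t, l (x τ) (u τ)) + cr (x (π.t j)) * (t - π.t j)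
        ≤ V (x (π.t j)) := by
  obtain ⟨hM, hcr, hMδ, hfM, hdesc⟩ := D.main _ hx0
  have hj0 := part_nonneg π j
  have hKU := D.fb.1 _ hx0
  have hd0 := (dC_pos_iff hC hne _).2 hx0
  have hρ : Mx (x (π.t j)) * (π.t (j + 1) - π.t j) ≤ dC C (x (π.t j)) / 2 :=
    (mul_le_mul_of_nonneg_left hδ hM.le).trans hMδ
  have hdisp := samp_disp h hC hne hH1 D.fb hx0 hM (fun w _ hw => hfM w hw) hρ
  have hout : ∀ τ ∈ Set.Icc (π.t j) (π.t (j + 1)), x τ ∉ C := by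
    intro τ hτ
    rw [← dC_pos_iff hC hne]
    have a1 := hdisp τ hτ
    have a2 : Mx (x (π.t j)) * (τ - π.t j) ≤ dC C (x (π.t j)) / 2 := by
      refine le_trans ?_ hρ
      apply mul_le_mul_of_nonneg_left _ hM.le; linarith [hτ.2]
    have a3 := dC_le_add C (x (π.t j)) (x τ)
    rw [norm_sub_rev] at a3
    linarith
  have hcontl : ContinuousOn (fun τ => l (x τ) (K (x (π.t j)))) (Set.Icc (π.t j) (π.t (j + 1))) := by
    have c1 : ContinuousOn (fun τ => (x τ, K (x (π.t j)))) (Set.Icc (π.t j) (π.t (j + 1))) :=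
      (h.cont.mono (fun s hs => hj0.trans hs.1)).prodMk continuousOn_const
    exact ContinuousOn.comp (g := fun q : Euc n × Euc m => l q.1 q.2) hH1.2.2.2.2.2.1 c1
      (fun s hs => ⟨subset_closure (hout s hs), hKU⟩)
  have hii : IntervalIntegrable (fun τ => l (x τ) (K (x (π.t j)))) volume (π.t j) t := by
    apply ContinuousOn.intervalIntegrable
    rw [Set.uIcc_of_le h1.le]
    exact hcontl.mono (Set.Icc_subset_Icc_right h2)
  have hae : ∀ᵐ τ ∂volume, τ ∈ Set.uIoc (π.t j) t →
      l (x τ) (K (x (π.t j))) = l (x τ) (u τ) := by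
    have : ∀ᵐ τ ∂(volume : Measure ℝ), τ ≠ t := by
      simp [ae_iff]
    filter_upwards [this] with τ hτ hm
    rw [Set.uIoc_of_le h1.le] at hm
    rw [h.ctrl j τ ⟨hm.1.le, lt_of_lt_of_le (lt_of_le_of_ne hm.2 hτ) h2⟩]
  have hinteg := intervalIntegral.integral_congr_ae hae
  have hii2 : IntervalIntegrable (fun τ => l (x τ) (u τ)) volume (π.t j) t := by
    apply hii.congr_ae
    exact (ae_restrict_iff' measurableSet_uIoc).2 hae
  have hnn : 0 ≤ ∫ τ in (π.t j)..t, l (x τ) (K (x (π.t j))) :=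
    intervalIntegral.integral_nonneg h1.le (fun τ _ => hH1.2.2.2.1 _ _ hKU)
  refine ⟨hout t ⟨h1.le, h2⟩, hii2, by rw [← hinteg]; exact hnn, ?_⟩
  rw [← hinteg]
  have hs : π.t j + (t - π.t j) = t := by ring
  have := hdesc (t - π.t j) (π.t j) x (by linarith) (by linarith) rfl
    (h.cont.mono (fun s hs => hj0.trans hs.1)) (by
      rw [hs]
      intro s hs'
      have h3 := h.deriv s (hj0.trans_lt hs'.1)
        (samp_lt h hC hne (hj0.trans hs'.1.le) (hout s ⟨hs'.1.le, hs'.2.le.trans h2⟩))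
          (part_ne π hs'.1 (hs'.2.trans_le h2))
      rwa [h.ctrl j s ⟨hs'.1.le, hs'.2.trans_le h2⟩] at h3) (by
      rw [hs]
      intro τ hτ
      exact hdisp τ ⟨hτ.1, hτ.2.trans h2⟩)
  rwa [hs] at this

end traj

section traj2
variable {n m : ℕ} {C : Set (Euc n)} {U : Set (Euc m)} {f : Euc n → Euc m → Euc n}
  {l : Euc n → Euc m → ℝ} {p0 : ℝ} {W : Euc n → ℝ} {K : Euc n → Euc m}
  {π : TimePartition} {z : Euc n} {x : ℝ → Euc n} {u : ℝ → Euc m} {T : ℝ≥0∞}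
  {V cr δf Mx : Euc n → ℝ}

/-- Good phase: the descent estimate holds up to time `t`. -/
structure GoodAt (C : Set (Euc n)) (l : Euc n → Euc m → ℝ) (p0 : ℝ) (V cr : Euc n → ℝ)
    (z : Euc n) (x : ℝ → Euc n) (u : ℝ → Euc m) (t : ℝ) : Prop where
  out : x t ∉ C
  int : IntervalIntegrable (fun τ => l (x τ) (u τ)) volume 0 t
  nn : 0 ≤ ∫ τ in (0:ℝ)..t, l (x τ) (u τ)
  le : V (x t) ≤ V z
  desc : ∀ c0 : ℝ, 0 ≤ c0 → (∀ w, w ∉ C → V (x t) ≤ V w → V w ≤ V z → c0 ≤ cr w) →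
    V (x t) + p0 * (∫ τ in (0:ℝ)..t, l (x τ) (u τ)) + c0 * t ≤ V z

lemma good_step (D : FBData C U f l p0 W K V cr δf Mx)
    (h : IsSamplingSol C U f K π z x u T) (hC : IsClosed C) (hne : C.Nonempty)
    (hH1 : HypH1 C U f l) (hp0 : 0 < p0) {j : ℕ} (hx0 : x (π.t j) ∉ C)
    (hδ : π.t (j + 1) - π.t j ≤ δf (x (π.t j)))
    (hg : GoodAt C l p0 V cr z x u (π.t j)) {t : ℝ} (h1 : π.t j ≤ t) (h2 : t ≤ π.t (j + 1)) :
    GoodAt C l p0 V cr z x u t := by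
  rcases eq_or_lt_of_le h1 with he | h1
  · rw [← he]; exact hg
  obtain ⟨a1, a2, a3, a4⟩ := samp_step D h hC hne hH1 hx0 hδ h1 h2
  have hcr := (D.main _ hx0).2.1
  have hsplit := intervalIntegral.integral_add_adjacent_intervals hg.int a2
  have b1 : 0 ≤ p0 * (∫ τ in (π.t j)..t, l (x τ) (u τ)) := mul_nonneg hp0.le a3
  have b2 : 0 ≤ cr (x (π.t j)) * (t - π.t j) := mul_nonneg hcr.le (by linarith)
  have b3 : V (x t) ≤ V (x (π.t j)) := by linarith
  refine ⟨a1, hg.int.trans a2, ?_, b3.trans hg.le, ?_⟩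
  · rw [← hsplit]; linarith [hg.nn]
  · intro c0 hc0 hw
    have c1 := hg.desc c0 hc0 (fun w hwC hw1 hw2 => hw w hwC (b3.trans hw1) hw2)
    have c2 := hw _ hx0 b3 hg.le
    have c3 : c0 * (t - π.t j) ≤ cr (x (π.t j)) * (t - π.t j) :=
      mul_le_mul_of_nonneg_right c2 (by linarith)
    rw [← hsplit]
    linarith

/-- Main trajectory lemma. -/
lemma samp_main (D : FBData C U f l p0 W K V cr δf Mx) (hH1 : HypH1 C U f l)
    (hne : C.Nonempty) (hp0 : 0 < p0)
    (hWc : ContinuousOn W (closure Cᶜ))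
    (hWpd : PosDefOn C W) (hWpr : ProperOn C W) {r : ℝ} (R : ℝ) (hr : 0 < r) :
    ∃ δ > 0, ∀ π : TimePartition, (∀ j, π.t (j + 1) - π.t j ≤ δ) → ∀ z, z ∉ C → dC C z ≤ R →
      ∀ x u T, IsSamplingSol C U f K π z x u T → ∀ t, 0 ≤ t →
        GoodAt C l p0 V cr z x u t ∨ ∀ τ, t ≤ τ → dC C (x τ) ≤ r := by
  have hC := hH1.1
  have hfr := hH1.2.1
  obtain ⟨Ω0, hΩ0, hΩ⟩ := cmp3 hC hne hfr hWc R
  obtain ⟨ω0, hω0, hω⟩ := cmp1 hC hne hWc hWpd hWpr hr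
  set Ω : ℝ := max Ω0 ω0 with hΩdef
  obtain ⟨Rs, hRs, hRs2⟩ := cmp4 hWpd hWpr (2 * Ω)
  obtain ⟨s0, hs0, hs⟩ := cmp2 hC hne hfr hWc hWpd (half_pos hω0)
  set s : ℝ := min (s0 / 2) (min (r / 2) (1 / 2)) with hsdef
  have hspos : 0 < s := by
    apply lt_min (by linarith) (lt_min (by linarith) (by norm_num))
  have hs1 : 2 * s ≤ s0 := by have := min_le_left (s0 / 2) (min (r / 2) (1 / 2)); linarith
  have hs2 : 2 * s ≤ r := by
    have := (min_le_right (s0 / 2) (min (r / 2) (1 / 2))).trans (min_le_left _ _); linarith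
  have hs3 : 2 * s ≤ 1 := by
    have := (min_le_right (s0 / 2) (min (r / 2) (1 / 2))).trans (min_le_right _ _); linarith
  obtain ⟨c0, hc0, hc⟩ := D.ann s Rs hspos
  obtain ⟨Mf, Ml, Lf, Ll, hMf, _, _, _, hbd, _⟩ :=
    hH1.2.2.2.2.2.2 _ (compact_near hC hne hfr 1) Set.inter_subset_left
  set M : ℝ := Mf + 1 with hMdef
  have hM : 0 < M := by linarith
  have hMs : 0 < s / M := div_pos hspos hM
  -- facts on V
  have f1 : ∀ w, w ∉ C → V w ≤ ω0 / 2 → dC C w ≤ r := fun w hw hv =>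
    hω w hw (by linarith [(D.VW w hw).2])
  have f2 : ∀ w, w ∉ C → dC C w ≤ 2 * s → V w ≤ ω0 / 2 := fun w hw hd =>
    (D.VW w hw).1.trans (hs w hw (hd.trans hs1))
  refine ⟨min c0 (s / M), lt_min hc0 hMs, ?_⟩
  intro π hπ z hz hzR x u T h
  have f3 : ∀ j w, w ∉ C → s ≤ dC C w → V w ≤ Ω → π.t (j + 1) - π.t j ≤ δf w := by
    intro j w hw hd hv
    refine (hπ j).trans ((min_le_left _ _).trans ?_)
    exact (hc w hd (hRs2 w hw (by linarith [(D.VW w hw).2]))).2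
  have f4 : ∀ j, M * (π.t (j + 1) - π.t j) ≤ s := by
    intro j
    have := (hπ j).trans (min_le_right _ _)
    calc M * (π.t (j + 1) - π.t j) ≤ M * (s / M) := mul_le_mul_of_nonneg_left this hM.le
      _ = s := by field_simp
  have hω0Ω : ω0 ≤ Ω := le_max_right _ _
  -- the trapped phase
  have small : ∀ j, x (π.t j) ∉ C → dC C (x (π.t j)) ≤ s →
      ∀ τ ∈ Set.Icc (π.t j) (π.t (j + 1)), dC C (x τ) ≤ 2 * s := by
    intro j hx0 hd τ hτ
    have hdisp := samp_disp h hC hne hH1 D.fb hx0 (ρ := s) hM (by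
      intro w hw hws
      have h1 : dC C w ≤ 1 := by
        have := dC_le_add C w (x (π.t j)); linarith
      have := (hbd w ⟨hw, h1⟩ _ (D.fb.1 _ hx0)).1
      linarith) (f4 j) τ hτ
    have h2 := dC_le_add C (x τ) (x (π.t j))
    have h3 : M * (τ - π.t j) ≤ M * (π.t (j + 1) - π.t j) :=
      mul_le_mul_of_nonneg_left (by linarith [hτ.2]) hM.le
    linarith [f4 j]
  have hC0 : ∀ w, w ∈ C → dC C w ≤ r := by
    intro w hw
    have : ¬ 0 < dC C w := fun hh => (dC_pos_iff hC hne w).1 hh hw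
    linarith
  have trapstep : ∀ j, (x (π.t j) ∈ C ∨ V (x (π.t j)) ≤ ω0 / 2) →
      (∀ τ ∈ Set.Icc (π.t j) (π.t (j + 1)), dC C (x τ) ≤ r) ∧
      (x (π.t (j + 1)) ∈ C ∨ V (x (π.t (j + 1))) ≤ ω0 / 2) := by
    intro j hj
    have hlt : π.t j < π.t (j + 1) := π.mono (Nat.lt_succ_self j)
    by_cases hx0 : x (π.t j) ∈ C
    · have := samp_const h (part_nonneg π j) hx0
      exact ⟨fun τ hτ => hC0 _ (this τ hτ.1), Or.inl (this _ hlt.le)⟩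
    · have hV : V (x (π.t j)) ≤ ω0 / 2 := hj.resolve_left hx0
      rcases le_total s (dC C (x (π.t j))) with hd | hd
      · have hδ := f3 j _ hx0 hd (by linarith)
        have key : ∀ τ, π.t j < τ → τ ≤ π.t (j + 1) → x τ ∉ C ∧ V (x τ) ≤ ω0 / 2 := by
          intro τ h1 h2
          obtain ⟨a1, a2, a3, a4⟩ := samp_step D h hC hne hH1 hx0 hδ h1 h2
          have b1 : 0 ≤ p0 * (∫ τ in (π.t j)..τ, l (x τ) (u τ)) := mul_nonneg hp0.le a3
          have b2 : 0 ≤ cr (x (π.t j)) * (τ - π.t j) :=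
            mul_nonneg (D.main _ hx0).2.1.le (by linarith)
          exact ⟨a1, by linarith⟩
        refine ⟨?_, Or.inr (key _ hlt le_rfl).2⟩
        intro τ hτ
        rcases eq_or_lt_of_le hτ.1 with he | h1
        · rw [← he]; exact f1 _ hx0 hV
        · have := key τ h1 hτ.2
          exact f1 _ this.1 this.2
      · have hsm := small j hx0 hd
        refine ⟨fun τ hτ => (hsm τ hτ).trans hs2, ?_⟩
        by_cases hx1 : x (π.t (j + 1)) ∈ C
        · exact Or.inl hx1
        · exact Or.inr (f2 _ hx1 (hsm _ ⟨hlt.le, le_rfl⟩))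
  have trap : ∀ j, (x (π.t j) ∈ C ∨ V (x (π.t j)) ≤ ω0 / 2) → ∀ i, j ≤ i →
      (x (π.t i) ∈ C ∨ V (x (π.t i)) ≤ ω0 / 2) := by
    intro j hj i hi
    induction i, hi using Nat.le_induction with
    | base => exact hj
    | succ i _ ih => exact (trapstep i ih).2
  -- the good phase
  have hVz : V z ≤ Ω := ((D.VW z hz).1.trans (hΩ z hz hzR)).trans (le_max_left _ _)
  have good : ∀ j, ¬ (x (π.t j) ∈ C ∨ V (x (π.t j)) ≤ ω0 / 2) →
      GoodAt C l p0 V cr z x u (π.t j) →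
      ∀ t, π.t j ≤ t → t ≤ π.t (j + 1) → GoodAt C l p0 V cr z x u t := by
    intro j hj hg t h1 h2
    have hd : s ≤ dC C (x (π.t j)) := by
      by_contra hc
      exact hj (Or.inr (f2 _ hg.out (by linarith)))
    exact good_step D h hC hne hH1 hp0 hg.out (f3 j _ hg.out hd (hg.le.trans hVz)) hg h1 h2
  have goodj : ∀ j, (∀ i, i < j → ¬ (x (π.t i) ∈ C ∨ V (x (π.t i)) ≤ ω0 / 2)) →
      GoodAt C l p0 V cr z x u (π.t j) := by
    intro j
    induction j with
    | zero =>
      intro _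
      rw [π.zero]
      refine ⟨by rw [h.init]; exact hz, by simp, by simp, by rw [h.init], ?_⟩
      intro c _ _
      simp [h.init]
    | succ j ih =>
      intro hj
      exact good j (hj j (Nat.lt_succ_self j)) (ih (fun i hi => hj i (by omega))) _
        (π.mono.monotone (Nat.le_succ j)) le_rfl
  intro t ht
  obtain ⟨j, hj1, hj2⟩ := part_locate π ht
  by_cases hP : x (π.t j) ∈ C ∨ V (x (π.t j)) ≤ ω0 / 2
  · right
    intro τ hτ
    obtain ⟨i, hi1, hi2⟩ := part_locate π (ht.trans hτ)
    have hji : j ≤ i := by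
      have : π.t j < π.t (i + 1) := by linarith
      have := π.mono.lt_iff_lt.1 this
      omega
    exact (trapstep i (trap j hP i hji)).1 τ ⟨hi1, hi2.le⟩
  · left
    refine good j hP (goodj j ?_) t hj1 hj2.le
    intro i hi hPi
    exact hP (trap i hPi j hi.le)

end traj2

section fin
variable {n m : ℕ} {C : Set (Euc n)} {U : Set (Euc m)} {f : Euc n → Euc m → Euc n}
  {l : Euc n → Euc m → ℝ} {p0 : ℝ} {W : Euc n → ℝ} {K : Euc n → Euc m}
  {π : TimePartition} {z : Euc n} {x : ℝ → Euc n} {u : ℝ → Euc m} {T : ℝ≥0∞}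
  {V cr δf Mx : Euc n → ℝ}

/-- Distances reachable in the good phase from `R` after time `t`. -/
def reachSet (C : Set (Euc n)) (V cr : Euc n → ℝ) (R t : ℝ) : Set ℝ :=
  {y | ∃ w z : Euc n, ∃ s : ℝ, w ∉ C ∧ z ∉ C ∧ dC C z ≤ R ∧ y = dC C w ∧ t ≤ s ∧ V w ≤ V z ∧
    ∀ c0 : ℝ, 0 ≤ c0 → (∀ w', w' ∉ C → V w ≤ V w' → V w' ≤ V z → c0 ≤ cr w') →
      V w + c0 * s ≤ V z}

lemma exists_beta (D : FBData C U f l p0 W K V cr δf Mx) (hH1 : HypH1 C U f l)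
    (hne : C.Nonempty) (hp0 : 0 < p0)
    (hWc : ContinuousOn W (closure Cᶜ))
    (hWpd : PosDefOn C W) (hWpr : ProperOn C W) :
    ∃ β, IsKL β ∧ ∀ (z : Euc n) (x : ℝ → Euc n) (u : ℝ → Euc m) (t R : ℝ), 0 ≤ t → z ∉ C →
      dC C z ≤ R → GoodAt C l p0 V cr z x u t → dC C (x t) ≤ β R t := by
  have hC := hH1.1
  have hfr := hH1.2.1
  have hnn : ∀ R t, ∀ y ∈ reachSet C V cr R t, 0 ≤ y := by
    rintro R t y ⟨w, z, s, -, -, -, rfl, -⟩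
    exact dC_nonneg C w
  have hbdd : ∀ R, ∃ B, ∀ t, ∀ y ∈ reachSet C V cr R t, y ≤ B := by
    intro R
    obtain ⟨Ω, hΩ0, hΩ⟩ := cmp3 hC hne hfr hWc R
    obtain ⟨B, hB0, hB⟩ := cmp4 hWpd hWpr (2 * Ω)
    refine ⟨B, ?_⟩
    rintro t y ⟨w, z, s, hw, hz, hzR, rfl, -, hV, -⟩
    apply hB w hw
    linarith [(D.VW w hw).2, (D.VW z hz).1, hΩ z hz hzR]
  have hba : ∀ R t, BddAbove (reachSet C V cr R t) := by
    intro R t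
    obtain ⟨B, hB⟩ := hbdd R
    exact ⟨B, fun y hy => hB t y hy⟩
  have hG0 : ∀ R t, 0 ≤ sSup (reachSet C V cr R t) := fun R t => Real.sSup_nonneg (hnn R t)
  have hsub : ∀ R R' t t', R ≤ R' → t' ≤ t →
      sSup (reachSet C V cr R t) ≤ sSup (reachSet C V cr R' t') := by
    intro R R' t t' hR ht
    apply Real.sSup_le _ (hG0 R' t')
    rintro y ⟨w, z, s, h1, h2, h3, h4, h5, h6⟩
    exact le_csSup (hba R' t') ⟨w, z, s, h1, h2, h3.trans hR, h4, ht.trans h5, h6⟩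
  obtain ⟨β, hβ, hGβ⟩ := exists_KL (fun R t => sSup (reachSet C V cr R t)) hG0
    (fun t _ R R' hR => hsub R R' t t hR le_rfl)
    (fun R t _ t' _ htt => hsub R R t' t le_rfl htt)
    (by
      intro R
      rw [Metric.tendsto_atTop]
      intro ε hε
      obtain ⟨ω, hω0, hω⟩ := cmp1 hC hne hWc hWpd hWpr (half_pos hε)
      obtain ⟨Ω, hΩ0, hΩ⟩ := cmp3 hC hne hfr hWc R
      obtain ⟨B, hB0, hB⟩ := cmp4 hWpd hWpr (2 * Ω)
      obtain ⟨s, hs0, hs⟩ := cmp2 hC hne hfr hWc hWpd (half_pos hω0)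
      obtain ⟨c0, hc0, hc⟩ := D.ann s B hs0
      refine ⟨Ω / c0, fun t ht => ?_⟩
      rw [Real.dist_eq, sub_zero, abs_of_nonneg (hG0 R t)]
      refine lt_of_le_of_lt (Real.sSup_le ?_ (half_pos hε).le) (half_lt_self hε)
      rintro y ⟨w, z, σ, hw, hz, hzR, rfl, hσ, hV, hdesc⟩
      have hz1 := (D.VW z hz).1.trans (hΩ z hz hzR)
      have hVw : V w ≤ ω / 2 := by
        by_contra hcon
        push Not at hcon
        have h1 := hdesc c0 hc0.le (by
          intro w' hw' h1 h2
          have a1 : s ≤ dC C w' := by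
            by_contra h3
            have := hs w' hw' (not_le.1 h3).le
            linarith [(D.VW w' hw').1]
          have a2 : dC C w' ≤ B := hB w' hw' (by linarith [(D.VW w' hw').2])
          exact (hc w' a1 a2).1)
        have h2 : Ω / c0 * c0 ≤ σ * c0 := mul_le_mul_of_nonneg_right (ht.trans hσ) hc0.le
        rw [div_mul_cancel₀ _ hc0.ne'] at h2
        linarith
      exact hω w hw (by linarith [(D.VW w hw).2]))
    (by
      intro ε hε
      obtain ⟨ω, hω0, hω⟩ := cmp1 hC hne hWc hWpd hWpr hε
      obtain ⟨s, hs0, hs⟩ := cmp2 hC hne hfr hWc hWpd (half_pos hω0)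
      refine ⟨s, hs0, Real.sSup_le ?_ hε.le⟩
      rintro y ⟨w, z, σ, hw, hz, hzR, rfl, hσ, hV, hdesc⟩
      apply hω w hw
      linarith [(D.VW w hw).2, (D.VW z hz).1, hs z hz hzR])
  refine ⟨β, hβ, ?_⟩
  intro z x u t R ht hz hzR hg
  refine le_trans ?_ (hGβ R t ((dC_nonneg C z).trans hzR) ht)
  apply le_csSup (hba R t)
  refine ⟨x t, z, t, hg.out, hz, hzR, rfl, le_rfl, hg.le, ?_⟩
  intro c0 hc0 hw
  have h1 := hg.desc c0 hc0 hw
  have h2 := mul_nonneg hp0.le hg.nn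
  linarith

lemma good_cost (D : FBData C U f l p0 W K V cr δf Mx) (hp0 : 0 < p0)
    (hWpd : PosDefOn C W) {t : ℝ} (hz : z ∉ C) (hg : GoodAt C l p0 V cr z x u t) :
    (∫ τ in (0:ℝ)..t, l (x τ) (u τ)) ≤ W z / (p0 / 2) := by
  have h1 := hg.desc 0 le_rfl (fun w hw _ _ => (D.main w hw).2.1.le)
  have h2 := hWpd.1 _ hg.out
  have h3 := (D.VW _ hg.out).2
  have h4 := (D.VW _ hz).1
  have h5 := hWpd.1 _ hz
  rw [le_div_iff₀ (by linarith)]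
  nlinarith [hg.nn]

lemma sample_stab (D : FBData C U f l p0 W K V cr δf Mx) (hH1 : HypH1 C U f l)
    (hne : C.Nonempty) (hp0 : 0 < p0)
    (hWc : ContinuousOn W (closure Cᶜ))
    (hWpd : PosDefOn C W) (hWpr : ProperOn C W) :
    SampleStabOn C U f l K Cᶜ (p0 / 2) W := by
  obtain ⟨β, hβ, hgood⟩ := exists_beta D hH1 hne hp0 hWc hWpd hWpr
  refine ⟨β, hβ, ?_⟩
  intro r R hr _
  obtain ⟨δ, hδ, hmain⟩ := samp_main D hH1 hne hp0 hWc hWpd hWpr R hr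
  refine ⟨δ, hδ, ?_⟩
  intro π hπ z hz hzR x u T h
  have hm := hmain π hπ z hz hzR x u T h
  refine ⟨?_, ?_⟩
  · intro t ht
    rcases hm t ht with hg | hb
    · exact (hgood z x u t R ht hz hzR hg).trans (le_max_left _ _)
    · exact (hb t le_rfl).trans (le_max_right _ _)
  · have hWz : 0 ≤ W z / (p0 / 2) := div_nonneg (hWpd.1 z hz).le (by linarith)
    have hTb0 : 0 ≤ Tbar C x r := Real.sInf_nonneg (fun t ht => ht.1.le)
    rcases eq_or_lt_of_le hTb0 with he | hpos
    · rw [← he, intervalIntegral.integral_same]; exact hWz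
    · have hlt : ∀ t ∈ Set.Ioo 0 (Tbar C x r),
          (∫ τ in (0:ℝ)..t, l (x τ) (u τ)) ≤ W z / (p0 / 2) := by
        intro t ht
        rcases hm t ht.1.le with hg | hb
        · exact good_cost D hp0 hWpd hz hg
        · exfalso
          have : Tbar C x r ≤ t := csInf_le ⟨0, fun s hs => hs.1.le⟩ ⟨ht.1, hb⟩
          linarith [ht.2]
      by_cases hinteg : IntervalIntegrable (fun τ => l (x τ) (u τ)) volume 0 (Tbar C x r)
      · have hc : ContinuousOn (fun t => ∫ τ in (0:ℝ)..t, l (x τ) (u τ))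
            (Set.uIcc 0 (Tbar C x r)) := by
          apply intervalIntegral.continuousOn_primitive_interval
          exact (intervalIntegrable_iff' (by simp)).1 hinteg
        rw [Set.uIcc_of_le hpos.le] at hc
        have h1 := (hc _ (Set.right_mem_Icc.2 hpos.le)).mono (Set.Ioo_subset_Icc_self)
        have h2 := h1.tendsto
        rw [nhdsWithin_Ioo_eq_nhdsLT hpos] at h2
        apply le_of_tendsto h2
        filter_upwards [Ioo_mem_nhdsLT hpos] with t ht using hlt t ht
      · rw [intervalIntegral.integral_undef hinteg]; exact hWz

lemma euler_out (hC : IsClosed C) (hne : C.Nonempty) {X : ℝ → Euc n}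
    (hX : ContinuousOn X (Set.Ici 0)) (h0 : X 0 ∉ C) {t : ℝ} (ht : 0 ≤ t)
    (hte : ENNReal.ofReal t < exitTimeInf C X) : X t ∉ C := by
  intro hxt
  have hAc : IsCompact (Set.Icc 0 t ∩ X ⁻¹' C) := by
    apply isCompact_Icc.of_isClosed_subset _ Set.inter_subset_left
    exact (hX.mono Set.Icc_subset_Ici_self).preimage_isClosed_of_isClosed isClosed_Icc hC
  obtain ⟨s, hs, hmin⟩ := hAc.exists_isLeast ⟨t, ⟨ht, le_rfl⟩, hxt⟩
  have hspos : 0 < s := by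
    rcases eq_or_lt_of_le hs.1.1 with he | hlt
    · exfalso; apply h0; rw [he]; exact hs.2
    · exact hlt
  have hle : exitTimeInf C X ≤ ENNReal.ofReal s := by
    apply sInf_le
    refine ⟨ENNReal.ofReal_pos.2 hspos, ?_, ?_⟩
    · intro τ hτ hτs hxτ
      have h1 := (ENNReal.ofReal_lt_ofReal_iff hspos).1 hτs
      have h2 := hmin ⟨⟨hτ, h1.le.trans hs.1.2⟩, hxτ⟩
      linarith
    · rw [leftFilter, if_neg ENNReal.ofReal_ne_top, ENNReal.toReal_ofReal hspos.le]
      have h1 : ContinuousAt X s := hX.continuousAt (Ici_mem_nhds hspos)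
      have h2 : Tendsto (fun t => dC C (X t)) (𝓝 s) (𝓝 (dC C (X s))) :=
        ((dC_cont C).continuousAt.comp h1).tendsto
      have h3 : dC C (X s) = 0 := by
        apply le_antisymm _ (dC_nonneg C _)
        by_contra hc
        exact (dC_pos_iff hC hne (X s)).1 (not_le.1 hc) hs.2
      rw [h3] at h2
      exact h2.mono_left nhdsWithin_le_nhds
  have := hte.trans_le (hle.trans (ENNReal.ofReal_le_ofReal hs.1.2))
  exact lt_irrefl _ this

lemma euler_stab (D : FBData C U f l p0 W K V cr δf Mx) (hH1 : HypH1 C U f l)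
    (hne : C.Nonempty) (hp0 : 0 < p0)
    (hWc : ContinuousOn W (closure Cᶜ))
    (hWpd : PosDefOn C W) (hWpr : ProperOn C W) :
    EulerStabOn C U f l K Cᶜ (p0 / 2) W := by
  have hC := hH1.1
  obtain ⟨β, hβ, hgood⟩ := exists_beta D hH1 hne hp0 hWc hWpd hWpr
  refine ⟨β, hβ, ?_⟩
  intro z hz
  refine ⟨?_, ?_⟩
  · rintro X ⟨π, x, u, T, δi, hδi, hdiam, hsol, hlim⟩ t ht
    have hpt : Tendsto (fun i => dC C (x i t)) atTop (𝓝 (dC C (X t))) :=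
      ((dC_cont C).tendsto _).comp (hlim.tendsto_at ht)
    have key : ∀ r, 0 < r → dC C (X t) ≤ max (β (dC C z) t) r := by
      intro r hr
      obtain ⟨δ, hδ, hmain⟩ := samp_main D hH1 hne hp0 hWc hWpd hWpr (dC C z) hr
      apply le_of_tendsto hpt
      filter_upwards [hδi.eventually (gt_mem_nhds hδ)] with i hi
      rcases hmain (π i) (fun j => (hdiam i j).trans hi.le) z hz le_rfl _ _ _ (hsol i) t ht
        with hg | hb
      · exact (hgood z _ _ t _ ht hz le_rfl hg).trans (le_max_left _ _)
      · exact (hb t le_rfl).trans (le_max_right _ _)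
    by_contra hcon
    push Not at hcon
    have hb0 := hβ.nonneg (dC C z) t (dC_nonneg C z) ht
    have := key (dC C (X t) / 2) (by linarith)
    rcases le_max_iff.1 this with h | h <;> linarith
  · rintro X X0 ⟨π, x, u, T, δi, hδi, hdiam, hsol, hlim, hlim0⟩ t ht hte
    have hXc : ContinuousOn X (Set.Ici 0) :=
      hlim.continuousOn (Frequently.of_forall (fun i => (hsol i).cont))
    have hX0 : X 0 = z := by
      have h1 := hlim.tendsto_at (Set.mem_Ici.2 (le_refl (0:ℝ)))
      have h2 : Tendsto (fun i => x i 0) atTop (𝓝 z) := by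
        simp only [(hsol _).init]; exact tendsto_const_nhds
      exact tendsto_nhds_unique h1 h2
    have hout := euler_out hC hne hXc (by rw [hX0]; exact hz) ht hte
    have hd := (dC_pos_iff hC hne _).2 hout
    have hpt : Tendsto (fun i => dC C (x i t)) atTop (𝓝 (dC C (X t))) :=
      ((dC_cont C).tendsto _).comp (hlim.tendsto_at ht)
    obtain ⟨δ, hδ, hmain⟩ := samp_main D hH1 hne hp0 hWc hWpd hWpr (dC C z) (half_pos hd)
    apply le_of_tendsto (hlim0.tendsto_at ht)
    filter_upwards [hδi.eventually (gt_mem_nhds hδ),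
      hpt.eventually (lt_mem_nhds (half_lt_self hd))] with i hi hi2
    rcases hmain (π i) (fun j => (hdiam i j).trans hi.le) z hz le_rfl _ _ _ (hsol i) t ht
      with hg | hb
    · exact good_cost D hp0 hWpd hz hg
    · exact absurd (hb t le_rfl) (not_le.2 hi2)

end fin

/-- Corollary 4.4: under (H1), a Lipschitz continuous `p₀`-MRF with `p₀ > 0` yields a
locally bounded feedback that sample and Euler stabilizes the system to `C` with
`(p₀/2, W)`-regulated cost. -/
theorem lipschitz_mrf_implies_stabilizability_with_half_regulated_cost
    {n m : ℕ} (C : Set (Euc n)) (U : Set (Euc m))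
    (f : Euc n → Euc m → Euc n) (l : Euc n → Euc m → ℝ)
    (p0 : ℝ) (W W1 : Euc n → ℝ) (γt : ℝ → ℝ)
    (hH1 : HypH1 C U f l) (hp0 : 0 < p0)
    (hWc : ContinuousOn W (closure Cᶜ)) (hWnn : ∀ x ∈ closure Cᶜ, 0 ≤ W x)
    (hWlip : LocLipschitzOn (closure Cᶜ) W)
    (hWpd : PosDefOn C W) (hWpr : ProperOn C W)
    (hγ : RateFun γt)
    (hW1c : ContinuousOn W1 (closure Cᶜ)) (hW1nn : ∀ x ∈ closure Cᶜ, 0 ≤ W1 x)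
    (hW1pd : PosDefOn C W1) (hW1pr : ProperOn C W1)
    (hdec : ∀ x, x ∉ C → ∀ p ∈ proxSubdiff W x, Ham U f l p0 x p ≤ -γt (W1 x)) :
    ∃ K : Euc n → Euc m, IsFeedback C U K ∧
      SampleStabOn C U f l K Cᶜ (p0 / 2) W ∧
      EulerStabOn C U f l K Cᶜ (p0 / 2) W := by
  have hne := target_nonempty hH1 hp0 hWc hWpd hWpr hγ hW1pd hdec
  obtain ⟨K, V, cr, δf, Mx, h1, h2, h3, h4⟩ :=
    exists_feedback hH1 hne hp0 hWc hWnn hWlip hWpd hWpr hγ hW1c hW1pd hdec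
  have D : FBData C U f l p0 W K V cr δf Mx := ⟨h1, h2, h3, h4⟩
  exact ⟨K, h1, sample_stab D hH1 hne hp0 hWc hWpd hWpr,
    euler_stab D hH1 hne hp0 hWc hWpd hWpr⟩
end
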